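/- Let A be a unital separable simple C*-algebra with TR(A) = 0 and with a unique tracial state. If α is an automorphism of A such that α^m is uniformly outer for every nonzero integer m, then α has the tracial Rokhlin property. -/

import Mathlib

open Filter Topology

/-- A projection in a C*-algebra: a self-adjoint idempotent. -/
def IsProjection {A : Type*} [Mul A] [Star A] (p : A) : Prop :=
  IsSelfAdjoint p ∧ IsIdempotentElem p

/-- A positive element of a C*-algebra (one of the standard equivalent definitions). -/
def IsPos {A : Type*} [Mul A] [Star A] (a : A) : Prop :=
  ∃ b : A, a = star b * b

/-- A central sequence: asymptotically commutes with every element. -/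
def IsCentralSeq {A : Type*} [CStarAlgebra A] (x : ℕ → A) : Prop :=
  ∀ a : A, Tendsto (fun n => ‖x n * a - a * x n‖) atTop (nhds 0)

/-- An approximately inner map: on every finite set it is approximated by `a ↦ v* a v`
for unitaries `v`. -/
def ApproxInner {A : Type*} [CStarAlgebra A] (f : A → A) : Prop :=
  ∀ (F : Finset A) (ε : ℝ), 0 < ε →
    ∃ v : A, v ∈ unitary A ∧ ∀ a ∈ F, ‖f a - star v * a * v‖ < ε

/-- Murray–von Neumann equivalence of projections. -/
def MvNEquiv {A : Type*} [CStarAlgebra A] (p q : A) : Prop :=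
  ∃ w : A, star w * w = p ∧ w * star w = q

/-- `[a] ≤ [b]`: there is `x` with `a = x*x` and `xx*` in the closure of `bAb`. -/
def CuntzLE {A : Type*} [CStarAlgebra A] (a b : A) : Prop :=
  ∃ x : A, a = star x * x ∧ x * star x ∈ closure (Set.range fun c => b * c * b)

/-- A simple C*-algebra: the only closed two-sided ideals are trivial. -/
def IsSimpleCStar (A : Type*) [CStarAlgebra A] : Prop :=
  ∀ I : TwoSidedIdeal A, IsClosed (I : Set A) →
    (I : Set A) = {0} ∨ (I : Set A) = Set.univ

/-- A tracial state on a unital C*-algebra. -/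
def IsTracialState {A : Type*} [CStarAlgebra A] (τ : A →ₗ[ℂ] ℂ) : Prop :=
  (∀ a : A, ∃ r : ℝ, 0 ≤ r ∧ τ (star a * a) = (r : ℂ)) ∧
  τ 1 = 1 ∧ ∀ a b : A, τ (a * b) = τ (b * a)

/-- The SP-property: every hereditary subalgebra `\overline{aAa}` (`a` positive nonzero)
contains a nonzero projection. -/
def SPProperty (A : Type*) [CStarAlgebra A] : Prop :=
  ∀ a : A, IsPos a → a ≠ 0 →
    ∃ p : A, IsProjection p ∧ p ≠ 0 ∧ p ∈ closure (Set.range fun c => a * c * a)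

/-- Stable rank one: invertibles are dense. -/
def StableRankOne (A : Type*) [CStarAlgebra A] : Prop :=
  Dense {x : A | IsUnit x}

/-- The Fundamental Comparison Property. -/
def FundamentalComparison (A : Type*) [CStarAlgebra A] : Prop :=
  ∀ p q : A, IsProjection p → IsProjection q →
    (∀ τ : A →ₗ[ℂ] ℂ, IsTracialState τ → (τ p).re < (τ q).re) →
    ∃ q' : A, IsProjection q' ∧ q' * q = q' ∧ q * q' = q' ∧ MvNEquiv p q'

/-- Tracial (topological) rank zero for a simple unital C*-algebra. -/
def TracialRankZero (A : Type*) [CStarAlgebra A] : Prop :=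
  ∀ (F : Finset A) (ε : ℝ), 0 < ε → ∀ a : A, IsPos a → a ≠ 0 →
    ∃ (B : NonUnitalStarSubalgebra ℂ A) (p : A),
      FiniteDimensional ℂ B ∧ IsProjection p ∧ p ∈ B ∧
      (∀ b ∈ B, p * b = b ∧ b * p = b) ∧
      (∀ x ∈ F, ‖x * p - p * x‖ < ε) ∧
      (∀ x ∈ F, ∃ b ∈ B, ‖p * x * p - b‖ < ε) ∧
      CuntzLE (1 - p) a

/-- The tracial Rokhlin property for an automorphism. -/
def TracialRokhlin {A : Type*} [CStarAlgebra A] (α : A ≃⋆ₐ[ℂ] A) : Prop :=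
  ∀ (F : Finset A) (ε : ℝ), 0 < ε → ∀ n : ℕ, ∀ x : A, IsPos x → x ≠ 0 →
    ∃ e : Fin (n + 1) → A,
      (∀ j, IsProjection (e j)) ∧
      (∀ i j, i ≠ j → e i * e j = 0) ∧
      (∀ j : Fin (n + 1), (j : ℕ) < n → ‖α (e j) - e (j + 1)‖ < ε) ∧
      (∀ j, ∀ a ∈ F, ‖e j * a - a * e j‖ < ε) ∧
      CuntzLE (1 - ∑ j, e j) x

/-- The tracial cyclic Rokhlin property for an automorphism: as the tracial
Rokhlin property, but with the cyclic condition `‖α(e n) - e 0‖ < ε` included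
(in `Fin (n+1)`, `j + 1` wraps around, so `e (n + 1) = e 0`). -/
def TracialCyclicRokhlin {A : Type*} [CStarAlgebra A] (α : A ≃⋆ₐ[ℂ] A) : Prop :=
  ∀ (F : Finset A) (ε : ℝ), 0 < ε → ∀ n : ℕ, ∀ x : A, IsPos x → x ≠ 0 →
    ∃ e : Fin (n + 1) → A,
      (∀ j, IsProjection (e j)) ∧
      (∀ i j, i ≠ j → e i * e j = 0) ∧
      (∀ j : Fin (n + 1), ‖α (e j) - e (j + 1)‖ < ε) ∧
      (∀ j, ∀ a ∈ F, ‖e j * a - a * e j‖ < ε) ∧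
      CuntzLE (1 - ∑ j, e j) x

/-- Integer powers of an automorphism, as a function. -/
def autZPow {A : Type*} [CStarAlgebra A] (α : A ≃⋆ₐ[ℂ] A) (m : ℤ) : A → A :=
  if 0 ≤ m then (⇑α)^[m.toNat] else (⇑α.symm)^[(-m).toNat]

/-- A uniformly outer map. -/
def UniformlyOuter {A : Type*} [CStarAlgebra A] (f : A → A) : Prop :=
  ∀ (a p : A), IsProjection p → ∀ ε : ℝ, 0 < ε →
    ∃ (n : ℕ) (q : Fin n → A),
      (∀ i, IsProjection (q i)) ∧ (∑ i, q i) = p ∧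
      ∀ i, ‖q i * a * f (q i)‖ < ε


set_option linter.unusedSectionVars false

section basics
variable {A : Type*} [CStarAlgebra A] [PartialOrder A] [StarOrderedRing A]

theorem IsProjection.st {p : A} (h : IsProjection p) : star p = p := h.1.star_eq
theorem IsProjection.mm {p : A} (h : IsProjection p) : p * p = p := h.2.eq

theorem isProjection_of {p : A} (h1 : star p = p) (h2 : p * p = p) : IsProjection p := ⟨h1, h2⟩

theorem IsProjection.nonneg' {p : A} (h : IsProjection p) : 0 ≤ p := by
  have := star_mul_self_nonneg p
  rwa [h.st, h.mm] at this

theorem IsProjection.compl {p : A} (h : IsProjection p) : IsProjection (1 - p) := by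
  refine isProjection_of (by simp [h.st]) ?_
  have := h.mm
  simp [mul_sub, sub_mul, this]

theorem IsProjection.le_one' {p : A} (h : IsProjection p) : p ≤ 1 :=
  sub_nonneg.1 h.compl.nonneg'

theorem isProjection_zero : IsProjection (0 : A) := isProjection_of (by simp) (by simp)
theorem isProjection_one : IsProjection (1 : A) := isProjection_of (by simp) (by simp)

theorem norm_le_one_of {a : A} (h0 : 0 ≤ a) (h1 : a ≤ 1) : ‖a‖ ≤ 1 :=
  (CStarAlgebra.norm_le_one_iff_of_nonneg a h0).2 h1

theorem IsProjection.norm_le {p : A} (h : IsProjection p) : ‖p‖ ≤ 1 :=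
  norm_le_one_of h.nonneg' h.le_one'

theorem norm_le_of_le_smul {a : A} {r : ℝ} (hr : 0 ≤ r) (h0 : 0 ≤ a) (h1 : a ≤ r • (1 : A)) :
    ‖a‖ ≤ r := by
  rw [CStarAlgebra.norm_le_iff_le_algebraMap a hr h0, Algebra.algebraMap_eq_smul_one]; exact h1

theorem sa_le_smul {a : A} {r : ℝ} (h : star a = a) (hr : ‖a‖ ≤ r) : a ≤ r • (1 : A) := by
  have h1 := IsSelfAdjoint.le_algebraMap_norm_self (a := a) h
  rw [Algebra.algebraMap_eq_smul_one] at h1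
  refine h1.trans ?_
  have : 0 ≤ (r - ‖a‖) • (1 : A) := smul_nonneg (by linarith) zero_le_one
  rw [sub_smul] at this
  exact sub_nonneg.1 this

theorem neg_smul_le_sa {a : A} {r : ℝ} (h : star a = a) (hr : ‖a‖ ≤ r) : -(r • (1 : A)) ≤ a := by
  have := sa_le_smul (a := -a) (r := r) (by simp [h]) (by simpa using hr)
  exact neg_le.1 this

theorem conj_nonneg' {a : A} (h : 0 ≤ a) (c : A) : 0 ≤ star c * a * c :=
  star_left_conjugate_nonneg h c

theorem conj_nonneg_r {a : A} (h : 0 ≤ a) (c : A) : 0 ≤ c * a * star c :=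
  star_right_conjugate_nonneg h c

theorem conj_mono {a b : A} (h : a ≤ b) (c : A) : star c * a * c ≤ star c * b * c :=
  star_left_conjugate_le_conjugate h c

theorem conj_mono_r {a b : A} (h : a ≤ b) (c : A) : c * a * star c ≤ c * b * star c :=
  star_right_conjugate_le_conjugate h c

theorem sa_of_nonneg {a : A} (h : 0 ≤ a) : star a = a := (IsSelfAdjoint.of_nonneg h).star_eq

theorem exists_sqrt {a : A} (h : 0 ≤ a) : ∃ s : A, 0 ≤ s ∧ s * s = a :=
  ⟨CFC.sqrt a, CFC.sqrt_nonneg a, CFC.sqrt_mul_sqrt_self a h⟩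

theorem smul_one_mono2 {r s : ℝ} (h : r ≤ s) : r • (1 : A) ≤ s • (1 : A) := by
  have : 0 ≤ (s - r) • (1 : A) := smul_nonneg (by linarith) zero_le_one
  rw [sub_smul] at this
  exact sub_nonneg.1 this

theorem IsPos.nonneg {a : A} (h : IsPos a) : 0 ≤ a := by
  obtain ⟨b, rfl⟩ := h; exact star_mul_self_nonneg b

theorem IsProjection.isPos {p : A} (h : IsProjection p) : IsPos p := ⟨p, by rw [h.st, h.mm]⟩

/-- (ab=a, a, b) sub projection facts -/
theorem IsProjection.le_of_mul {p q : A} (hp : IsProjection p) (hq : IsProjection q)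
    (h : q * p = p) : p ≤ q := by
  have h2 : p * q = p := by
    have := congrArg star h
    simpa [hp.st, hq.st] using this
  have : IsProjection (q - p) := by
    refine isProjection_of (by simp [hp.st, hq.st]) ?_
    simp [mul_sub, sub_mul, hp.mm, hq.mm, h, h2]
  exact sub_nonneg.1 this.nonneg'

theorem IsProjection.add' {p q : A} (hp : IsProjection p) (hq : IsProjection q)
    (h : q * p = 0) : IsProjection (p + q) := by
  have h2 : p * q = 0 := by
    have := congrArg star h
    simpa [hp.st, hq.st] using this
  refine isProjection_of (by simp [hp.st, hq.st]) ?_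
  simp [mul_add, add_mul, hp.mm, hq.mm, h, h2]

theorem IsProjection.sub' {p q : A} (hp : IsProjection p) (hq : IsProjection q)
    (h : q * p = p) : IsProjection (q - p) := by
  have h2 : p * q = p := by
    have := congrArg star h
    simpa [hp.st, hq.st] using this
  refine isProjection_of (by simp [hp.st, hq.st]) ?_
  simp [mul_sub, sub_mul, hp.mm, hq.mm, h, h2]

theorem IsProjection.sum' {ι : Type*} (s : Finset ι) (q : ι → A) (h : ∀ i ∈ s, IsProjection (q i))
    (ho : ∀ i ∈ s, ∀ j ∈ s, i ≠ j → q i * q j = 0) : IsProjection (∑ i ∈ s, q i) := by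
  classical
  refine isProjection_of (by rw [star_sum]; exact Finset.sum_congr rfl fun i hi => (h i hi).st) ?_
  rw [Finset.sum_mul_sum]
  refine Finset.sum_congr rfl fun i hi => ?_
  rw [Finset.sum_eq_single_of_mem i hi fun j hj hne => ho i hi j hj hne.symm, (h i hi).mm]

theorem mul_eq_zero_of_conj {p a : A} (ha : 0 ≤ a) (h : star p * a * p = 0) : a * p = 0 := by
  obtain ⟨s, hs, rfl⟩ := exists_sqrt ha
  have : star (s * p) * (s * p) = 0 := by
    rw [star_mul, sa_of_nonneg hs]; simpa [mul_assoc] using h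
  rw [mul_assoc, (CStarRing.star_mul_self_eq_zero_iff (s * p)).1 this, mul_zero]

/-- projections summing to a projection are orthogonal -/
theorem proj_orth_of_sum {ι : Type*} (s : Finset ι) (q : ι → A) (p : A)
    (h : ∀ i ∈ s, IsProjection (q i)) (hp : IsProjection p) (hs : ∑ i ∈ s, q i = p) :
    ∀ i ∈ s, ∀ j ∈ s, i ≠ j → q i * q j = 0 := by
  classical
  intro i hi j hj hij
  have h1 : q i + q j ≤ p := by
    rw [← hs, ← Finset.add_sum_erase s q hi,
      ← Finset.add_sum_erase (s.erase i) q (Finset.mem_erase.2 ⟨hij.symm, hj⟩), ← add_assoc]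
    refine le_add_of_nonneg_right (Finset.sum_nonneg fun k hk => (h k ?_).nonneg')
    exact Finset.mem_of_mem_erase (Finset.mem_of_mem_erase hk)
  have h2 := conj_mono (h1.trans hp.le_one') (q j)
  have hj' := h j hj
  simp only [mul_add, add_mul, hj'.st, hj'.mm, mul_one] at h2
  have h3 : star (q j) * q i * q j ≤ 0 := by
    rw [hj'.st]; exact le_of_add_le_add_right (h2.trans (by simp))
  exact mul_eq_zero_of_conj (h i hi).nonneg'
    (le_antisymm h3 (conj_nonneg' (h i hi).nonneg' _))

theorem sub_of_sum {ι : Type*} (s : Finset ι) (q : ι → A) (p : A)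
    (h : ∀ i ∈ s, IsProjection (q i)) (hp : IsProjection p) (hs : ∑ i ∈ s, q i = p) :
    ∀ i ∈ s, p * q i = q i ∧ q i * p = q i := by
  classical
  intro i hi
  have ho := proj_orth_of_sum s q p h hp hs
  constructor
  · rw [← hs, Finset.sum_mul, Finset.sum_eq_single_of_mem i hi fun j hj hne => ho j hj i hi hne,
      (h i hi).mm]
  · rw [← hs, Finset.mul_sum,
      Finset.sum_eq_single_of_mem i hi fun j hj hne => ho i hi j hj hne.symm, (h i hi).mm]

/-- real trace -/
structure IsTr (T : A →ₗ[ℝ] ℝ) : Prop where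
  pos : ∀ x : A, 0 ≤ T (star x * x)
  one : T 1 = 1
  comm : ∀ x y : A, T (x * y) = T (y * x)
  tstar : ∀ x : A, T (star x) = T x

noncomputable def n2 (T : A →ₗ[ℝ] ℝ) (x : A) : ℝ := Real.sqrt (T (star x * x))

end basics

section traces
variable {A : Type*} [CStarAlgebra A] [PartialOrder A] [StarOrderedRing A]
variable {T : A →ₗ[ℝ] ℝ}

theorem IsTr.nonneg (h : IsTr T) {x : A} (hx : 0 ≤ x) : 0 ≤ T x := by
  obtain ⟨b, rfl⟩ := CStarAlgebra.nonneg_iff_eq_star_mul_self.1 hx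
  exact h.pos b

theorem IsTr.mono (h : IsTr T) {x y : A} (hx : x ≤ y) : T x ≤ T y := by
  have := h.nonneg (sub_nonneg.2 hx)
  rw [map_sub] at this; linarith

theorem IsTr.smul_one (h : IsTr T) (r : ℝ) : T (r • (1 : A)) = r := by
  rw [map_smul, h.one]; simp

theorem IsTr.mul_nn (h : IsTr T) {x y : A} (hx : 0 ≤ x) (hy : 0 ≤ y) : 0 ≤ T (x * y) := by
  obtain ⟨b, rfl⟩ := CStarAlgebra.nonneg_iff_eq_star_mul_self.1 hy
  rw [← mul_assoc, h.comm, ← mul_assoc]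
  exact h.nonneg (conj_nonneg_r hx b)

theorem IsTr.mul_mono_l (h : IsTr T) {x y z : A} (hz : 0 ≤ z) (hxy : x ≤ y) :
    T (z * x) ≤ T (z * y) := by
  have := h.mul_nn hz (sub_nonneg.2 hxy)
  rw [mul_sub, map_sub] at this; linarith

theorem IsTr.mul_mono_r (h : IsTr T) {x y z : A} (hz : 0 ≤ z) (hxy : x ≤ y) :
    T (x * z) ≤ T (y * z) := by
  rw [h.comm x, h.comm y]; exact h.mul_mono_l hz hxy

theorem n2_nonneg (x : A) : 0 ≤ n2 T x := Real.sqrt_nonneg _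

theorem IsTr.n2_sq (h : IsTr T) (x : A) : n2 T x ^ 2 = T (star x * x) := Real.sq_sqrt (h.pos x)

theorem IsTr.cs (h : IsTr T) (x y : A) : |T (star x * y)| ≤ n2 T x * n2 T y := by
  have key : ∀ t : ℝ, 0 ≤ T (star x * x) * (t * t) + (2 * T (star x * y)) * t + T (star y * y) := by
    intro t
    have h1 := h.pos (t • x + y)
    have h2 : T (star y * x) = T (star x * y) := by rw [← h.tstar, star_mul, star_star]
    have : star (t • x + y) * (t • x + y) =
        (t * t) • (star x * x) + t • (star x * y) + t • (star y * x) + star y * y := by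
      simp [add_mul, mul_add, smul_smul]; abel
    rw [this] at h1
    simp only [map_add, map_smul, smul_eq_mul, h2] at h1
    linarith
  have hd := discrim_le_zero key
  rw [discrim] at hd
  rw [n2, n2, ← Real.sqrt_mul (h.pos x)]
  apply Real.abs_le_sqrt
  nlinarith

theorem IsTr.n2_add (h : IsTr T) (x y : A) : n2 T (x + y) ≤ n2 T x + n2 T y := by
  have h2 : T (star y * x) = T (star x * y) := by rw [← h.tstar, star_mul, star_star]
  have h1 := (abs_le.1 (h.cs x y)).2
  have h3 : n2 T (x + y) ^ 2 ≤ (n2 T x + n2 T y) ^ 2 := by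
    rw [h.n2_sq, add_sq, h.n2_sq, h.n2_sq]
    simp only [star_add, add_mul, mul_add, map_add, h2]
    linarith
  exact (sq_le_sq₀ (n2_nonneg _) (add_nonneg (n2_nonneg _) (n2_nonneg _))).1 h3

theorem IsTr.n2_neg (x : A) : n2 T (-x) = n2 T x := by simp [n2]

theorem IsTr.n2_star (h : IsTr T) (x : A) : n2 T (star x) = n2 T x := by
  simp only [n2, star_star]; rw [h.comm]

theorem star_mul_le (c x : A) : star (c * x) * (c * x) ≤ (‖c‖ ^ 2) • (star x * x) := by
  have h1 : star c * c ≤ (‖c‖ ^ 2) • (1 : A) :=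
    sa_le_smul (by simp) (by rw [CStarRing.norm_star_mul_self, sq])
  have := conj_mono h1 x
  rw [star_mul]
  calc star x * star c * (c * x) = star x * (star c * c) * x := by simp only [mul_assoc]
    _ ≤ _ := this
    _ = _ := by simp

theorem IsTr.n2_mul_le (h : IsTr T) (c x : A) : n2 T (c * x) ≤ ‖c‖ * n2 T x := by
  have h1 := h.mono (star_mul_le c x)
  rw [map_smul, smul_eq_mul] at h1
  refine (sq_le_sq₀ (n2_nonneg _) (mul_nonneg (norm_nonneg _) (n2_nonneg _))).1 ?_
  rw [mul_pow, h.n2_sq, h.n2_sq]; exact h1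

theorem IsTr.abs_mul_le (h : IsTr T) (x : A) {z : A} (hz : 0 ≤ z) : |T (x * z)| ≤ ‖x‖ * T z := by
  obtain ⟨s, hs, rfl⟩ := exists_sqrt hz
  have hst := sa_of_nonneg hs
  have h1 := h.cs s (x * s)
  have h2 := h.n2_mul_le x s
  have h3 : T (x * (s * s)) = T (star s * (x * s)) := by
    rw [hst, ← mul_assoc, h.comm]
  rw [h3]
  have h4 := h.n2_sq s
  rw [hst] at h4
  rw [← h4]
  have := n2_nonneg (T := T) s
  nlinarith

theorem IsTr.abs_mul_le' (h : IsTr T) (x : A) {z : A} (hz : 0 ≤ z) : |T (z * x)| ≤ ‖x‖ * T z := by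
  rw [h.comm]; exact h.abs_mul_le x hz

theorem IsTr.abs_le (h : IsTr T) (x : A) : |T x| ≤ ‖x‖ := by
  have := h.abs_mul_le x (zero_le_one (α := A))
  simpa [h.one] using this

theorem IsTr.le_one (h : IsTr T) {x : A} (hx : x ≤ 1) : T x ≤ 1 := by
  have := h.mono hx; rwa [h.one] at this

end traces

set_option linter.unusedSectionVars false

theorem inv_sqrt_real {t d : ℝ} (hd : d ≤ 1 / 4) (h3 : 1 - d ≤ t) (h4 : t ≤ 1) :
    |(Real.sqrt t)⁻¹ - 1| ≤ d := by
  have h5 : 0 < t := by linarith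
  have h6 : (1:ℝ)/2 ≤ Real.sqrt t := Real.le_sqrt_of_sq_le (by norm_num; linarith)
  have h7 := Real.mul_self_sqrt h5.le
  have h8 : Real.sqrt t ≤ 1 := Real.sqrt_le_one.2 h4
  have h9 : 1 ≤ (Real.sqrt t)⁻¹ := (one_le_inv₀ (by linarith)).2 h8
  rw [abs_of_nonneg (by linarith)]
  have h10 : (Real.sqrt t)⁻¹ * Real.sqrt t = 1 := inv_mul_cancel₀ (by linarith)
  generalize Real.sqrt t = s at *
  generalize s⁻¹ = i at *
  have h11 : (3:ℝ)/4 ≤ s := by nlinarith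
  have h12 : i ≤ 1 + s := by
    by_contra hcon
    push Not at hcon
    have := mul_lt_mul_of_pos_right hcon (show 0 < s by linarith)
    nlinarith
  have h13 : i - 1 = i * (1 - s) := by rw [mul_sub, h10, mul_one]
  have h14 : i * (1 - s) ≤ (1 + s) * (1 - s) := mul_le_mul_of_nonneg_right h12 (by linarith)
  nlinarith

section pol
variable {A : Type*} [CStarAlgebra A] [PartialOrder A] [StarOrderedRing A]

theorem exists_inv_sqrt {h : A} (hsa : star h = h) {c : ℝ} (hc : 0 < c) (hle : c • (1 : A) ≤ h) :
    ∃ k : A, star k = k ∧ k * h * k = 1 ∧ (∀ z, h * z = z * h → k * z = z * k) ∧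
      (∀ d : ℝ, 0 ≤ d → d ≤ 1 / 4 → (1 - d) • (1 : A) ≤ h → h ≤ 1 → ‖k - 1‖ ≤ d) := by
  have hsa' : IsSelfAdjoint h := hsa
  have hsp : ∀ t ∈ spectrum ℝ h, c ≤ t := by
    rw [← algebraMap_le_iff_le_spectrum (a := h), Algebra.algebraMap_eq_smul_one]; exact hle
  have hcont : ContinuousOn (fun t : ℝ => (Real.sqrt t)⁻¹) (spectrum ℝ h) := by
    apply ContinuousOn.inv₀ (Real.continuous_sqrt.continuousOn)
    intro t ht
    exact (Real.sqrt_pos.2 (lt_of_lt_of_le hc (hsp t ht))).ne'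
  refine ⟨cfc (fun t : ℝ => (Real.sqrt t)⁻¹) h, (cfc_predicate (p := IsSelfAdjoint) (fun t : ℝ => (Real.sqrt t)⁻¹) h).star_eq, ?_, ?_, ?_⟩
  · nth_rw 2 [← cfc_id' ℝ h]
    rw [← cfc_mul .., ← cfc_mul .., ← cfc_one ℝ h]
    apply cfc_congr
    intro t ht
    have h1 := Real.sqrt_pos.2 (lt_of_lt_of_le hc (hsp t ht))
    have h2 := Real.mul_self_sqrt (lt_of_lt_of_le hc (hsp t ht)).le
    simp only [Pi.one_apply]
    field_simp
    nlinarith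
  · intro z hz
    exact (Commute.cfc_real (show Commute h z from hz) _).eq
  · intro d hd0 hd h1 h2
    have hsp1 : ∀ t ∈ spectrum ℝ h, 1 - d ≤ t := by
      rw [← algebraMap_le_iff_le_spectrum (a := h), Algebra.algebraMap_eq_smul_one]; exact h1
    have hsp2 : ∀ t ∈ spectrum ℝ h, t ≤ 1 := by
      rw [← le_algebraMap_iff_spectrum_le (a := h), Algebra.algebraMap_eq_smul_one, one_smul]
      exact h2
    rw [← cfc_one ℝ h, ← cfc_sub ..]
    refine norm_cfc_le hd0 fun t ht => ?_
    have h3 := hsp1 t ht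
    have h4 := hsp2 t ht
    simp only [Pi.one_apply, Real.norm_eq_abs]
    exact inv_sqrt_real hd h3 h4

/-- polar decomposition in a corner -/
theorem pol {ψ y : A} (hψ : IsProjection ψ) (hy : y * ψ = y) {c : ℝ} (hc : 0 < c)
    (hle : c • ψ ≤ star y * y) : ∃ w k : A, star w * w = ψ ∧ w = y * k ∧ k * ψ = ψ * k ∧
      star k = k := by
  have hy2 : ψ * star y = star y := by
    have := congrArg star hy
    simpa [hψ.st] using this
  have hsa : star (star y * y + (1 - ψ)) = star y * y + (1 - ψ) := by simp [hψ.st]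
  have hc' : 0 < min c 1 := lt_min hc one_pos
  have hge : (min c 1) • (1 : A) ≤ star y * y + (1 - ψ) := by
    have h1 : (min c 1) • ψ ≤ star y * y :=
      le_trans (smul_le_smul_of_nonneg_right (min_le_left _ _) hψ.nonneg') hle
    have h2 : (min c 1) • (1 - ψ) ≤ (1 - ψ) := by
      have := smul_le_smul_of_nonneg_right (min_le_right c 1) hψ.compl.nonneg'
      rwa [one_smul] at this
    have := add_le_add h1 h2
    rwa [← smul_add, add_sub_cancel] at this
  obtain ⟨k, hk1, hk2, hk3, -⟩ := exists_inv_sqrt hsa hc' hge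
  have e1 : (star y * y + (1 - ψ)) * ψ = star y * y := by
    rw [add_mul, mul_assoc, hy, sub_mul, hψ.mm, one_mul, sub_self, add_zero]
  have e2 : ψ * (star y * y + (1 - ψ)) = star y * y := by
    rw [mul_add, ← mul_assoc, hy2, mul_sub, hψ.mm, mul_one, sub_self, add_zero]
  have e3 := hk3 ψ (e1.trans e2.symm)
  refine ⟨y * k, k, ?_, rfl, e3, hk1⟩
  rw [star_mul, hk1]
  calc k * star y * (y * k) = k * (star y * y) * k := by simp only [mul_assoc]
    _ = k * ((star y * y + (1 - ψ)) * ψ) * k := by rw [e1]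
    _ = k * (star y * y + (1 - ψ)) * (k * ψ) := by rw [e3]; simp only [mul_assoc]
    _ = ψ := by rw [← mul_assoc, hk2, one_mul]

theorem norm_partial_iso {w χ : A} (hχ : IsProjection χ) (hw : star w * w = χ) : ‖w‖ ≤ 1 := by
  have := hχ.norm_le
  rw [← hw, CStarRing.norm_star_mul_self] at this
  nlinarith [norm_nonneg w]

theorem partial_iso_proj {w χ : A} (hχ : IsProjection χ) (hw : star w * w = χ) :
    w * χ = w ∧ IsProjection (w * star w) := by
  have h1 : w * χ = w := by
    have : star (w * χ - w) * (w * χ - w) = 0 := by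
      simp only [star_sub, star_mul, hχ.st, sub_mul, mul_sub]
      have e1 : χ * star w * (w * χ) = χ := by
        rw [mul_assoc, ← mul_assoc (star w), hw, hχ.mm, hχ.mm]
      have e2 : χ * star w * w = χ := by rw [mul_assoc, hw, hχ.mm]
      have e3 : star w * (w * χ) = χ := by rw [← mul_assoc, hw, hχ.mm]
      rw [e1, e2, e3, hw]; simp
    exact sub_eq_zero.1 ((CStarRing.star_mul_self_eq_zero_iff _).1 this)
  refine ⟨h1, isProjection_of (by simp) ?_⟩
  rw [mul_assoc, ← mul_assoc (star w), hw, ← mul_assoc, h1]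

/-- perturbation lemma -/
theorem pert {χ q : A} (hχ : IsProjection χ) (hq : IsProjection q) {δ : ℝ} (hδ : δ ≤ 1 / 2)
    (h : ‖χ - q * χ‖ ≤ δ) : ∃ w : A, star w * w = χ ∧ q * w = w ∧ ‖w - χ‖ ≤ 2 * δ ∧
      ‖w * star w - χ‖ ≤ 4 * δ := by
  have hδ0 : 0 ≤ δ := (norm_nonneg _).trans h
  have hd2 : δ ^ 2 ≤ 1 / 4 := by nlinarith
  set z := χ - q * χ with hz
  have hzz : star z * z = χ - χ * q * χ := by
    simp only [hz, star_sub, star_mul, hχ.st, hq.st, sub_mul, mul_sub, hχ.mm]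
    have : χ * q * (q * χ) = χ * q * χ := by rw [mul_assoc, ← mul_assoc q, hq.mm, mul_assoc]
    rw [this, ← mul_assoc]; simp
  have hzn : star z * z ≤ (δ ^ 2) • (1 : A) :=
    sa_le_smul (by simp) (by rw [CStarRing.norm_star_mul_self]; nlinarith [norm_nonneg z])
  have hz0 : 0 ≤ star z * z := star_mul_self_nonneg z
  set g := 1 - star z * z with hg
  have hgsa : star g = g := by simp [hg]
  have hg1 : (1 - δ ^ 2) • (1 : A) ≤ g := by
    rw [sub_smul, one_smul]; exact sub_le_sub_left hzn 1
  have hg2 : g ≤ 1 := sub_le_self _ hz0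
  obtain ⟨k, hk1, hk2, hk3, hk4⟩ := exists_inv_sqrt hgsa (c := 1 - δ ^ 2) (by linarith) hg1
  have hkn := hk4 (δ ^ 2) (by positivity) hd2 hg1 hg2
  have e1 : g * χ = χ * q * χ := by
    rw [hg, hzz, sub_mul, sub_mul, mul_assoc _ χ χ, hχ.mm]; simp
  have e2 : χ * g = χ * q * χ := by
    rw [hg, hzz, mul_sub, mul_sub, ← mul_assoc χ, ← mul_assoc χ, hχ.mm]; simp
  have e3 := hk3 χ (e1.trans e2.symm)
  have hw : star (q * χ * k) * (q * χ * k) = χ := by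
    simp only [star_mul, hk1, hχ.st, hq.st]
    calc k * (χ * q) * (q * χ * k) = k * (χ * (q * q) * χ) * k := by simp only [mul_assoc]
      _ = k * (g * χ) * k := by rw [hq.mm, e1]
      _ = k * g * (k * χ) := by rw [e3]; simp only [mul_assoc]
      _ = χ := by rw [← mul_assoc, hk2, one_mul]
  have hwn := norm_partial_iso hχ hw
  have hn : ‖q * χ * k - χ‖ ≤ 2 * δ := by
    have : q * χ * k - χ = q * (χ * (k - 1)) + (q * χ - χ) := by
      simp only [mul_sub, mul_one, mul_assoc]; abel
    rw [this]
    have n1 : ‖q * (χ * (k - 1))‖ ≤ δ ^ 2 := by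
      refine (norm_mul_le _ _).trans ?_
      have := norm_mul_le χ (k - 1)
      have a1 := hq.norm_le
      have a2 := hχ.norm_le
      have b1 : ‖χ‖ * ‖k - 1‖ ≤ ‖k - 1‖ := mul_le_of_le_one_left (norm_nonneg _) a2
      have b2 : ‖q‖ * ‖χ * (k - 1)‖ ≤ ‖χ * (k - 1)‖ := mul_le_of_le_one_left (norm_nonneg _) a1
      linarith
    have n2 : ‖q * χ - χ‖ ≤ δ := by rw [norm_sub_rev]; exact h
    have := norm_add_le (q * (χ * (k - 1))) (q * χ - χ)
    nlinarith
  refine ⟨q * χ * k, hw, ?_, hn, ?_⟩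
  · rw [← mul_assoc, ← mul_assoc, hq.mm]
  · set w := q * χ * k
    have : w * star w - χ = (w - χ) * star w + χ * star (w - χ) := by
      simp only [star_sub, hχ.st, sub_mul, mul_sub, hχ.mm]; abel
    rw [this]
    have n1 : ‖(w - χ) * star w‖ ≤ 2 * δ := by
      refine (norm_mul_le _ _).trans ?_
      rw [norm_star]
      exact (mul_le_of_le_one_right (norm_nonneg _) hwn).trans hn
    have n2 : ‖χ * star (w - χ)‖ ≤ 2 * δ := by
      refine (norm_mul_le _ _).trans ?_
      rw [norm_star]
      exact (mul_le_of_le_one_left (norm_nonneg _) hχ.norm_le).trans hn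
    have := norm_add_le ((w - χ) * star w) (χ * star (w - χ))
    linarith

end pol

section findim
variable {A : Type*} [CStarAlgebra A] [PartialOrder A] [StarOrderedRing A]
variable (B : NonUnitalStarSubalgebra ℂ A) [FiniteDimensional ℂ B]

theorem fd_closed : IsClosed (B : Set A) := by
  have h : FiniteDimensional ℂ B.toNonUnitalSubalgebra.toSubmodule := by
    assumption
  exact Submodule.closed_of_finiteDimensional B.toNonUnitalSubalgebra.toSubmodule

theorem fd_spectrum_finite {b : A} (hb : b ∈ B) : (spectrum ℝ b).Finite := by
  classical
  have hmem : ∀ P : Polynomial ℂ, Polynomial.aeval b (Polynomial.X * P) ∈ B := by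
    intro P
    induction P using Polynomial.induction_on' with
    | add p q hp hq => rw [mul_add, map_add]; exact add_mem hp hq
    | monomial n a =>
      rw [map_mul, Polynomial.aeval_X, Polynomial.aeval_monomial]
      have : b * (algebraMap ℂ A a * b ^ n) = a • b ^ (n + 1) := by
        rw [← Algebra.smul_def, mul_smul_comm, pow_succ']
      rw [this]
      refine SMulMemClass.smul_mem (s := B) a ?_
      induction n with
      | zero => simpa using hb
      | succ k ih => rw [pow_succ]; exact mul_mem (ih (by rw [← Algebra.smul_def, mul_smul_comm, pow_succ'])) hb
  let φ : Polynomial ℂ →ₗ[ℂ] B :=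
    { toFun := fun P => ⟨Polynomial.aeval b (Polynomial.X * P), hmem P⟩
      map_add' := by intro x y; ext; simp [mul_add]
      map_smul' := by intro c x; ext; simp }
  have hni : ¬ Function.Injective φ := by
    intro hi
    have : Module.Finite ℂ (Polynomial ℂ) := Module.Finite.of_injective φ hi
    exact Polynomial.not_finite this
  rw [← LinearMap.ker_eq_bot, LinearMap.ker_eq_bot'] at hni
  push Not at hni
  obtain ⟨P, hP, hP0⟩ := hni
  have hP' : Polynomial.aeval b (Polynomial.X * P) = 0 := congrArg Subtype.val hP
  have hsub := spectrum.subset_polynomial_aeval b (Polynomial.X * P)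
  have hfin : (spectrum ℂ b).Finite := by
    refine Set.Finite.subset (Polynomial.X * P).roots.toFinset.finite_toSet ?_
    intro z hz
    have h1 := hsub ⟨z, hz, rfl⟩
    rw [hP'] at h1
    have hnt : Nontrivial A := by
      by_contra hn
      rw [not_nontrivial_iff_subsingleton] at hn
      simp [spectrum.of_subsingleton] at hz
    rw [spectrum.zero_eq] at h1
    simp only [Finset.mem_coe, Multiset.mem_toFinset]
    rw [Polynomial.mem_roots (mul_ne_zero Polynomial.X_ne_zero hP0)]
    exact h1
  refine (hfin.preimage (f := ((↑) : ℝ → ℂ)) Complex.ofReal_injective.injOn).subset ?_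
  intro t ht
  exact spectrum.algebraMap_mem ℂ ht

theorem fd_thr {p : A} (hp : IsProjection p) (hu : ∀ b ∈ B, p * b = b ∧ b * p = b)
    {b : A} (hb : b ∈ B) (hsa : star b = b) {η : ℝ} (hη : 0 < η) :
    ∃ ψ ∈ B, IsProjection ψ ∧ ψ * b = b * ψ ∧ η • ψ ≤ ψ * b ∧ b - ψ * b ≤ η • (p - ψ) ∧
      (η = 1 / 2 → ‖ψ - b‖ ≤ 2 * ‖b * b - b‖) := by
  classical
  have hsa' : IsSelfAdjoint b := hsa
  have hfin := fd_spectrum_finite B hb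
  have hc : ∀ f : ℝ → ℝ, ContinuousOn f (spectrum ℝ b) := fun f => hfin.continuousOn f
  let f : ℝ → ℝ := fun t => if η < t then 1 else 0
  have hf0 : f 0 = 0 := by simp [f, hη.le]
  have hbid : b = cfc (fun t : ℝ => t) b := (cfc_id' ℝ b).symm
  have hψB : cfc f b ∈ B := by
    have hq : ContinuousOn f (quasispectrum ℝ b) := by
      rw [quasispectrum_eq_spectrum_union_zero]
      exact (hfin.union (Set.finite_singleton 0)).continuousOn f
    rw [← cfcₙ_eq_cfc (f := f) (a := b) hq hf0]
    exact cfcₙ_mem (𝕜' := ℂ) (hs := fd_closed B) f hb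
  have hψ : IsProjection (cfc f b) := by
    refine isProjection_of (cfc_predicate (p := IsSelfAdjoint) f b).star_eq ?_
    rw [← cfc_mul f f b (hc _) (hc _)]
    apply cfc_congr
    intro t _
    simp only [f]; split_ifs <;> simp
  have hmul : cfc f b * b = cfc (fun t => f t * t) b := by
    nth_rw 2 [hbid]
    rw [← cfc_mul f _ b (hc _) (hc _)]
  refine ⟨cfc f b, hψB, hψ, ?_, ?_, ?_, ?_⟩
  · exact (Commute.cfc_real (show Commute b b from rfl) f).eq
  · rw [hmul, ← cfc_smul η f b (hc _)]
    apply cfc_mono _ (hc _) (hc _)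
    intro t _
    simp only [f, smul_eq_mul]
    split_ifs with h
    · simp [h.le]
    · simp
  · have h1 : b - cfc f b * b ≤ η • (1 - cfc f b) := by
      rw [hmul]
      nth_rw 1 [hbid]
      rw [← cfc_sub _ _ b (hc _) (hc _), ← cfc_one ℝ b, ← cfc_sub _ _ b (hc _) (hc _),
        ← cfc_smul η _ b (hc _)]
      apply cfc_mono _ (hc _) (hc _)
      intro t _
      simp only [f, smul_eq_mul, Pi.one_apply]
      split_ifs with h
      · simp
      · simp at h; simp [h]
    have h2 := conj_mono h1 p
    have e1 : star p * (b - cfc f b * b) * p = b - cfc f b * b := by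
      have hm : b - cfc f b * b ∈ B := sub_mem hb (mul_mem hψB hb)
      rw [hp.st, (hu _ hm).1, (hu _ hm).2]
    have e2 : star p * (η • (1 - cfc f b)) * p = η • (p - cfc f b) := by
      rw [hp.st, mul_smul_comm, smul_mul_assoc, mul_sub, sub_mul, mul_one, hp.mm, (hu _ hψB).1,
        (hu _ hψB).2]
    rwa [e1, e2] at h2
  · intro hη2
    have e1 : b * b - b = cfc (fun t : ℝ => t * t - t) b := by
      nth_rw 1 [hbid]; nth_rw 2 [hbid]; nth_rw 3 [hbid]
      rw [← cfc_mul _ _ b (hc _) (hc _), ← cfc_sub _ _ b (hc _) (hc _)]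
    have e2 : cfc f b - b = cfc (fun t : ℝ => f t - t) b := by
      nth_rw 2 [hbid]
      rw [← cfc_sub _ _ b (hc _) (hc _)]
    rw [e2]
    refine norm_cfc_le (by positivity) fun t ht => ?_
    have h1 := norm_apply_le_norm_cfc (fun t : ℝ => t * t - t) b ht (hc _)
    rw [← e1] at h1
    refine le_trans ?_ (mul_le_mul_of_nonneg_left h1 zero_le_two)
    simp only [f, Real.norm_eq_abs, hη2]
    have e3 : t * t - t = t * (t - 1) := by ring
    rw [e3, abs_mul]
    split_ifs with h
    · rw [abs_sub_comm 1 t, abs_of_pos (show 0 < t by linarith)]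
      nlinarith [abs_nonneg (t - 1)]
    · push Not at h
      rw [zero_sub, abs_neg, abs_sub_comm t 1, abs_of_pos (show 0 < 1 - t by linarith)]
      nlinarith [abs_nonneg t]
end findim


set_option linter.unusedSectionVars false

section fd2
variable {A : Type*} [CStarAlgebra A] [PartialOrder A] [StarOrderedRing A]
variable (B : NonUnitalStarSubalgebra ℂ A)

theorem fd_rsmul_mem {b : A} (hb : b ∈ B) (c : ℝ) : c • b ∈ B := by
  have : c • b = (c : ℂ) • b := by simp
  rw [this]; exact SMulMemClass.smul_mem _ hb

theorem fd_cfc_mem [FiniteDimensional ℂ B] {b : A} (hb : b ∈ B) (f : ℝ → ℝ) (hf0 : f 0 = 0) : cfc f b ∈ B := by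
  have hfin := fd_spectrum_finite B hb
  have hq : ContinuousOn f (quasispectrum ℝ b) := by
    rw [quasispectrum_eq_spectrum_union_zero]
    exact (hfin.union (Set.finite_singleton 0)).continuousOn f
  rw [← cfcₙ_eq_cfc (f := f) (a := b) hq hf0]
  exact cfcₙ_mem (𝕜' := ℂ) (hs := fd_closed B) f hb

/-- right ideal generated by a projection -/
def rId (e : A) : Submodule ℂ A where
  carrier := {b | b ∈ B ∧ e * b = b}
  add_mem' := by
    rintro a b ⟨h1, h2⟩ ⟨h3, h4⟩
    exact ⟨add_mem h1 h3, by rw [mul_add, h2, h4]⟩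
  zero_mem' := ⟨zero_mem _, by simp⟩
  smul_mem' := by
    rintro c b ⟨h1, h2⟩
    exact ⟨SMulMemClass.smul_mem _ h1, by rw [mul_smul_comm, h2]⟩

theorem rId_lt [FiniteDimensional ℂ B] {e P : A} (hP : IsProjection P) (hPB : P ∈ B)
    (h : P * e = e) (hne : e * P ≠ P) :
    Module.finrank ℂ (rId B e) < Module.finrank ℂ (rId B P) := by
  have hfd : FiniteDimensional ℂ B.toNonUnitalSubalgebra.toSubmodule := by assumption
  have hle : rId B P ≤ B.toNonUnitalSubalgebra.toSubmodule := fun b hb => hb.1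
  have : FiniteDimensional ℂ (rId B P) := Submodule.finiteDimensional_of_le hle
  apply Submodule.finrank_lt_finrank_of_lt
  refine lt_of_le_of_ne ?_ ?_
  · rintro b ⟨h1, h2⟩
    exact ⟨h1, by rw [← h2, ← mul_assoc, h]⟩
  · intro heq
    have : P ∈ rId B P := ⟨hPB, hP.mm⟩
    rw [← heq] at this
    exact hne this.2

/-- minimal projection of `B` -/
structure MinP (m : A) : Prop where
  proj : IsProjection m
  mem : m ∈ B
  ne : m ≠ 0
  min : ∀ e ∈ B, IsProjection e → m * e = e → e = 0 ∨ e = m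

theorem exists_minP [FiniteDimensional ℂ B] : ∀ n : ℕ, ∀ P ∈ B, IsProjection P → P ≠ 0 →
    Module.finrank ℂ (rId B P) = n → ∃ m, MinP B m ∧ P * m = m := by
  intro n
  induction n using Nat.strong_induction_on with
  | _ n ih =>
    intro P hPB hP hP0 hn
    by_cases h : ∀ e ∈ B, IsProjection e → P * e = e → e = 0 ∨ e = P
    · exact ⟨P, ⟨hP, hPB, hP0, h⟩, hP.mm⟩
    · push Not at h
      obtain ⟨e, heB, he, hPe, h0, h1⟩ := h
      have heP : e * P = e := by
        have := congrArg star hPe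
        simpa [he.st, hP.st] using this
      have hlt := rId_lt B hP hPB hPe (by rw [heP]; exact h1)
      obtain ⟨m, hm, hem⟩ := ih _ (hn ▸ hlt) e heB he h0 rfl
      exact ⟨m, hm, by rw [← hem, ← mul_assoc, hPe]⟩

theorem exists_decomp [FiniteDimensional ℂ B] : ∀ n : ℕ, ∀ P ∈ B, IsProjection P →
    Module.finrank ℂ (rId B P) = n → ∃ (k : ℕ) (q : Fin k → A), (∀ i, MinP B (q i)) ∧
      ∑ i, q i = P := by
  intro n
  induction n using Nat.strong_induction_on with
  | _ n ih =>
    intro P hPB hP hn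
    by_cases hP0 : P = 0
    · exact ⟨0, fun i => i.elim0, fun i => i.elim0, by simp [hP0]⟩
    obtain ⟨m, hm, hPm⟩ := exists_minP B _ P hPB hP hP0 rfl
    have hmP : m * P = m := by
      have := congrArg star hPm
      simpa [hm.proj.st, hP.st] using this
    have hpr := hm.proj.sub' hP hPm
    have hlt : Module.finrank ℂ (rId B (P - m)) < n := by
      rw [← hn]
      refine rId_lt B hP hPB (by rw [mul_sub, hP.mm, hPm]) ?_
      rw [sub_mul, hP.mm, hmP]
      intro h
      exact hm.ne (by simpa using h)
    obtain ⟨k, q, hq, hs⟩ := ih _ hlt (P - m) (sub_mem hPB hm.mem) hpr rfl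
    refine ⟨k + 1, Fin.cons m q, ?_, ?_⟩
    · intro i
      refine Fin.cases ?_ (fun j => ?_) i
      · simpa using hm
      · simpa using hq j
    · rw [Fin.sum_univ_succ]; simp [hs]

theorem minP_sa [FiniteDimensional ℂ B] {m x : A} (hm : MinP B m) (hx : x ∈ B) (hsa : star x = x)
    (hmx : m * x = x) : ∃ c : ℂ, x = c • m := by
  classical
  have hsa' : IsSelfAdjoint x := hsa
  by_cases h : ∀ t ∈ spectrum ℝ x, t = 0
  · refine ⟨0, ?_⟩
    rw [zero_smul, ← cfc_id' ℝ x]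
    rw [cfc_congr (g := fun _ => (0 : ℝ)) (fun t ht => h t ht)]
    simp
  push Not at h
  obtain ⟨t, ht, ht0⟩ := h
  have hfin := fd_spectrum_finite B hx
  have hc : ∀ f : ℝ → ℝ, ContinuousOn f (spectrum ℝ x) := fun f => hfin.continuousOn f
  let f : ℝ → ℝ := fun s => if s = t then 1 else 0
  have hf0 : f 0 = 0 := by simp [f, ht0.symm]
  have heB := fd_cfc_mem B hx f hf0
  have he : IsProjection (cfc f x) := by
    refine isProjection_of (cfc_predicate (p := IsSelfAdjoint) f x).star_eq ?_
    rw [← cfc_mul f f x (hc _) (hc _)]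
    apply cfc_congr
    intro t _
    simp only [f]; split_ifs <;> simp
  have hxe : x * cfc f x = t • cfc f x := by
    nth_rw 1 [← cfc_id' ℝ x]
    rw [← cfc_mul _ f x (hc _) (hc _), ← cfc_smul t f x (hc _)]
    apply cfc_congr
    intro s _
    simp only [f, smul_eq_mul]; split_ifs with h <;> simp [h]
  have hme : m * cfc f x = cfc f x := by
    have : cfc f x = t⁻¹ • (x * cfc f x) := by rw [hxe, smul_smul, inv_mul_cancel₀ ht0, one_smul]
    rw [this, mul_smul_comm, ← mul_assoc, hmx]
  have hxm : x * m = x := by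
    have := congrArg star hmx
    simpa [hm.proj.st, hsa] using this
  rcases hm.min _ heB he hme with h0 | h1
  · exfalso
    have := norm_apply_le_norm_cfc f x ht (hc _)
    rw [h0] at this
    simp [f] at this
    linarith
  · refine ⟨(t : ℂ), ?_⟩
    rw [h1, hxm] at hxe
    rw [hxe]; simp

theorem minP_scal [FiniteDimensional ℂ B] {m b : A} (hm : MinP B m) (hb : b ∈ B) :
    ∃ c : ℂ, m * b * m = c • m := by
  set x := m * b * m with hx
  have hxB : x ∈ B := mul_mem (mul_mem hm.mem hb) hm.mem
  have hmx : m * x = x := by rw [hx, ← mul_assoc, ← mul_assoc, hm.proj.mm]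
  have hmx' : m * star x = star x := by
    rw [hx]; simp only [star_mul, hm.proj.st, ← mul_assoc, hm.proj.mm]
  obtain ⟨c1, h1⟩ := minP_sa B hm (x := x + star x) (add_mem hxB (star_mem hxB))
    (by simp [add_comm]) (by rw [mul_add, hmx, hmx'])
  obtain ⟨c2, h2⟩ := minP_sa B hm (x := Complex.I • (x - star x))
    (SMulMemClass.smul_mem _ (sub_mem hxB (star_mem hxB)))
    (by simp [star_smul, smul_sub]; abel) (by rw [mul_smul_comm, mul_sub, hmx, hmx'])
  refine ⟨(1 / 2) * c1 - (Complex.I / 2) * c2, ?_⟩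
  rw [sub_smul, mul_smul, mul_smul, ← h1, ← h2, smul_smul]
  have : Complex.I / 2 * Complex.I = -(1 / 2) := by
    rw [div_mul_eq_mul_div, Complex.I_mul_I]; ring
  rw [this, neg_smul, sub_neg_eq_add, ← smul_add, add_add_sub_cancel, ← two_smul ℂ x, smul_smul]
  simp

theorem minP_equiv [FiniteDimensional ℂ B] {m m' b : A} (hm : MinP B m) (hm' : MinP B m')
    (hb : b ∈ B) (hne : m' * b * m ≠ 0) : ∃ v ∈ B, star v * v = m ∧ v * star v = m' := by
  set x := m' * b * m with hx
  have hxB : x ∈ B := mul_mem (mul_mem hm'.mem hb) hm.mem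
  have e0 : star x * x = m * (star b * m' * b) * m := by
    rw [hx]; simp only [star_mul, hm.proj.st, hm'.proj.st]
    calc _ = m * (star b * (m' * m') * b) * m := by simp only [mul_assoc]
      _ = _ := by rw [hm'.proj.mm]
  obtain ⟨c, hc⟩ := minP_scal B hm (mul_mem (mul_mem (star_mem hb) hm'.mem) hb)
  rw [← e0] at hc
  have hm0 : 0 < ‖m‖ := norm_pos_iff.2 hm.ne
  have hre : c.re • m = star x * x := by
    have h1 : star (star x * x) = star x * x := by simp
    rw [hc, star_smul, hm.proj.st] at h1
    have h2 : (star c - c) • m = 0 := by rw [sub_smul, h1, sub_self]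
    rcases smul_eq_zero.1 h2 with h3 | h3
    · have h4 : (starRingEnd ℂ) c = c := sub_eq_zero.1 h3
      rw [Complex.conj_eq_iff_re] at h4
      rw [hc]; nth_rw 2 [← h4]; simp
    · exact absurd h3 hm.ne
  have hcpos : 0 < c.re := by
    by_contra hcon
    push Not at hcon
    have h1 : 0 ≤ (-c.re) • m := smul_nonneg (by linarith) hm.proj.nonneg'
    have h2 : 0 ≤ star x * x := star_mul_self_nonneg x
    rw [← hre] at h2
    rw [neg_smul] at h1
    have h3 := le_antisymm (neg_nonneg.1 h1) h2
    rw [hre] at h3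
    exact hne ((CStarRing.star_mul_self_eq_zero_iff _).1 h3)
  set s := (Real.sqrt c.re)⁻¹ with hs
  have hss : s * s * c.re = 1 := by
    have h1 := Real.mul_self_sqrt hcpos.le
    have h2 := Real.sqrt_pos.2 hcpos
    rw [hs]; field_simp; nlinarith
  have hv : star (s • x) * (s • x) = m := by
    rw [star_smul, smul_mul_smul_comm, ← hre, smul_smul]; simp [hss]
  have hpi := partial_iso_proj hm.proj hv
  have hvB : s • x ∈ B := fd_rsmul_mem B hxB s
  refine ⟨s • x, hvB, hv, ?_⟩
  have hle : m' * (s • x * star (s • x)) = s • x * star (s • x) := by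
    rw [← mul_assoc, mul_smul_comm]
    congr 2
    rw [hx, ← mul_assoc, ← mul_assoc, hm'.proj.mm]
  rcases hm'.min _ (mul_mem hvB (star_mem hvB)) hpi.2 hle with h0 | h1
  · exfalso
    have h2 := (CStarRing.mul_star_self_eq_zero_iff _).1 h0
    rw [h2] at hv
    exact hm.ne (by simpa using hv.symm)
  · exact h1

/-- matrix units for the finite dimensional algebra -/
structure MU (p : A) {N : ℕ} (v : Fin N → A) (r : Fin N → Fin N) (Q : Fin N → A) : Prop where
  mem : ∀ s, v s ∈ B
  Qp : ∀ k, IsProjection (Q k)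
  QB : ∀ k, Q k ∈ B
  Qne : ∀ k, Q k ≠ 0
  vv : ∀ s, star (v s) * v s = Q (r s)
  orth : ∀ s t, s ≠ t → star (v s) * v t = 0
  sum : ∑ s, v s * star (v s) = p
  scal : ∀ b ∈ B, ∀ s t, r s = r t → ∃ c : ℂ, star (v s) * b * v t = c • Q (r s)
  zero : ∀ b ∈ B, ∀ s t, r s ≠ r t → star (v s) * b * v t = 0

theorem exists_MU [FiniteDimensional ℂ B] {p : A} (hp : IsProjection p) (hpB : p ∈ B) :
    ∃ (N : ℕ) (v : Fin N → A) (r : Fin N → Fin N) (Q : Fin N → A), MU B p v r Q := by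
  classical
  obtain ⟨N, q, hq, hsum⟩ := exists_decomp B _ p hpB hp rfl
  let S : Setoid (Fin N) :=
    { r := fun s t => ∃ v ∈ B, star v * v = q s ∧ v * star v = q t
      iseqv :=
        { refl := fun s => ⟨q s, (hq s).mem, by rw [(hq s).proj.st, (hq s).proj.mm],
            by rw [(hq s).proj.st, (hq s).proj.mm]⟩
          symm := by
            rintro s t ⟨v, h1, h2, h3⟩
            exact ⟨star v, star_mem h1, by rw [star_star, h3], by rw [star_star, h2]⟩
          trans := by
            rintro s t u ⟨v, h1, h2, h3⟩ ⟨w, h4, h5, h6⟩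
            refine ⟨w * v, mul_mem h4 h1, ?_, ?_⟩
            · rw [star_mul, mul_assoc, ← mul_assoc (star w), h5, ← h3, ← mul_assoc, ← mul_assoc,
                h2, mul_assoc, h2, (hq s).proj.mm]
            · rw [star_mul, mul_assoc, ← mul_assoc v, h3, ← h5, ← mul_assoc, ← mul_assoc,
                h6, mul_assoc, h6, (hq u).proj.mm] } }
  let r : Fin N → Fin N := fun s => (Quotient.mk S s).out
  have hr : ∀ s, ∃ v ∈ B, star v * v = q (r s) ∧ v * star v = q s := fun s =>
    Quotient.exact (s := S) (Quotient.out_eq (Quotient.mk S s))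
  have hrr : ∀ s t, (∃ v ∈ B, star v * v = q s ∧ v * star v = q t) → r s = r t := by
    intro s t h
    have : Quotient.mk S s = Quotient.mk S t := Quotient.sound h
    simp only [r, this]
  choose v hvB hv1 hv2 using hr
  have hvq : ∀ s, q s * v s = v s := by
    intro s
    rw [← hv2, mul_assoc, hv1, (partial_iso_proj (hq _).proj (hv1 s)).1]
  have hvq' : ∀ s, star (v s) * q s = star (v s) := by
    intro s
    have := congrArg star (hvq s)
    simpa [(hq s).proj.st] using this
  have hvr : ∀ s, v s * q (r s) = v s := fun s => (partial_iso_proj (hq _).proj (hv1 s)).1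
  have hvr' : ∀ s, q (r s) * star (v s) = star (v s) := by
    intro s
    have := congrArg star (hvr s)
    simpa [(hq _).proj.st] using this
  have horth := proj_orth_of_sum Finset.univ q p (fun i _ => (hq i).proj) hp hsum
  refine ⟨N, v, r, q, hvB, fun k => (hq k).proj, fun k => (hq k).mem, fun k => (hq k).ne, hv1, ?_, ?_, ?_, ?_⟩
  · intro s t hst
    rw [← hvq' s, ← hvq t, mul_assoc, ← mul_assoc (q s), horth s (by simp) t (by simp) hst]
    simp
  · rw [← hsum]; exact Finset.sum_congr rfl fun s _ => hv2 s
  · intro b hb s t hst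
    obtain ⟨c, hc⟩ := minP_scal B (hq (r s)) (mul_mem (mul_mem (star_mem (hvB s)) hb) (hvB t))
    refine ⟨c, ?_⟩
    rw [← hc]
    have : q (r s) * (star (v s) * b * v t) * q (r s) =
      (q (r s) * star (v s)) * b * (v t * q (r s)) := by simp only [mul_assoc]
    rw [this, hvr', hst, hvr]
  · intro b hb s t hst
    by_contra hne
    have hne' : q s * b * q t ≠ 0 := by
      intro h0
      apply hne
      rw [← hvq' s, ← hvq t]
      have : star (v s) * q s * b * (q t * v t) = star (v s) * (q s * b * q t) * v t := by
        simp only [mul_assoc]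
      rw [this, h0]; simp
    exact hst (hrr t s (minP_equiv B (hq t) (hq s) hb hne')).symm

end fd2

set_option linter.unusedSectionVars false

section mu
variable {A : Type*} [CStarAlgebra A] [PartialOrder A] [StarOrderedRing A]
variable {B : NonUnitalStarSubalgebra ℂ A}

def eMU {N : ℕ} (v : Fin N → A) (r : Fin N → Fin N) (y : Fin N → A) : A :=
  ∑ s, v s * y (r s) * star (v s)

variable {p : A} {N : ℕ} {v : Fin N → A} {r : Fin N → Fin N} {Q : Fin N → A}

theorem MU.vQ (h : MU B p v r Q) (s : Fin N) : v s * Q (r s) = v s :=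
  (partial_iso_proj (h.Qp _) (h.vv s)).1

theorem MU.Qv (h : MU B p v r Q) (s : Fin N) : Q (r s) * star (v s) = star (v s) := by
  have := congrArg star (h.vQ s)
  simpa [(h.Qp _).st] using this

theorem MU.norm_v (h : MU B p v r Q) (s : Fin N) : ‖v s‖ ≤ 1 := norm_partial_iso (h.Qp _) (h.vv s)

theorem MU.pp (h : MU B p v r Q) : IsProjection p := by
  rw [← h.sum]
  refine IsProjection.sum' _ _ (fun i _ => (partial_iso_proj (h.Qp _) (h.vv i)).2) ?_
  intro i _ j _ hij
  rw [mul_assoc, ← mul_assoc (star (v i)), h.orth i j hij]; simp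

theorem MU.pv (h : MU B p v r Q) (s : Fin N) : p * v s = v s := by
  rw [← h.sum, Finset.sum_mul, Finset.sum_eq_single_of_mem s (Finset.mem_univ _), mul_assoc, h.vv, h.vQ]
  intro t _ hts
  rw [mul_assoc, h.orth t s hts, mul_zero]

theorem MU.vp (h : MU B p v r Q) (s : Fin N) : star (v s) * p = star (v s) := by
  have := congrArg star (h.pv s)
  simpa [h.pp.st] using this

theorem MU.e_mul (h : MU B p v r Q) (y z : Fin N → A) (hy : ∀ k, y k * Q k = y k) :
    eMU v r y * eMU v r z = eMU v r (fun k => y k * z k) := by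
  rw [eMU, eMU, eMU, Finset.sum_mul_sum]
  refine Finset.sum_congr rfl fun s _ => ?_
  rw [Finset.sum_eq_single_of_mem s (Finset.mem_univ _)]
  · calc _ = v s * (y (r s) * (star (v s) * v s)) * z (r s) * star (v s) := by simp only [mul_assoc]
      _ = _ := by rw [h.vv, hy]; simp only [mul_assoc]
  · intro t _ hts
    calc _ = v s * (y (r s) * (star (v s) * v t)) * z (r t) * star (v t) := by simp only [mul_assoc]
      _ = _ := by rw [h.orth s t hts.symm]; simp

theorem e_star (y : Fin N → A) : star (eMU v r y) = eMU v r (fun k => star (y k)) := by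
  simp [eMU, star_sum, mul_assoc]

theorem e_sum {ι : Type*} (S : Finset ι) (y : ι → Fin N → A) :
    ∑ i ∈ S, eMU v r (y i) = eMU v r (fun k => ∑ i ∈ S, y i k) := by
  simp only [eMU]
  rw [Finset.sum_comm]
  refine Finset.sum_congr rfl fun s _ => ?_
  rw [Finset.mul_sum, Finset.sum_mul]

theorem MU.e_Q (h : MU B p v r Q) : eMU v r Q = p := by
  rw [← h.sum, eMU]
  exact Finset.sum_congr rfl fun s _ => by rw [h.vQ]

theorem MU.e_proj (h : MU B p v r Q) (y : Fin N → A) (hy : ∀ k, y k * Q k = y k)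
    (hp : ∀ k, IsProjection (y k)) : IsProjection (eMU v r y) := by
  refine isProjection_of ?_ ?_
  · rw [e_star]; congr 1; funext k; exact (hp k).st
  · rw [h.e_mul y y hy]; congr 1; funext k; exact (hp k).mm

theorem MU.pe (h : MU B p v r Q) (y : Fin N → A) : p * eMU v r y = eMU v r y := by
  rw [eMU, Finset.mul_sum]
  exact Finset.sum_congr rfl fun s _ => by rw [← mul_assoc, ← mul_assoc, h.pv]

theorem MU.ep (h : MU B p v r Q) (y : Fin N → A) : eMU v r y * p = eMU v r y := by
  rw [eMU, Finset.sum_mul]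
  exact Finset.sum_congr rfl fun s _ => by rw [mul_assoc, h.vp]

theorem MU.e_comm (h : MU B p v r Q) (hu : ∀ b ∈ B, p * b = b ∧ b * p = b) (y : Fin N → A)
    (hy : ∀ k, Q k * y k = y k) (hy' : ∀ k, y k * Q k = y k) {b : A} (hb : b ∈ B) :
    eMU v r y * b = b * eMU v r y := by
  have e1 : eMU v r y * b = ∑ t, ∑ s, v t * (y (r t) * (star (v t) * b * v s)) * star (v s) := by
    conv_lhs => rw [← (hu b hb).2, ← h.sum, eMU, Finset.sum_mul]
    refine Finset.sum_congr rfl fun t _ => ?_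
    rw [Finset.mul_sum, Finset.mul_sum]
    exact Finset.sum_congr rfl fun s _ => by simp only [mul_assoc]
  have e2 : b * eMU v r y = ∑ t, ∑ s, v t * ((star (v t) * b * v s) * y (r s)) * star (v s) := by
    conv_lhs => rw [← (hu b hb).1, ← h.sum, eMU, mul_assoc, Finset.sum_mul]
    refine Finset.sum_congr rfl fun t _ => ?_
    rw [Finset.mul_sum, Finset.mul_sum]
    exact Finset.sum_congr rfl fun s _ => by simp only [mul_assoc]
  rw [e1, e2]
  refine Finset.sum_congr rfl fun t _ => Finset.sum_congr rfl fun s _ => ?_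
  congr 2
  by_cases hts : r t = r s
  · obtain ⟨c, hc⟩ := h.scal b hb t s hts
    rw [hc, mul_smul_comm, smul_mul_assoc, hy', ← hts, hy]
  · rw [h.zero b hb t s hts]; simp

theorem MU.e_tr (h : MU B p v r Q) {T : A →ₗ[ℝ] ℝ} (hT : IsTr T) (y : Fin N → A)
    (hy : ∀ k, Q k * y k = y k) : T (eMU v r y) = ∑ s, T (y (r s)) := by
  rw [eMU, map_sum]
  refine Finset.sum_congr rfl fun s _ => ?_
  rw [hT.comm, ← mul_assoc, h.vv, hy]

/-- near-centrality of elements of the commutant of `B` -/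
theorem near_central (hp : IsProjection p) {e x : A} {ε : ℝ} (hpe : p * e = e) (hep : e * p = e)
    (hn : ‖e‖ ≤ 1) (hc : ∀ b ∈ B, e * b = b * e) (h1 : ‖x * p - p * x‖ < ε)
    (h2 : ∃ b ∈ B, ‖p * x * p - b‖ < ε) : ‖e * x - x * e‖ < 4 * ε := by
  obtain ⟨b, hb, hb2⟩ := h2
  have e1 : e * x - x * e = -(e * ((x * p - p * x) * (1 - p))) + e * (p * x * p - b)
      - (p * x * p - b) * e - (1 - p) * (x * p - p * x) * e := by
    have a1 : e * ((x * p - p * x) * (1 - p)) = - (e * x) + e * x * p := by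
      have : (x * p - p * x) * (1 - p) = - p * x + p * x * p + (x * p - x * (p * p)) := by
        noncomm_ring
      rw [this, hp.mm, sub_self, add_zero, mul_add, neg_mul, mul_neg, ← mul_assoc, ← mul_assoc,
        ← mul_assoc, hep]
    have a2 : (1 - p) * (x * p - p * x) * e = x * e - p * x * e := by
      have : (1 - p) * (x * p - p * x) * e = x * (p * e) - p * x * (p * e)  - p * x * e + (p * p) * x * e := by
        noncomm_ring
      rw [this, hpe, hp.mm]; abel
    have a3 : e * (p * x * p - b) = e * x * p - e * b := by
      rw [mul_sub, ← mul_assoc, ← mul_assoc, hep]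
    have a4 : (p * x * p - b) * e = p * x * e - b * e := by
      rw [sub_mul, mul_assoc _ p e, hpe]
    rw [a1, a2, a3, a4, hc b hb]; abel
  have hε : 0 < ε := (norm_nonneg _).trans_lt h1
  have hcn := hp.compl.norm_le
  have m1 : ∀ z : A, ‖e * z‖ ≤ ‖z‖ := fun z =>
    (norm_mul_le _ _).trans (mul_le_of_le_one_left (norm_nonneg _) hn)
  have m2 : ∀ z : A, ‖z * e‖ ≤ ‖z‖ := fun z =>
    (norm_mul_le _ _).trans (mul_le_of_le_one_right (norm_nonneg _) hn)
  have b1 : ‖e * ((x * p - p * x) * (1 - p))‖ < ε := ((m1 _).trans ((norm_mul_le _ _).trans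
    (mul_le_of_le_one_right (norm_nonneg _) hcn))).trans_lt h1
  have b2 : ‖(1 - p) * (x * p - p * x) * e‖ < ε := ((m2 _).trans ((norm_mul_le _ _).trans
    (mul_le_of_le_one_left (norm_nonneg _) hcn))).trans_lt h1
  have b3 := (m1 (p * x * p - b)).trans_lt hb2
  have b4 := (m2 (p * x * p - b)).trans_lt hb2
  rw [e1]
  have c1 := norm_sub_le (-(e * ((x * p - p * x) * (1 - p))) + e * (p * x * p - b)
      - (p * x * p - b) * e) ((1 - p) * (x * p - p * x) * e)
  have c2 := norm_sub_le (-(e * ((x * p - p * x) * (1 - p))) + e * (p * x * p - b))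
      ((p * x * p - b) * e)
  have c3 := norm_add_le (-(e * ((x * p - p * x) * (1 - p)))) (e * (p * x * p - b))
  rw [norm_neg] at c3
  linarith

/-- central projection for a class -/
def zMU (v : Fin N → A) (r : Fin N → Fin N) (Q : Fin N → A) (k : Fin N) : A :=
  eMU v r (fun j => if j = k then Q j else 0)

theorem MU.z_proj (h : MU B p v r Q) (k : Fin N) : IsProjection (zMU v r Q k) := by
  refine h.e_proj _ ?_ ?_
  · intro j; split_ifs
    · exact (h.Qp j).mm
    · simp
  · intro j; split_ifs
    · exact h.Qp j
    · exact isProjection_zero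

theorem MU.z_comm (h : MU B p v r Q) (hu : ∀ b ∈ B, p * b = b ∧ b * p = b) (k : Fin N) {b : A} (hb : b ∈ B) :
    zMU v r Q k * b = b * zMU v r Q k := by
  refine h.e_comm hu _ ?_ ?_ hb
  · intro j; split_ifs
    · exact (h.Qp j).mm
    · simp
  · intro j; split_ifs
    · exact (h.Qp j).mm
    · simp

theorem MU.z_sum (h : MU B p v r Q) : ∑ k, zMU v r Q k = p := by
  rw [← h.e_Q]
  simp only [zMU]
  rw [e_sum]; congr 1; funext k; simp

/-- nonzero cuts by the same central projection are connected -/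
theorem MU.connect (h : MU B p v r Q) {P R : A} (hP : IsProjection P)
    (hR : IsProjection R) (hRB : R ∈ B) (k : Fin N) (h1 : zMU v r Q k * P ≠ 0)
    (h2 : zMU v r Q k * R ≠ 0) : ∃ b ∈ B, R * b * P ≠ 0 := by
  have key : ∀ P : A, zMU v r Q k * P ≠ 0 → ∃ s, r s = k ∧ star (v s) * P ≠ 0 := by
    intro P hP
    by_contra hcon
    push Not at hcon
    apply hP
    rw [zMU, eMU, Finset.sum_mul]
    refine Finset.sum_eq_zero fun s _ => ?_
    split_ifs with hs
    · rw [mul_assoc, hcon s hs, mul_zero]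
    · simp
  obtain ⟨s, hs, hs0⟩ := key P h1
  obtain ⟨t, ht, ht0⟩ := key R h2
  refine ⟨v t * star (v s), mul_mem (h.mem t) (star_mem (h.mem s)), ?_⟩
  intro h0
  obtain ⟨c, hc⟩ := h.scal R hRB t t rfl
  have hc0 : c ≠ 0 := by
    rintro rfl
    rw [zero_smul] at hc
    have : star (R * v t) * (R * v t) = 0 := by
      rw [star_mul, hR.st, mul_assoc, ← mul_assoc R, hR.mm, ← mul_assoc, hc]
    have := (CStarRing.star_mul_self_eq_zero_iff _).1 this
    apply ht0
    have := congrArg star this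
    simpa [hR.st] using this
  have h3 : star (v t) * (R * (v t * star (v s)) * P) = c • (star (v s) * P) := by
    calc _ = (star (v t) * R * v t) * star (v s) * P := by simp only [mul_assoc]
      _ = _ := by rw [hc, smul_mul_assoc, smul_mul_assoc, ht, ← hs, h.Qv]
  rw [h0, mul_zero] at h3
  exact (smul_ne_zero hc0 hs0) h3.symm

/-- comparison in B -/
theorem MU.compare [FiniteDimensional ℂ B] (h : MU B p v r Q) (hu : ∀ b ∈ B, p * b = b ∧ b * p = b)
    {T : A →ₗ[ℝ] ℝ} (hT : IsTr T)
    (hfaith : ∀ q : A, IsProjection q → q ≠ 0 → 0 < T q) : ∀ n : ℕ, ∀ P R : A, P ∈ B → R ∈ B →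
    IsProjection P → IsProjection R → Module.finrank ℂ (rId B P) = n →
    (∀ k, T (zMU v r Q k * P) ≤ T (zMU v r Q k * R)) →
    ∃ w ∈ B, star w * w = P ∧ R * w = w := by
  intro n
  induction n using Nat.strong_induction_on with
  | _ n ih =>
    intro P R hPB hRB hP hR hn hle
    by_cases hP0 : P = 0
    · exact ⟨0, zero_mem _, by simp [hP0], by simp⟩
    have hz : ∃ k, zMU v r Q k * P ≠ 0 := by
      by_contra hcon
      push Not at hcon
      apply hP0
      rw [← (hu P hPB).1, ← h.z_sum, Finset.sum_mul]
      exact Finset.sum_eq_zero fun k _ => hcon k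
    obtain ⟨k, hk⟩ := hz
    have hzP : IsProjection (zMU v r Q k * P) := by
      have hc := h.z_comm hu k hPB
      refine isProjection_of (by rw [star_mul, hP.st, (h.z_proj k).st, hc]) ?_
      rw [mul_assoc, ← mul_assoc P, ← hc, mul_assoc _ P P, hP.mm, ← mul_assoc, (h.z_proj k).mm]
    have hpos := hfaith _ hzP hk
    have hkR : zMU v r Q k * R ≠ 0 := by
      intro h0
      have := hle k
      rw [h0, map_zero] at this
      linarith
    obtain ⟨b, hb, hbne⟩ := h.connect hP hR hRB k hk hkR
    obtain ⟨a1, f1, hf1, hs1⟩ := exists_decomp B _ P hPB hP rfl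
    obtain ⟨a2, f2, hf2, hs2⟩ := exists_decomp B _ R hRB hR rfl
    have hex : ∃ i j, f2 i * b * f1 j ≠ 0 := by
      by_contra hcon
      push Not at hcon
      apply hbne
      rw [← hs1, ← hs2, Finset.sum_mul, Finset.sum_mul_sum]
      exact Finset.sum_eq_zero fun i _ => Finset.sum_eq_zero fun j _ => hcon i j
    obtain ⟨i, j, hij⟩ := hex
    obtain ⟨u, huB, hu1, hu2⟩ := minP_equiv B (hf1 j) (hf2 i) hb hij
    have hPj := sub_of_sum Finset.univ f1 P (fun i _ => (hf1 i).proj) hP hs1 j (Finset.mem_univ _)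
    have hRi := sub_of_sum Finset.univ f2 R (fun i _ => (hf2 i).proj) hR hs2 i (Finset.mem_univ _)
    have hm := (hf1 j)
    have hm' := (hf2 i)
    have hlt : Module.finrank ℂ (rId B (P - f1 j)) < n := by
      rw [← hn]
      refine rId_lt B hP hPB (by rw [mul_sub, hP.mm, hPj.1]) ?_
      rw [sub_mul, hP.mm, hPj.2]
      intro h
      exact hm.ne (by simpa using h)
    obtain ⟨w, hwB, hw1, hw2⟩ := ih _ hlt (P - f1 j) (R - f2 i) (sub_mem hPB hm.mem)
      (sub_mem hRB hm'.mem) (hm.proj.sub' hP hPj.1) (hm'.proj.sub' hR hRi.1) rfl (by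
        intro k
        have e1 : T (zMU v r Q k * f1 j) = T (zMU v r Q k * f2 i) := by
          rw [← hu1, ← hu2, ← mul_assoc, hT.comm, ← mul_assoc, ← mul_assoc, h.z_comm hu k huB]
        have := hle k
        rw [mul_sub, mul_sub, map_sub, map_sub, e1]
        linarith)
    have hu3 : f2 i * u = u := by
      rw [← hu2, mul_assoc, hu1, (partial_iso_proj hm.proj hu1).1]
    have hwu : star w * u = 0 := by
      have e1 : star w * (R - f2 i) = star w := by
        have := congrArg star hw2
        simpa [hR.st, hm'.proj.st] using this
      rw [← e1, ← hu3, mul_assoc, ← mul_assoc _ (f2 i), sub_mul, hRi.1, hm'.proj.mm, sub_self]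
      simp
    have huw : star u * w = 0 := by
      have := congrArg star hwu
      simpa using this
    refine ⟨w + u, add_mem hwB huB, ?_, ?_⟩
    · simp only [star_add, add_mul, mul_add, hwu, huw, hw1, hu1]; abel
    · have e1 : R * (R - f2 i) = R - f2 i := by rw [mul_sub, hR.mm, hRi.1]
      rw [mul_add]
      congr 1
      · rw [← hw2, ← mul_assoc, e1]
      · rw [← hu3, ← mul_assoc, hRi.1]
end mu

set_option linter.unusedSectionVars false

section ctx
variable {A : Type*} [CStarAlgebra A] [PartialOrder A] [StarOrderedRing A]

/-- the standing assumptions -/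
structure Ctx (α : A ≃⋆ₐ[ℂ] A) (T : A →ₗ[ℝ] ℝ) : Prop where
  tr : IsTr T
  inv : ∀ x, T (α x) = T x
  faith : ∀ x, T (star x * x) = 0 → x = 0
  uniq : ∀ T' : A →ₗ[ℝ] ℝ, IsTr T' → T' = T
  simple : IsSimpleCStar A
  TR : TracialRankZero A
  out : ∀ m : ℤ, m ≠ 0 → UniformlyOuter (autZPow α m)

def Cen (F : Finset A) (ε : ℝ) (z : A) : Prop := ∀ a ∈ F, ‖z * a - a * z‖ < ε

/-- comparison of projections -/
def PLE (q Q : A) : Prop := ∃ w : A, star w * w = q ∧ Q * w = w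

variable {α : A ≃⋆ₐ[ℂ] A} {T : A →ₗ[ℝ] ℝ}

theorem Ctx.fproj (c : Ctx α T) {q : A} (hq : IsProjection q) (h : q ≠ 0) : 0 < T q := by
  refine lt_of_le_of_ne (c.tr.nonneg hq.nonneg') fun h0 => h (c.faith q ?_)
  rw [hq.st, hq.mm, ← h0]

theorem Ctx.fpos (c : Ctx α T) {x : A} (hx : 0 ≤ x) (h : x ≠ 0) : 0 < T x := by
  refine lt_of_le_of_ne (c.tr.nonneg hx) fun h0 => h ?_
  obtain ⟨b, rfl⟩ := CStarAlgebra.nonneg_iff_eq_star_mul_self.1 hx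
  rw [c.faith b h0.symm]; simp

theorem alpha_proj {q : A} (hq : IsProjection q) (β : A ≃⋆ₐ[ℂ] A) : IsProjection (β q) :=
  isProjection_of (by rw [← map_star, hq.st]) (by rw [← map_mul, hq.mm])

theorem Ctx.exists_mul_ne (c : Ctx α T) {q x : A} (hq : q ≠ 0) (hx : x ≠ 0) :
    ∃ a, q * a * x ≠ 0 := by
  let I : TwoSidedIdeal A := TwoSidedIdeal.mk' {x | ∀ a, q * a * x = 0} (by simp)
    (by intro x y hx hy a; rw [mul_add, hx a, hy a, add_zero])
    (by intro x hx a; rw [mul_neg, hx a, neg_zero])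
    (by intro x y hy a; rw [← mul_assoc, mul_assoc q]; exact hy _)
    (by intro x y hx a; rw [← mul_assoc, hx a, zero_mul])
  have hmem : ∀ x, x ∈ I ↔ ∀ a, q * a * x = 0 := fun x => by
    rw [TwoSidedIdeal.mem_mk']; rfl
  have hcl : IsClosed (I : Set A) := by
    have : (I : Set A) = ⋂ a, {x | q * a * x = 0} := by
      ext x; simp [hmem]
    rw [this]
    exact isClosed_iInter fun a => isClosed_eq (by fun_prop) (by fun_prop)
  rcases c.simple I hcl with h | h
  · by_contra hcon
    push Not at hcon
    have : x ∈ (I : Set A) := (hmem x).2 hcon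
    rw [h] at this
    exact hx this
  · exfalso
    have : (1 : A) ∈ (I : Set A) := by rw [h]; trivial
    have := (hmem 1).1 this 1
    simp at this
    exact hq this

theorem Ctx.split (c : Ctx α T) {q : A} (hq : IsProjection q) (h0 : q ≠ 0) :
    ∃ q1 q2, IsProjection q1 ∧ IsProjection q2 ∧ q1 + q2 = q ∧ q1 ≠ 0 ∧ q2 ≠ 0 := by
  have hα : α q ≠ 0 := fun h => h0 (by simpa using h)
  obtain ⟨a, ha⟩ := c.exists_mul_ne h0 hα
  obtain ⟨n, y, hy, hs, hn⟩ := c.out 1 one_ne_zero a q hq _ (norm_pos_iff.2 ha)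
  have hex : ∃ i, y i ≠ 0 := by
    by_contra hcon
    push Not at hcon
    apply h0
    rw [← hs]; exact Finset.sum_eq_zero fun i _ => hcon i
  obtain ⟨i, hi⟩ := hex
  have hsub := (sub_of_sum Finset.univ y q (fun i _ => hy i) hq hs i (Finset.mem_univ _)).1
  refine ⟨y i, q - y i, hy i, (hy i).sub' hq hsub, by abel, hi, ?_⟩
  intro h
  have h1 : y i = q := (sub_eq_zero.1 h).symm
  have h2 := hn i
  rw [h1] at h2
  simp [autZPow] at h2

theorem Ctx.small (c : Ctx α T) {q : A} (hq : IsProjection q) (h0 : q ≠ 0) (k : ℕ) :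
    ∃ q', IsProjection q' ∧ q' ≠ 0 ∧ T q' ≤ T q / 2 ^ k := by
  induction k with
  | zero => exact ⟨q, hq, h0, by simp⟩
  | succ k ih =>
    obtain ⟨q', h1, h2, h3⟩ := ih
    obtain ⟨a, b, ha, hb, hab, ha0, hb0⟩ := c.split h1 h2
    have h4 : T a + T b = T q' := by rw [← map_add, hab]
    rcases le_total (T a) (T b) with h | h
    · refine ⟨a, ha, ha0, ?_⟩
      rw [pow_succ, ← div_div]; linarith
    · refine ⟨b, hb, hb0, ?_⟩
      rw [pow_succ, ← div_div]; linarith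

theorem Ctx.one_ne (c : Ctx α T) : (1 : A) ≠ 0 := by
  intro h
  have := c.tr.one
  rw [h, map_zero] at this
  norm_num at this

theorem Ctx.small' (c : Ctx α T) {ε : ℝ} (hε : 0 < ε) :
    ∃ q : A, IsProjection q ∧ q ≠ 0 ∧ T q < ε := by
  obtain ⟨k, hk⟩ := exists_pow_lt_of_lt_one hε (show (1/2 : ℝ) < 1 by norm_num)
  obtain ⟨q, h1, h2, h3⟩ := c.small isProjection_one c.one_ne k
  refine ⟨q, h1, h2, h3.trans_lt ?_⟩
  rw [c.tr.one]
  rwa [one_div_pow] at hk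

theorem ple_of_cuntz {q f : A} (hf : IsProjection f) (h : CuntzLE q f) : PLE q f := by
  obtain ⟨x, h1, h2⟩ := h
  refine ⟨x, h1.symm, ?_⟩
  have h3 : (1 - f) * (x * star x) = 0 := by
    have hcl : IsClosed {z : A | (1 - f) * z = 0} := isClosed_eq (by fun_prop) (by fun_prop)
    refine closure_minimal ?_ hcl h2
    rintro _ ⟨c, rfl⟩
    simp only [Set.mem_ofPred_eq]
    rw [← mul_assoc, ← mul_assoc, sub_mul, hf.mm]; simp
  have h4 : ((1 - f) * x) * star ((1 - f) * x) = 0 := by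
    rw [star_mul, ← mul_assoc, mul_assoc (1 - f) x, h3, zero_mul]
  have h5 := (CStarRing.mul_star_self_eq_zero_iff _).1 h4
  rw [sub_mul, one_mul] at h5
  exact (sub_eq_zero.1 h5).symm

theorem ple_tr (hT : IsTr T) {q f : A} (hq : IsProjection q) (hf : IsProjection f) (h : PLE q f) :
    T q ≤ T f := by
  obtain ⟨w, h1, h2⟩ := h
  rw [← h1, hT.comm]
  refine hT.mono ((partial_iso_proj hq h1).2.le_of_mul hf ?_)
  rw [← mul_assoc, h2]

/-- tracial rank zero with small trace -/
theorem Ctx.tr0 (c : Ctx α T) (F : Finset A) {ε : ℝ} (hε : 0 < ε) :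
    ∃ (B : NonUnitalStarSubalgebra ℂ A) (p : A),
      FiniteDimensional ℂ B ∧ IsProjection p ∧ p ∈ B ∧
      (∀ b ∈ B, p * b = b ∧ b * p = b) ∧
      (∀ x ∈ F, ‖x * p - p * x‖ < ε) ∧
      (∀ x ∈ F, ∃ b ∈ B, ‖p * x * p - b‖ < ε) ∧ T (1 - p) < ε := by
  obtain ⟨q, h1, h2, h3⟩ := c.small' hε
  obtain ⟨B, p, a1, a2, a3, a4, a5, a6, a7⟩ := c.TR F ε hε q h1.isPos h2
  exact ⟨B, p, a1, a2, a3, a4, a5, a6,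
    (ple_tr c.tr a2.compl h1 (ple_of_cuntz h1 a7)).trans_lt h3⟩

theorem sa_approx {B : NonUnitalStarSubalgebra ℂ A} {x p : A} {ε : ℝ} (hx : star x = x)
    (hp : IsProjection p) (h : ∃ b ∈ B, ‖p * x * p - b‖ < ε) :
    ∃ b ∈ B, star b = b ∧ ‖p * x * p - b‖ < ε := by
  obtain ⟨b, hb, hn⟩ := h
  refine ⟨(1 / 2 : ℝ) • (b + star b), fd_rsmul_mem B (add_mem hb (star_mem hb)) _, ?_, ?_⟩
  · simp [add_comm]
  · have hn2 : ‖p * x * p - star b‖ < ε := by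
      rw [← norm_star]; simpa [hp.st, hx, mul_assoc] using hn
    have : p * x * p - (1 / 2 : ℝ) • (b + star b) =
        (1 / 2 : ℝ) • ((p * x * p - b) + (p * x * p - star b)) := by
      have : p * x * p = (1 / 2 : ℝ) • (p * x * p + p * x * p) := by
        rw [← two_smul ℝ, smul_smul]; norm_num
      nth_rw 1 [this]
      rw [← smul_sub]; congr 1; abel
    rw [this, norm_smul]
    have h1 := norm_add_le (p * x * p - b) (p * x * p - star b)
    rw [Real.norm_of_nonneg (by norm_num)]
    linarith

/-- SP property in a strong form -/
theorem Ctx.sp (c : Ctx α T) {x : A} (hx : star x = x) (h0 : x ≠ 0) :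
    ∃ f z : A, IsProjection f ∧ f ≠ 0 ∧ f = x * z * x := by
  set X := x * x with hX
  have hX0 : 0 ≤ X := by have := star_mul_self_nonneg x; rwa [hx] at this
  have hXsa : star X = X := sa_of_nonneg hX0
  have hTX : 0 < T X := by
    refine c.fpos hX0 fun h => h0 ?_
    rw [hX] at h
    nth_rw 1 [← hx] at h
    exact (CStarRing.star_mul_self_eq_zero_iff x).1 h
  set d := T X with hd
  set ε := d / (8 * (1 + ‖X‖)) with hεd
  have hn : 0 < 1 + ‖X‖ := by positivity
  have hε : 0 < ε := by positivity
  have hε2 : ε * (1 + ‖X‖) = d / 8 := by rw [hεd]; field_simp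
  obtain ⟨B, p, hfd, hp, hpB, hu, h1, h2, h3⟩ := c.tr0 {X} hε
  obtain ⟨b, hb, hbsa, hbn⟩ := sa_approx hXsa hp (h2 X (by simp))
  obtain ⟨ψ, hψB, hψ, hψb, hψ1, hψ2, -⟩ := fd_thr B hp hu hb hbsa (η := d / 4) (by positivity)
  have hsa1 : star (p * X * p - b) = p * X * p - b := by
    simp [hp.st, hXsa, hbsa, mul_assoc]
  have hTp : T (1 - p) = 1 - T p := by rw [map_sub, c.tr.one]
  have hTb : d - d / 8 ≤ T b := by
    have k1 : T (p * X * p - b) ≤ ε := (le_abs_self _).trans ((c.tr.abs_le _).trans hbn.le)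
    have k2 : T (p * X * p) = T X - T (X * (1 - p)) := by
      rw [mul_assoc, c.tr.comm, mul_assoc, hp.mm, mul_sub, map_sub, mul_one]; ring
    have k3 : T (X * (1 - p)) ≤ ‖X‖ * T (1 - p) :=
      (le_abs_self _).trans (c.tr.abs_mul_le X hp.compl.nonneg')
    rw [map_sub, k2] at k1
    have k4 : ‖X‖ * T (1 - p) ≤ ‖X‖ * ε := mul_le_mul_of_nonneg_left h3.le (norm_nonneg _)
    nlinarith
  have hψ0 : ψ ≠ 0 := by
    intro h
    rw [h] at hψ2
    have := c.tr.mono hψ2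
    simp only [zero_mul, sub_zero, map_smul, smul_eq_mul] at this
    have hp1 := c.tr.le_one hp.le_one'
    nlinarith
  have hε3 : ε ≤ d / 8 := by nlinarith [norm_nonneg X]
  have hψX : (d / 8) • ψ ≤ ψ * X * ψ := by
    have k1 := neg_smul_le_sa hsa1 hbn.le
    have k2 := conj_mono k1 ψ
    have hψp := hu ψ hψB
    have e1 : star ψ * (p * X * p - b) * ψ = ψ * X * ψ - ψ * b := by
      rw [hψ.st, mul_sub, sub_mul, mul_assoc ψ b ψ, ← hψb, ← mul_assoc ψ ψ b, hψ.mm]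
      congr 1
      calc _ = (ψ * p) * X * (p * ψ) := by simp only [mul_assoc]
        _ = _ := by rw [hψp.1, hψp.2]
    have e2 : star ψ * (-(ε • (1 : A))) * ψ = -(ε • ψ) := by
      rw [hψ.st]; simp [hψ.mm]
    rw [e1, e2] at k2
    have k3 := add_le_add k2 hψ1
    rw [sub_add_cancel, neg_add_eq_sub, ← sub_smul] at k3
    exact (smul_le_smul_of_nonneg_right (by linarith) hψ.nonneg').trans k3
  have hyy : star (x * ψ) * (x * ψ) = ψ * X * ψ := by
    rw [star_mul, hψ.st, hx, hX]; simp only [mul_assoc]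
  rw [← hyy] at hψX
  obtain ⟨w, k, hw, hwk, -, hks⟩ := pol hψ (y := x * ψ) (by rw [mul_assoc, hψ.mm]) (by positivity) hψX
  refine ⟨w * star w, ψ * k * (k * ψ), (partial_iso_proj hψ hw).2, ?_, ?_⟩
  · intro h
    have h4 := (CStarRing.mul_star_self_eq_zero_iff _).1 h
    rw [h4] at hw
    exact hψ0 (by simpa using hw.symm)
  · rw [hwk]; simp only [star_mul, hks, hx, hψ.st, mul_assoc]

/-- commutator bound with a projection -/
theorem comm_bound (hT : IsTr T) {z : A} (hz : IsProjection z) (x y : A) :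
    |T (z * (x * y)) - T (z * (y * x))| ≤ 2 * (‖z * x - x * z‖ * ‖y‖) * T z := by
  set k := z * x - x * z with hk
  have e1 : k = z * k + k * z := by
    rw [hk, mul_sub, sub_mul, ← mul_assoc, ← mul_assoc, hz.mm, mul_assoc x z z, hz.mm]; abel
  have e2 : T (z * (x * y)) - T (z * (y * x)) = T (z * (k * y)) + T ((y * k) * z) := by
    have a1 : T (z * (y * x)) = T (x * z * y) := by
      rw [← mul_assoc, hT.comm, mul_assoc]
    have a2 : T ((y * k) * z) = T (k * z * y) := by
      rw [mul_assoc, hT.comm]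
    rw [a1, a2, ← mul_assoc, ← map_sub, ← sub_mul, ← hk, ← mul_assoc, ← map_add, ← add_mul, ← e1]
  rw [e2]
  have b1 := hT.abs_mul_le' (k * y) hz.nonneg'
  have b2 := hT.abs_mul_le (y * k) hz.nonneg'
  have hz0 := hT.nonneg hz.nonneg'
  have n1 := mul_le_mul_of_nonneg_right (norm_mul_le k y) hz0
  have n2 := mul_le_mul_of_nonneg_right (norm_mul_le y k) hz0
  have := abs_add_le (T (z * (k * y))) (T ((y * k) * z))
  nlinarith

theorem ultra_lim {ι : Type*} (U : Ultrafilter ι) (f : ι → ℝ) {M : ℝ} (h : ∀ i, |f i| ≤ M) :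
    ∃ l, Tendsto f U (𝓝 l) := by
  have hc : IsCompact (Set.Icc (-M) M) := isCompact_Icc
  obtain ⟨l, -, hl⟩ := hc.ultrafilter_le_nhds (U.map f) (by
    rw [le_principal_iff]
    exact Filter.mem_map.2 (Filter.univ_mem' fun i => abs_le.1 (h i)))
  exact ⟨l, hl⟩

/-- asymptotic independence -/
theorem Ctx.indep (c : Ctx α T) (F : Finset A) {ε : ℝ} (hε : 0 < ε) :
    ∃ (F' : Finset A) (ε' : ℝ), 0 < ε' ∧ ∀ z, IsProjection z → Cen F' ε' z →
      ∀ a ∈ F, |T (z * a) - T z * T a| ≤ ε * T z := by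
  classical
  by_contra hcon
  push Not at hcon
  have hch : ∀ i : Finset A × ℕ, ∃ z, IsProjection z ∧ Cen i.1 (1 / ((i.2 : ℝ) + 1)) z ∧
      ∃ a ∈ F, ε * T z < |T (z * a) - T z * T a| := fun i =>
    hcon i.1 (1 / ((i.2 : ℝ) + 1)) (by positivity)
  choose z hz hzc a ha hza using hch
  have hz0 : ∀ i, 0 < T (z i) := by
    intro i
    refine c.fproj (hz i) fun h => ?_
    have := hza i
    rw [h] at this
    simp at this
  let L : Finset A × ℕ → A → ℝ := fun i x => T (z i * x) / T (z i)
  have hLb : ∀ i x, |L i x| ≤ ‖x‖ := by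
    intro i x
    simp only [L, abs_div, abs_of_pos (hz0 i)]
    rw [div_le_iff₀ (hz0 i)]
    exact c.tr.abs_mul_le' x (hz i).nonneg'
  let U : Ultrafilter (Finset A × ℕ) := Ultrafilter.of atTop
  have hU : (U : Filter (Finset A × ℕ)) ≤ atTop := Ultrafilter.of_le _
  choose l hl using fun x => ultra_lim U (fun i => L i x) (fun i => hLb i x)
  let T' : A →ₗ[ℝ] ℝ :=
    { toFun := l
      map_add' := by
        intro x y
        refine tendsto_nhds_unique (hl (x + y)) (((hl x).add (hl y)).congr fun i => ?_)
        simp [L, mul_add, add_div]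
      map_smul' := by
        intro r x
        refine tendsto_nhds_unique (hl (r • x)) (((hl x).const_mul r).congr fun i => ?_)
        simp [L, mul_div_assoc] }
  have hT' : IsTr T' := by
    refine ⟨?_, ?_, ?_, ?_⟩
    · intro x
      refine ge_of_tendsto' (hl _) fun i => ?_
      exact div_nonneg (c.tr.mul_nn (hz i).nonneg' (star_mul_self_nonneg x)) (hz0 i).le
    · refine tendsto_nhds_unique (hl 1) (tendsto_const_nhds.congr fun i => ?_)
      simp only [L, mul_one]
      rw [div_self (hz0 i).ne']
    · intro x y
      have key : Tendsto (fun i => L i (x * y) - L i (y * x)) U (𝓝 0) := by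
        refine Tendsto.mono_left ?_ hU
        have hb : ∀ᶠ i : Finset A × ℕ in atTop, |L i (x * y) - L i (y * x)| ≤
            2 * ((1 / ((i.2 : ℝ) + 1)) * ‖y‖) := by
          filter_upwards [eventually_ge_atTop (({x} : Finset A), 0)] with i hi
          have hx : x ∈ i.1 := hi.1 (by simp)
          have h1 := (hzc i x hx).le
          have h2 := comm_bound c.tr (hz i) x y
          have h3 : L i (x * y) - L i (y * x) =
            (T (z i * (x * y)) - T (z i * (y * x))) / T (z i) := by simp only [L]; ring
          rw [h3, abs_div, abs_of_pos (hz0 i), div_le_iff₀ (hz0 i)]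
          refine h2.trans ?_
          have := hz0 i
          gcongr
        have ht : Tendsto (fun i : Finset A × ℕ => 2 * ((1 / ((i.2 : ℝ) + 1)) * ‖y‖)) atTop (𝓝 0) := by
          have h1 : Tendsto (fun i : Finset A × ℕ => 1 / ((i.2 : ℝ) + 1)) atTop (𝓝 0) := by
            have := tendsto_one_div_add_atTop_nhds_zero_nat (𝕜 := ℝ)
            rw [← prod_atTop_atTop_eq]
            exact this.comp tendsto_snd
          have := (h1.mul_const ‖y‖).const_mul 2
          simpa using this
        rw [tendsto_zero_iff_abs_tendsto_zero]
        exact squeeze_zero' (Eventually.of_forall fun i => abs_nonneg _) hb ht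
      have := tendsto_nhds_unique key ((hl (x * y)).sub (hl (y * x)))
      exact sub_eq_zero.1 this.symm
    · intro x
      refine tendsto_nhds_unique (hl _) ((hl x).congr fun i => ?_)
      simp only [L]
      congr 1
      rw [← c.tr.tstar, star_mul, (hz i).st, c.tr.comm]
  have hTT := c.uniq T' hT'
  have hlT : ∀ x, l x = T x := fun x => by rw [← hTT]; rfl
  have hev : ∀ᶠ i in (U : Filter (Finset A × ℕ)), ∀ x ∈ F, |L i x - T x| < ε := by
    rw [Finset.eventually_all]
    intro x _
    have h1 := (hl x).sub_const (T x)
    rw [hlT, sub_self, tendsto_zero_iff_abs_tendsto_zero] at h1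
    exact h1.eventually (gt_mem_nhds hε)
  obtain ⟨i, hi⟩ := hev.exists
  have h1 := hi (a i) (ha i)
  have h2 := hza i
  have h3 : L i (a i) - T (a i) = (T (z i * a i) - T (z i) * T (a i)) / T (z i) := by
    have := (hz0 i).ne'
    simp only [L]; field_simp
  rw [h3, abs_div, abs_of_pos (hz0 i), div_lt_iff₀ (hz0 i)] at h1
  linarith
end ctx

set_option linter.unusedSectionVars false

section comparison
variable {A : Type*} [CStarAlgebra A] [PartialOrder A] [StarOrderedRing A]
variable {α : A ≃⋆ₐ[ℂ] A} {T : A →ₗ[ℝ] ℝ}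

theorem PLE.trans' {a b d : A} (h1 : PLE a b) (h2 : PLE b d) : PLE a d := by
  obtain ⟨w, hw, hw'⟩ := h1
  obtain ⟨u, hu, hu'⟩ := h2
  refine ⟨u * w, ?_, by rw [← mul_assoc, hu']⟩
  rw [star_mul, mul_assoc, ← mul_assoc (star u), hu, hw', hw]

theorem PLE.add' {a b d e : A} (hd : IsProjection d) (he : IsProjection e) (hde : d * e = 0)
    (h1 : PLE a d) (h2 : PLE b e) : PLE (a + b) (d + e) := by
  obtain ⟨w, hw, hw'⟩ := h1
  obtain ⟨u, hu, hu'⟩ := h2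
  have hed : e * d = 0 := by
    have := congrArg star hde
    rwa [star_mul, hd.st, he.st, star_zero] at this
  have x1 : d * u = 0 := by rw [← hu', ← mul_assoc, hde, zero_mul]
  have x2 : e * w = 0 := by rw [← hw', ← mul_assoc, hed, zero_mul]
  have x3 : star w * u = 0 := by
    rw [← hw', star_mul, hd.st, mul_assoc, x1, mul_zero]
  have x4 : star u * w = 0 := by
    rw [← hu', star_mul, he.st, mul_assoc, x2, mul_zero]
  refine ⟨w + u, ?_, ?_⟩
  · rw [star_add, add_mul, mul_add, mul_add, x3, x4, hw, hu]; simp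
  · rw [add_mul, mul_add, mul_add, x1, x2, hw', hu']; simp

theorem norm_conj_le {p a : A} (hp : ‖p‖ ≤ 1) {q : A} (hq : ‖q‖ ≤ 1) : ‖p * a * q‖ ≤ ‖a‖ := by
  calc ‖p * a * q‖ ≤ ‖p‖ * ‖a‖ * ‖q‖ := norm_mul₃_le
    _ ≤ 1 * ‖a‖ * 1 := by gcongr
    _ = _ := by ring

theorem norm_mul_le_l {p a : A} (hp : ‖p‖ ≤ 1) : ‖p * a‖ ≤ ‖a‖ := by
  calc ‖p * a‖ ≤ ‖p‖ * ‖a‖ := norm_mul_le _ _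
    _ ≤ 1 * ‖a‖ := by gcongr
    _ = _ := by ring

theorem norm_mul_le_r {p a : A} (hp : ‖p‖ ≤ 1) : ‖a * p‖ ≤ ‖a‖ := by
  calc ‖a * p‖ ≤ ‖a‖ * ‖p‖ := norm_mul_le _ _
    _ ≤ ‖a‖ * 1 := by gcongr
    _ = _ := by ring

/-- cutting a projection down to the finite dimensional subalgebra -/
theorem proj_cut (B : NonUnitalStarSubalgebra ℂ A) [FiniteDimensional ℂ B] {p q : A}
    (hp : IsProjection p) (hu : ∀ b ∈ B, p * b = b ∧ b * p = b) (hq : IsProjection q)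
    {ε : ℝ} (hε : ε ≤ 1) (h1 : ‖q * p - p * q‖ < ε)
    (h2 : ∃ b ∈ B, ‖p * q * p - b‖ < ε) :
    ∃ χ ∈ B, IsProjection χ ∧ ‖χ - p * q * p‖ ≤ 11 * ε ∧ ‖χ - q * χ‖ ≤ 12 * ε ∧
      ‖(p - χ) * q‖ ≤ 12 * ε := by
  obtain ⟨b, hb, hbs, hbn⟩ := sa_approx hq.st hp h2
  obtain ⟨χ, hχB, hχ, -, -, -, hn⟩ := fd_thr B hp hu hb hbs (η := 1 / 2) (by norm_num)
  have hn := hn rfl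
  set X := p * q * p with hX
  have hXn : ‖X‖ ≤ 1 := (norm_conj_le hp.norm_le hp.norm_le).trans hq.norm_le
  have hXX : ‖X * X - X‖ ≤ ε := by
    have : X * X - X = p * (q * ((-1 : ℝ) • (q * p - p * q))) * p := by
      rw [hX]
      have e1 : p * (q * (q * p - p * q)) * p = p * (q * q) * (p * p) - p * q * p * q * p := by
        noncomm_ring
      have e2 : p * q * p * (p * q * p) = p * q * (p * p) * q * p := by noncomm_ring
      rw [mul_smul_comm, mul_smul_comm, smul_mul_assoc, e1, e2, hq.mm, hp.mm, neg_one_smul]; abel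
    rw [this]
    refine (norm_conj_le hp.norm_le hp.norm_le).trans ((norm_mul_le_l hq.norm_le).trans ?_)
    rw [norm_smul]; simpa using h1.le
  have hd : ‖X - b‖ ≤ ε := hbn.le
  have hε0 : 0 ≤ ε := (norm_nonneg _).trans hd
  have hbb : ‖b * b - b‖ ≤ 5 * ε := by
    have e : b * b - b = (X * X - X) - X * (X - b) - (X - b) * X + (X - b) * (X - b) + (X - b) := by
      noncomm_ring
    rw [e]
    have n1 := norm_mul_le_l (a := X - b) hXn
    have n2 := norm_mul_le_r (a := X - b) hXn
    have n3 : ‖(X - b) * (X - b)‖ ≤ ‖X - b‖ := norm_mul_le_l (hd.trans hε)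
    calc _ ≤ ‖X * X - X‖ + ‖X * (X - b)‖ + ‖(X - b) * X‖ + ‖(X - b) * (X - b)‖ + ‖X - b‖ := by
          refine (norm_add_le _ _).trans (add_le_add_left ((norm_add_le _ _).trans
            (add_le_add_left ((norm_sub_le _ _).trans (add_le_add_left (norm_sub_le _ _) _)) _)) _)
      _ ≤ _ := by linarith
  have hχX : ‖χ - X‖ ≤ 11 * ε := by
    have : χ - X = (χ - b) - (X - b) := by abel
    rw [this]
    refine (norm_sub_le _ _).trans ?_
    linarith
  refine ⟨χ, hχB, hχ, hχX, ?_, ?_⟩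
  · have : χ - q * χ = (1 - q) * (χ - X) + (1 - q) * ((-1 : ℝ) • (q * p - p * q)) * p := by
      have e : (1 - q) * ((-1 : ℝ) • (q * p - p * q)) * p = (1 - q) * X - (q - q * q) * (p * p) := by
        rw [hX, mul_smul_comm, smul_mul_assoc, neg_one_smul]; noncomm_ring
      rw [e, hq.mm]; noncomm_ring
    rw [this]
    have n1 := norm_mul_le_l (a := χ - X) hq.compl.norm_le
    have n2 := norm_conj_le (a := (-1 : ℝ) • (q * p - p * q)) hq.compl.norm_le hp.norm_le
    rw [norm_smul] at n2
    simp only [norm_neg, norm_one, one_mul] at n2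
    refine (norm_add_le _ _).trans ?_
    linarith
  · have : (p - χ) * q = (X - χ) * q + (-1 : ℝ) • ((q * p - p * q) * (1 - p) * q) := by
      have e : (q * p - p * q) * (1 - p) * q = (q * p - q * (p * p)) * q - p * (q * q) + X * q := by
        rw [hX]; noncomm_ring
      rw [e, hp.mm, hq.mm, neg_one_smul]; noncomm_ring
    rw [this]
    have n1 := norm_mul_le_r (a := X - χ) hq.norm_le
    have n2 := (norm_mul_le_r (a := (q * p - p * q) * (1 - p)) hq.norm_le).trans
      (norm_mul_le_r (a := q * p - p * q) hp.compl.norm_le)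
    have n3 := norm_sub_rev X χ
    refine (norm_add_le _ _).trans ?_
    rw [norm_smul]
    simp only [norm_neg, norm_one, one_mul]
    linarith

theorem Ctx.comparison (c : Ctx α T) {x : A} (hx : IsPos x) (h0 : x ≠ 0) :
    ∃ δ > 0, ∀ q, IsProjection q → T q < δ → CuntzLE q x := by
  classical
  obtain ⟨f, z, hf, hf0, hfz⟩ := c.sp (sa_of_nonneg hx.nonneg) h0
  obtain ⟨f1, f2, hf1, hf2, hff, hf10, hf20⟩ := c.split hf hf0
  have hd0 := c.fproj hf2 hf20
  set d := T f2 with hd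
  refine ⟨d / 2, by positivity, fun q hq hTq => ?_⟩
  have hd1 : d ≤ 1 := c.tr.le_one hf2.le_one'
  obtain ⟨F', ε', hε', hind⟩ := c.indep {q, f2} (ε := d / 16) (by positivity)
  set ε := min (ε' / 4) (d / 100) with hεd
  have hε : 0 < ε := by positivity
  have hε1 : ε ≤ d / 100 := min_le_right _ _
  have hε4 : 4 * ε ≤ ε' := by have := min_le_left (ε' / 4) (d / 100); linarith
  obtain ⟨B, p, hfd, hp, hpB, hu, a5, a6, a7⟩ := c.TR (F' ∪ {q, f2}) ε hε f1 hf1.isPos hf10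
  obtain ⟨q', hq'B, hq', b1, b2, b3⟩ := proj_cut B hp hu hq (by linarith) (a5 q (by simp)) (a6 q (by simp))
  obtain ⟨χ, hχB, hχ, c1, c2, c3⟩ :=
    proj_cut B hp hu hf2 (by linarith) (a5 f2 (by simp)) (a6 f2 (by simp))
  obtain ⟨N, v, r, Q, hMU⟩ := exists_MU B hp hpB
  have hzp : ∀ k, p * zMU v r Q k = zMU v r Q k ∧ zMU v r Q k * p = zMU v r Q k := fun k =>
    sub_of_sum Finset.univ _ p (fun k _ => hMU.z_proj k) hp hMU.z_sum k (Finset.mem_univ k)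
  have key : ∀ k, ∀ a χ : A, (a = q ∨ a = f2) → ‖χ - p * a * p‖ ≤ 11 * ε →
      |T (zMU v r Q k * χ) - T (zMU v r Q k) * T a| ≤ (d / 16 + 11 * ε) * T (zMU v r Q k) := by
    intro k a χ ha hn
    have hz := hMU.z_proj k
    have hi := hind _ hz (fun x hx => (near_central (B := B) hp (hzp k).1 (hzp k).2 hz.norm_le
      (fun b hb => hMU.z_comm hu k hb) (a5 x (Finset.mem_union_left _ hx))
      (a6 x (Finset.mem_union_left _ hx))).trans_le hε4) a (by simpa using ha)
    have e1 : T (zMU v r Q k * (p * a * p)) = T (zMU v r Q k * a) := by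
      rw [← mul_assoc, ← mul_assoc, (hzp k).2, c.tr.comm, ← mul_assoc, (hzp k).1]
    have e2 := (c.tr.abs_mul_le' (χ - p * a * p) hz.nonneg').trans
      (mul_le_mul_of_nonneg_right hn (c.tr.nonneg hz.nonneg'))
    rw [mul_sub, map_sub, e1] at e2
    have := abs_add_le (T (zMU v r Q k * χ) - T (zMU v r Q k * a))
      (T (zMU v r Q k * a) - T (zMU v r Q k) * T a)
    rw [sub_add_sub_cancel] at this
    linarith
  obtain ⟨w, hwB, hw1, hw2⟩ := hMU.compare hu c.tr (fun q h1 h2 => c.fproj h1 h2) _ q' χ hq'B hχB hq' hχ rfl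
    (by
      intro k
      have k1 := (abs_le.1 (key k q q' (Or.inl rfl) b1)).2
      have k2 := (abs_le.1 (key k f2 χ (Or.inr rfl) c1)).1
      have hz := c.tr.nonneg (hMU.z_proj k).nonneg'
      rw [← hd] at k2
      nlinarith [mul_le_mul_of_nonneg_left hTq.le hz, mul_le_mul_of_nonneg_left hε1 hz, mul_nonneg hz hd0.le])
  have p1 : PLE q' χ := ⟨w, hw1, hw2⟩
  have p2 : PLE χ f2 := by
    obtain ⟨w, g1, g2, -, -⟩ := pert hχ hf2 (δ := 12 * ε) (by linarith) c2
    exact ⟨w, g1, g2⟩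
  have p3 : PLE (1 - p) f1 := ple_of_cuntz hf1 a7
  have h12 : f2 * f1 = 0 := by
    have hs : ∑ i : Fin 2, ![f1, f2] i = f := by simpa [Fin.sum_univ_two] using hff
    have := proj_orth_of_sum Finset.univ ![f1, f2] f (by intro i _; fin_cases i <;> simpa) hf hs
      1 (Finset.mem_univ _) 0 (Finset.mem_univ _) (by decide)
    simpa using this
  have p4 : PLE (q' + (1 - p)) (f2 + f1) := PLE.add' hf2 hf1 h12 (p1.trans' p2) p3
  have hR : IsProjection (q' + (1 - p)) := hq'.add' hp.compl (by
    rw [sub_mul, one_mul, (hu q' hq'B).1, sub_self])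
  have p5 : PLE q (q' + (1 - p)) := by
    obtain ⟨w, g1, g2, -, -⟩ := pert hq hR (δ := 12 * ε) (by linarith) (by
      have : q - (q' + (1 - p)) * q = (p - q') * q := by noncomm_ring
      rw [this]; exact b3)
    exact ⟨w, g1, g2⟩
  have p6 := p5.trans' p4
  rw [add_comm, hff] at p6
  obtain ⟨w, g1, g2⟩ := p6
  refine ⟨w, g1.symm, subset_closure ⟨z * x * (w * star w) * x * z, ?_⟩⟩
  have g3 : star w * f = star w := by
    have := congrArg star g2
    rwa [star_mul, hf.st] at this
  have : w * star w = f * (w * star w) * f := by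
    rw [← mul_assoc, g2, mul_assoc, g3]
  calc x * (z * x * (w * star w) * x * z) * x = (x * z * x) * (w * star w) * (x * z * x) := by
        simp only [mul_assoc]
    _ = w * star w := by rw [← hfz, ← this]
end comparison

set_option linter.unusedSectionVars false

theorem rounding {ι : Type*} [DecidableEq ι] (I : Finset ι) (t : ι → ℝ) (m : ι → ι → ℝ)
    {γ : ℝ} (h0 : 0 ≤ γ) (h1 : γ ≤ 1) :
    ∃ S ⊆ I, γ * ∑ i ∈ I, (t i - m i i) - γ ^ 2 * (∑ i ∈ I, ∑ j ∈ I, m i j - ∑ i ∈ I, m i i) ≤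
      ∑ i ∈ S, t i - ∑ i ∈ S, ∑ j ∈ S, m i j := by
  induction I using Finset.induction_on generalizing t with
  | empty => exact ⟨∅, subset_rfl, by simp⟩
  | insert a I ha ih =>
    obtain ⟨S1, hS1, h2⟩ := ih t
    obtain ⟨S2, hS2, h3⟩ := ih (fun i => t i - (m i a + m a i))
    have ha2 : a ∉ S2 := fun h => ha (hS2 h)
    set P := ∑ i ∈ I, (t i - m i i) with hP
    set D := ∑ i ∈ I, ∑ j ∈ I, m i j - ∑ i ∈ I, m i i with hD
    set X := ∑ i ∈ I, (m i a + m a i) with hX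
    have e1 : ∑ i ∈ insert a I, (t i - m i i) = (t a - m a a) + P := by
      rw [Finset.sum_insert ha]
    have e2 : ∑ i ∈ insert a I, ∑ j ∈ insert a I, m i j - ∑ i ∈ insert a I, m i i = D + X := by
      simp only [Finset.sum_insert ha, Finset.sum_add_distrib, hD, hX]; ring
    have e3 : ∑ i ∈ I, (t i - (m i a + m a i) - m i i) = P - X := by
      rw [hP, hX, ← Finset.sum_sub_distrib]
      exact Finset.sum_congr rfl fun i _ => by ring
    rw [e3] at h3
    rw [e1, e2]
    have e4 : ∑ i ∈ insert a S2, t i - ∑ i ∈ insert a S2, ∑ j ∈ insert a S2, m i j =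
        t a - m a a + (∑ i ∈ S2, (t i - (m i a + m a i)) - ∑ i ∈ S2, ∑ j ∈ S2, m i j) := by
      simp only [Finset.sum_insert ha2, Finset.sum_add_distrib, Finset.sum_sub_distrib]; ring
    by_contra hcon
    push Not at hcon
    have g1 := hcon S1 (hS1.trans (Finset.subset_insert _ _))
    have g2 := hcon (insert a S2) (Finset.insert_subset_insert _ hS2)
    rw [e4] at g2
    have g3 : γ * P - γ ^ 2 * D < γ * (t a - m a a + P) - γ ^ 2 * (D + X) := by linarith
    have g4 : t a - m a a + (γ * (P - X) - γ ^ 2 * D) < γ * (t a - m a a + P) - γ ^ 2 * (D + X) := by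
      linarith
    nlinarith [mul_nonneg h0 (sub_nonneg.2 g4.le), mul_nonneg (sub_nonneg.2 h1) (sub_nonneg.2 g3.le),
      mul_pos (show (0:ℝ) < 1 by norm_num) (sub_pos.2 g3), mul_nonneg h0 (sub_nonneg.2 g3.le)]

section Qsec
variable {A : Type*} [CStarAlgebra A] [PartialOrder A] [StarOrderedRing A]
variable {α : A ≃⋆ₐ[ℂ] A} {T : A →ₗ[ℝ] ℝ}

theorem pow_app (α : A ≃⋆ₐ[ℂ] A) (k : ℕ) (x : A) : (α ^ k) x = (⇑α)^[k] x := by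
  induction k generalizing x with
  | zero => rfl
  | succ k ih => rw [pow_succ, Function.iterate_succ_apply, ← ih]; rfl

theorem autZPow_nat (α : A ≃⋆ₐ[ℂ] A) (k : ℕ) : autZPow α (k : ℤ) = ⇑(α ^ k) := by
  funext x
  rw [pow_app]
  simp [autZPow]

theorem norm_alpha (β : A ≃⋆ₐ[ℂ] A) (x : A) : ‖β x‖ = ‖x‖ := by
  exact NonUnitalStarAlgHom.norm_map β β.injective x

theorem Ctx.refine_list (c : Ctx α T) (L : List (A × ℕ)) (hL : ∀ l ∈ L, l.2 ≠ 0) {q : A}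
    (hq : IsProjection q) {ε : ℝ} (hε : 0 < ε) :
    ∃ (ι : Type) (_ : Fintype ι) (y : ι → A), (∀ i, IsProjection (y i)) ∧ ∑ i, y i = q ∧
      ∀ i, ∀ l ∈ L, ‖y i * l.1 * (α ^ l.2) (y i)‖ < ε := by
  induction L with
  | nil => exact ⟨Unit, inferInstance, fun _ => q, fun _ => hq, by simp, by simp⟩
  | cons l L ih =>
    obtain ⟨ι, _, y, hy, hs, hn⟩ := ih (fun l hl => hL l (List.mem_cons_of_mem _ hl))
    have hl0 : (l.2 : ℤ) ≠ 0 := by exact_mod_cast hL l (List.mem_cons_self)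
    choose n z hz hzs hzn using fun i => c.out l.2 hl0 l.1 (y i) (hy i) ε hε
    refine ⟨Σ i, Fin (n i), inferInstance, fun x => z x.1 x.2, fun x => hz _ _, ?_, ?_⟩
    · rw [Fintype.sum_sigma]; simp only [hzs, hs]
    · rintro ⟨i, j⟩ l' hl'
      simp only
      rcases List.mem_cons.1 hl' with rfl | h
      · have := hzn i j
        rwa [autZPow_nat] at this
      · have hsub := sub_of_sum Finset.univ (z i) (y i) (fun j _ => hz i j) (hy i) (hzs i) j (Finset.mem_univ _)
        have : z i j * l'.1 * (α ^ l'.2) (z i j) =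
            z i j * (y i * l'.1 * (α ^ l'.2) (y i)) * (α ^ l'.2) (z i j) := by
          calc _ = (z i j * y i) * l'.1 * (α ^ l'.2) (y i * z i j) := by rw [hsub.1, hsub.2]
            _ = _ := by rw [map_mul]; simp only [mul_assoc]
        rw [this]
        exact (norm_conj_le (hz i j).norm_le (alpha_proj (hz i j) _).norm_le).trans_lt (hn i l' h)

theorem Ctx.inv_pow (c : Ctx α T) (k : ℕ) (x : A) : T ((α ^ k) x) = T x := by
  induction k with
  | zero => rfl
  | succ k ih => rw [pow_succ']; exact (c.inv _).trans ih

theorem Ctx.exists_g (c : Ctx α T) (M : ℕ) {σ : ℝ} (hσ : 0 < σ) :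
    ∃ d > 0, ∀ (F : Finset A) (ε : ℝ), 0 < ε → ∃ g, IsProjection g ∧ Cen F ε g ∧ d ≤ T g ∧
      ∀ k, 1 ≤ k → k ≤ M → T (g * (α ^ k) g) ≤ σ * T g := by
  classical
  set M' : ℝ := M + 1 with hM'
  have hM0 : 0 < M' := by positivity
  set γ := min 1 (σ / (2 * M')) with hγ
  have hγ0 : 0 < γ := by positivity
  have hγ1 : γ ≤ 1 := min_le_left _ _
  have hγσ : 2 * M' * γ ≤ σ := by
    have := min_le_right 1 (σ / (2 * M'))
    rw [← hγ, le_div_iff₀ (by positivity)] at this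
    linarith
  refine ⟨γ / 3, by positivity, fun F ε hε => ?_⟩
  obtain ⟨B, p, hfd, hp, hpB, hu, a5, a6, a7⟩ := c.tr0 F (ε := min (ε / 4) (1 / 12)) (by positivity)
  obtain ⟨N, v, r, Q, hMU⟩ := exists_MU B hp hpB
  set τ := γ / 6 with hτ
  have hτ0 : 0 < τ := by positivity
  set τ' := τ / ((N : ℝ) * N + 1) with hτ'
  have hτ'0 : 0 < τ' := by positivity
  let L : List (A × ℕ) :=
    ((Finset.univ : Finset (Fin N × Fin N)) ×ˢ Finset.Icc 1 M).toList.map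
      fun x => (star (v x.1.1) * (α ^ x.2) (v x.1.2), x.2)
  have hL : ∀ l ∈ L, l.2 ≠ 0 := by
    intro l hl
    simp only [L, List.mem_map, Finset.mem_toList, Finset.mem_product, Finset.mem_Icc] at hl
    obtain ⟨x, hx, rfl⟩ := hl
    simp only; omega
  choose ι hι y hy hys hyn using fun k => c.refine_list L hL (hMU.Qp k) hτ'0
  let Y : (Σ k, ι k) → Fin N → A := fun x k => if h : k = x.1 then y x.1 x.2 else 0
  have hYp : ∀ x k, IsProjection (Y x k) := by
    intro x k
    simp only [Y]
    split_ifs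
    · exact hy _ _
    · exact isProjection_zero
  have hysub := fun k i => sub_of_sum Finset.univ (y k) (Q k) (fun i _ => hy k i) (hMU.Qp k) (hys k) i
    (Finset.mem_univ _)
  have hYQ : ∀ x k, Q k * Y x k = Y x k ∧ Y x k * Q k = Y x k := by
    rintro ⟨k', i⟩ k
    simp only [Y]
    split_ifs with h
    · subst h; exact hysub _ _
    · simp
  let f : (Σ k, ι k) → A := fun x => eMU v r (Y x)
  have hf : ∀ x, IsProjection (f x) := fun x => hMU.e_proj _ (fun k => (hYQ x k).2) (hYp x)
  have hfs : ∑ x, f x = p := by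
    have : (fun k => ∑ x, Y x k) = Q := by
      funext k
      rw [Fintype.sum_sigma, Finset.sum_eq_single k]
      · simp only [Y, dite_true]; exact hys k
      · intro k' _ hk
        simp [Y, hk.symm]
      · simp
    rw [e_sum, this, hMU.e_Q]
  have hfc : ∀ x, ∀ b ∈ B, f x * b = b * f x := fun x b hb =>
    hMU.e_comm hu (Y x) (fun k => (hYQ x k).1) (fun k => (hYQ x k).2) hb
  have hfn : ∀ x, ∀ k ∈ Finset.Icc 1 M, ‖f x * (α ^ k) (f x)‖ ≤ τ := by
    intro x k hk
    have e : f x * (α ^ k) (f x) = ∑ s, ∑ t, v s *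
        (Y x (r s) * (star (v s) * (α ^ k) (v t)) * (α ^ k) (Y x (r t))) * (α ^ k) (star (v t)) := by
      simp only [f, eMU, map_sum, Finset.sum_mul_sum, map_mul, mul_assoc]
    rw [e]
    have hterm : ∀ s t, ‖v s * (Y x (r s) * (star (v s) * (α ^ k) (v t)) * (α ^ k) (Y x (r t))) *
        (α ^ k) (star (v t))‖ ≤ τ' := by
      intro s t
      refine (norm_conj_le (hMU.norm_v s) ?_).trans ?_
      · rw [norm_alpha, norm_star]; exact hMU.norm_v t
      by_cases h1 : r s = x.1
      · by_cases h2 : r t = x.1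
        · have hk1 : Y x (r s) = y x.1 x.2 := by simp [Y, h1]
          have hk2 : Y x (r t) = y x.1 x.2 := by simp [Y, h2]
          rw [hk1, hk2]
          exact (hyn x.1 x.2 (star (v s) * (α ^ k) (v t), k) (by
            simp only [L, List.mem_map, Finset.mem_toList, Finset.mem_product]
            exact ⟨((s, t), k), ⟨Finset.mem_univ _, hk⟩, rfl⟩)).le
        · have hk2 : Y x (r t) = 0 := by simp [Y, h2]
          rw [hk2]; simp [hτ'0.le]
      · have hk1 : Y x (r s) = 0 := by simp [Y, h1]
        rw [hk1]; simp [hτ'0.le]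
    calc _ ≤ ∑ s : Fin N, ∑ t : Fin N, τ' :=
          norm_sum_le_of_le _ fun s _ => norm_sum_le_of_le _ fun t _ => hterm s t
      _ = (N : ℝ) * N * τ' := by simp; ring
      _ ≤ τ := by
        rw [hτ']
        have : ((N : ℝ) * N + 1) * (τ / ((N : ℝ) * N + 1)) = τ := by field_simp
        nlinarith
  -- rounding
  set μ := 1 / (2 * M' * γ) with hμ
  have hμ0 : 0 < μ := by positivity
  have hμγ : μ * M' * γ = 1 / 2 := by rw [hμ]; field_simp
  let m : (Σ k, ι k) → (Σ k, ι k) → ℝ := fun i j => μ * ∑ k ∈ Finset.Icc 1 M, T (f i * (α ^ k) (f j))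
  have hpos : ∀ i j k, 0 ≤ T (f i * (α ^ k) (f j)) := fun i j k =>
    c.tr.mul_nn (hf i).nonneg' (alpha_proj (hf j) _).nonneg'
  have hmS : ∀ S : Finset (Σ k, ι k), ∑ i ∈ S, ∑ j ∈ S, m i j =
      μ * ∑ k ∈ Finset.Icc 1 M, T ((∑ i ∈ S, f i) * (α ^ k) (∑ i ∈ S, f i)) := by
    intro S
    have : ∀ k, T ((∑ i ∈ S, f i) * (α ^ k) (∑ i ∈ S, f i)) = ∑ i ∈ S, ∑ j ∈ S, T (f i * (α ^ k) (f j)) := by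
      intro k
      rw [map_sum, Finset.sum_mul_sum, map_sum]
      exact Finset.sum_congr rfl fun i _ => map_sum _ _ _
    simp only [this, m, ← Finset.mul_sum]
    congr 1
    rw [Finset.sum_comm (s := Finset.Icc 1 M)]
    refine Finset.sum_congr rfl fun i _ => ?_
    rw [Finset.sum_comm]
  obtain ⟨S, -, hS⟩ := rounding Finset.univ (fun i => T (f i)) m hγ0.le hγ1
  rw [hmS, hmS, hfs] at hS
  set g := ∑ i ∈ S, f i with hg
  have horth := proj_orth_of_sum Finset.univ f p (fun i _ => hf i) hp hfs
  have hgp : IsProjection g := IsProjection.sum' S f (fun i _ => hf i)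
    fun i _ j _ hij => horth i (Finset.mem_univ _) j (Finset.mem_univ _) hij
  have hTg : ∑ i ∈ S, T (f i) = T g := by rw [hg, map_sum]
  rw [hTg] at hS
  have hTp : 11 / 12 ≤ T p := by
    have h1 := a7.trans_le (min_le_right _ _)
    rw [map_sub, c.tr.one] at h1; linarith
  have hTp1 : T p ≤ 1 := c.tr.le_one hp.le_one'
  have hmii : ∀ i, 0 ≤ m i i ∧ m i i ≤ μ * (M' * (τ * T (f i))) := by
    intro i
    refine ⟨mul_nonneg hμ0.le (Finset.sum_nonneg fun k _ => hpos _ _ _), ?_⟩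
    refine mul_le_mul_of_nonneg_left ?_ hμ0.le
    have hTf := c.tr.nonneg (hf i).nonneg'
    calc _ ≤ ∑ k ∈ Finset.Icc 1 M, τ * T (f i) := by
          refine Finset.sum_le_sum fun k hk => ?_
          have e1 : T (f i * (α ^ k) (f i)) = T ((f i * (α ^ k) (f i)) * f i) := by
            rw [c.tr.comm _ (f i), ← mul_assoc, (hf i).mm]
          rw [e1]
          refine (le_abs_self _).trans ((c.tr.abs_mul_le _ (hf i).nonneg').trans ?_)
          exact mul_le_mul_of_nonneg_right (hfn i k hk) hTf
      _ = M * (τ * T (f i)) := by simp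
      _ ≤ _ := by
        have : 0 ≤ τ * T (f i) := by positivity
        rw [hM']; nlinarith
  have b1 : T p - 1 / 12 ≤ ∑ i, (T (f i) - m i i) := by
    rw [Finset.sum_sub_distrib, ← map_sum, hfs]
    have : ∑ i, m i i ≤ ∑ i, μ * (M' * (τ * T (f i))) := Finset.sum_le_sum fun i _ => (hmii i).2
    have e0 : ∑ i, μ * (M' * (τ * T (f i))) = μ * (M' * (τ * T p)) := by
      rw [← hfs, map_sum]; simp only [Finset.mul_sum]
    rw [e0] at this
    have e : μ * (M' * (τ * T p)) = (μ * M' * γ) * T p / 6 := by rw [hτ]; ring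
    rw [e, hμγ] at this
    linarith
  have b2 : γ ^ 2 * (μ * ∑ k ∈ Finset.Icc 1 M, T (p * (α ^ k) p) - ∑ i, m i i) ≤ γ / 2 := by
    have h1 : 0 ≤ ∑ i, m i i := Finset.sum_nonneg fun i _ => (hmii i).1
    have h2 : ∑ k ∈ Finset.Icc 1 M, T (p * (α ^ k) p) ≤ M' := by
      calc _ ≤ ∑ k ∈ Finset.Icc 1 M, (1 : ℝ) := by
            refine Finset.sum_le_sum fun k hk => ?_
            refine (le_abs_self _).trans ((c.tr.abs_le _).trans ?_)
            exact (norm_mul_le_l hp.norm_le).trans (alpha_proj hp _).norm_le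
        _ = M := by simp
        _ ≤ _ := by rw [hM']; linarith
    have h3 : μ * ∑ k ∈ Finset.Icc 1 M, T (p * (α ^ k) p) - ∑ i, m i i ≤ μ * M' := by
      have := mul_le_mul_of_nonneg_left h2 hμ0.le
      linarith
    have h4 := mul_le_mul_of_nonneg_left h3 (sq_nonneg γ)
    have e : γ ^ 2 * (μ * M') = (μ * M' * γ) * γ := by ring
    rw [e, hμγ] at h4
    linarith
  have b3 := mul_le_mul_of_nonneg_left b1 hγ0.le
  have hov : ∀ k, 0 ≤ T (g * (α ^ k) g) := fun k =>
    c.tr.mul_nn hgp.nonneg' (alpha_proj hgp _).nonneg'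
  have b4 : 0 ≤ μ * ∑ k ∈ Finset.Icc 1 M, T (g * (α ^ k) g) :=
    mul_nonneg hμ0.le (Finset.sum_nonneg fun k _ => hov k)
  have b5 := mul_le_mul_of_nonneg_left hTp hγ0.le
  refine ⟨g, hgp, ?_, by linarith, ?_⟩
  · intro a ha
    have hgpp : p * g = g := by rw [hg, Finset.mul_sum]; exact Finset.sum_congr rfl fun i _ => hMU.pe _
    have hgpp' : g * p = g := by
      have := congrArg star hgpp
      rwa [star_mul, hgp.st, hp.st] at this
    refine (near_central (B := B) hp hgpp hgpp' hgp.norm_le ?_ (a5 a ha) (a6 a ha)).trans_le ?_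
    · intro b hb
      rw [hg, Finset.sum_mul, Finset.mul_sum]
      exact Finset.sum_congr rfl fun i _ => hfc i b hb
    · have := min_le_left (ε / 4) (1 / 12 : ℝ)
      linarith
  · intro k hk1 hk2
    have h1 : T (g * (α ^ k) g) ≤ ∑ k ∈ Finset.Icc 1 M, T (g * (α ^ k) g) :=
      Finset.single_le_sum (f := fun k => T (g * (α ^ k) g)) (fun k _ => hov k) (Finset.mem_Icc.2 ⟨hk1, hk2⟩)
    have h2 : μ * T (g * (α ^ k) g) ≤ T g := by
      have := mul_le_mul_of_nonneg_left h1 hμ0.le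
      linarith
    have h3 : T (g * (α ^ k) g) ≤ 2 * M' * γ * T g := by
      have e : T (g * (α ^ k) g) = 2 * M' * γ * (μ * T (g * (α ^ k) g)) := by
        rw [hμ]; field_simp
      rw [e]
      exact mul_le_mul_of_nonneg_left h2 (by positivity)
    exact h3.trans (mul_le_mul_of_nonneg_right hγσ (c.tr.nonneg hgp.nonneg'))
end Qsec

set_option linter.unusedSectionVars false

section tower
variable {A : Type*} [CStarAlgebra A] [PartialOrder A] [StarOrderedRing A]
variable {α : A ≃⋆ₐ[ℂ] A} {T : A →ₗ[ℝ] ℝ}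

noncomputable def tstep (q E : A) (s : ℝ) : A := (1 - q) * E * (1 - q) + s • q

noncomputable def tseq (q : ℕ → A) (s : ℕ → ℝ) (E : A) : ℕ → A
  | 0 => E
  | l + 1 => tstep (q l) (tseq q s E l) (s l)

theorem norm_le_one_of_unit {E : A} (h0 : 0 ≤ E) (h1 : E ≤ 1) : ‖E‖ ≤ 1 :=
  norm_le_of_le_smul zero_le_one h0 (by simpa using h1)

theorem tstep_unit {q E : A} {s : ℝ} (hq : IsProjection q) (h0 : 0 ≤ E) (h1 : E ≤ 1)
    (hs0 : 0 ≤ s) (hs1 : s ≤ 1) : 0 ≤ tstep q E s ∧ tstep q E s ≤ 1 := by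
  have a1 := conj_nonneg' h0 (1 - q)
  have a2 := conj_mono h1 (1 - q)
  rw [hq.compl.st] at a1 a2
  rw [mul_one, hq.compl.mm] at a2
  refine ⟨add_nonneg a1 (smul_nonneg hs0 hq.nonneg'), ?_⟩
  have a3 : s • q ≤ (1 : ℝ) • q := smul_le_smul_of_nonneg_right hs1 hq.nonneg'
  calc tstep q E s ≤ (1 - q) + (1 : ℝ) • q := add_le_add a2 a3
    _ = 1 := by rw [one_smul]; abel

theorem tseq_unit {q : ℕ → A} {s : ℕ → ℝ} {E : A} (hq : ∀ l, IsProjection (q l)) (h0 : 0 ≤ E)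
    (h1 : E ≤ 1) (hs : ∀ l, 0 ≤ s l ∧ s l ≤ 1) (l : ℕ) : 0 ≤ tseq q s E l ∧ tseq q s E l ≤ 1 := by
  induction l with
  | zero => exact ⟨h0, h1⟩
  | succ l ih => exact tstep_unit (hq l) ih.1 ih.2 (hs l).1 (hs l).2

theorem tstep_comm (ν : A → ℝ) (ha : ∀ x y, ν (x + y) ≤ ν x + ν y)
    (hl : ∀ d x : A, ‖d‖ ≤ 1 → ν (d * x) ≤ ν x) (hr : ∀ d x : A, ‖d‖ ≤ 1 → ν (x * d) ≤ ν x)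
    {q E : A} {s : ℝ} (hq : IsProjection q) (h0 : 0 ≤ E) (h1 : E ≤ 1)
    (hs0 : 0 ≤ s) (hs1 : s ≤ 1) (x : A) :
    ν (tstep q E s * x - x * tstep q E s) ≤ ν (E * x - x * E) + 3 * ν (q * x - x * q) := by
  have hE := norm_le_one_of_unit h0 h1
  have hp := hq.compl.norm_le
  have e : tstep q E s * x - x * tstep q E s = (1 - q) * (E * x - x * E) * (1 - q) +
      ((-((1 - q) * E)) * (q * x - x * q) + ((q * x - x * q) * (-(E * (1 - q))) +
        (s • (1 : A)) * (q * x - x * q))) := by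
    simp only [tstep, smul_mul_assoc, one_mul, add_mul, mul_add, mul_smul_comm, smul_sub]
    noncomm_ring
  rw [e]
  have n1 := (hr (1 - q) ((1 - q) * (E * x - x * E)) hp).trans (hl (1 - q) _ hp)
  have n2 := hl (-((1 - q) * E)) (q * x - x * q) (by
    rw [norm_neg]; exact (norm_mul_le_l hp).trans hE)
  have n3 := hr (-(E * (1 - q))) (q * x - x * q) (by
    rw [norm_neg]; exact (norm_mul_le_r hp).trans hE)
  have n4 := hl (s • (1 : A)) (q * x - x * q) (by
    rw [norm_smul, Real.norm_of_nonneg hs0]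
    exact (mul_le_of_le_one_right hs0 isProjection_one.norm_le).trans hs1)
  have := ha ((1 - q) * (E * x - x * E) * (1 - q)) ((-((1 - q) * E)) * (q * x - x * q) +
    ((q * x - x * q) * (-(E * (1 - q))) + (s • (1 : A)) * (q * x - x * q)))
  have := ha ((-((1 - q) * E)) * (q * x - x * q))
    ((q * x - x * q) * (-(E * (1 - q))) + (s • (1 : A)) * (q * x - x * q))
  have := ha ((q * x - x * q) * (-(E * (1 - q)))) ((s • (1 : A)) * (q * x - x * q))
  linarith

theorem tseq_comm (ν : A → ℝ) (ha : ∀ x y, ν (x + y) ≤ ν x + ν y)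
    (hl : ∀ d x : A, ‖d‖ ≤ 1 → ν (d * x) ≤ ν x) (hr : ∀ d x : A, ‖d‖ ≤ 1 → ν (x * d) ≤ ν x)
    {q : ℕ → A} {s : ℕ → ℝ} {E : A} (hq : ∀ l, IsProjection (q l)) (h0 : 0 ≤ E)
    (h1 : E ≤ 1) (hs : ∀ l, 0 ≤ s l ∧ s l ≤ 1) (x : A) {κ : ℝ} (l : ℕ)
    (hκ : ∀ i < l, ν (q i * x - x * q i) ≤ κ) :
    ν (tseq q s E l * x - x * tseq q s E l) ≤ ν (E * x - x * E) + l * (3 * κ) := by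
  induction l with
  | zero => simp [tseq]
  | succ l ih =>
    have hu := tseq_unit hq h0 h1 hs l
    have h2 := tstep_comm ν ha hl hr (hq l) hu.1 hu.2 (hs l).1 (hs l).2 x
    have h3 := ih fun i hi => hκ i (by omega)
    have h4 := hκ l (by omega)
    simp only [tseq]
    push_cast
    linarith

theorem n2_l (hT : IsTr T) (d x : A) (hd : ‖d‖ ≤ 1) : n2 T (d * x) ≤ n2 T x :=
  (hT.n2_mul_le d x).trans (mul_le_of_le_one_left (n2_nonneg x) hd)

theorem n2_r (hT : IsTr T) (d x : A) (hd : ‖d‖ ≤ 1) : n2 T (x * d) ≤ n2 T x := by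
  rw [← hT.n2_star, star_mul, ← hT.n2_star x]
  exact n2_l hT _ _ (by rwa [norm_star])

theorem tr_core (hT : IsTr T) {E G q : A} (hq : IsProjection q) (hE0 : 0 ≤ E) (hE1 : E ≤ 1)
    (hG0 : 0 ≤ G) :
    T (E * ((1 - q) * G * (1 - q))) ≤ T (E * G) + 2 * n2 T (G * q - q * G) * n2 T q := by
  have hE := norm_le_one_of_unit hE0 hE1
  set k := G * q - q * G with hk
  have e1 : (1 - q) * G * (1 - q) = G - q * G - (1 - q) * k * q := by
    have : (1 - q) * k * q = (1 - q) * G * (q * q) - (q - q * q) * G * q := by rw [hk]; noncomm_ring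
    rw [this, hq.mm]; noncomm_ring
  have e2 : T (E * (q * G)) = T (G * (q * E * q)) - T (k * (E * q)) := by
    have a1 : T (E * (q * G)) = T ((q * G) * (E * q)) := by
      calc T (E * (q * G)) = T (E * (q * q) * G) := by rw [hq.mm, mul_assoc]
        _ = T ((E * q) * (q * G)) := by simp only [mul_assoc]
        _ = _ := hT.comm _ _
    have a2 : q * G = G * q - k := by rw [hk]; abel
    rw [a1, a2, sub_mul, map_sub]; simp only [mul_assoc]
  have e3 : 0 ≤ T (G * (q * E * q)) := by
    have := conj_nonneg' hE0 q
    rw [hq.st] at this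
    exact hT.mul_nn hG0 this
  have e4 : |T (k * (E * q))| ≤ n2 T k * n2 T q := by
    have := hT.cs (star k) (E * q)
    rw [star_star, hT.n2_star] at this
    exact this.trans (mul_le_mul_of_nonneg_left (n2_l hT _ _ hE) (n2_nonneg k))
  have e5 : |T (E * ((1 - q) * k * q))| ≤ n2 T k * n2 T q := by
    have a1 : T (E * ((1 - q) * k * q)) = T (star q * ((E * (1 - q)) * k)) := by
      rw [hq.st, hT.comm q]; simp only [mul_assoc]
    rw [a1, mul_comm]
    refine (hT.cs _ _).trans (mul_le_mul_of_nonneg_left (n2_l hT _ _ ?_) (n2_nonneg q))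
    exact (norm_mul_le_r hq.compl.norm_le).trans hE
  rw [e1, mul_sub, mul_sub, map_sub, map_sub, e2]
  have := abs_le.1 e4
  have := abs_le.1 e5
  linarith

theorem T_tstep (hT : IsTr T) {q : A} (hq : IsProjection q) (E : A) (s : ℝ) :
    T (tstep q E s) = T E - T (E * q) + s * T q := by
  rw [tstep, map_add, map_smul, smul_eq_mul]
  congr 1
  rw [hT.comm, ← mul_assoc, hq.compl.mm, sub_mul, one_mul, map_sub, hT.comm q]

/-- product of two simultaneous steps -/
theorem tstep_mul (hT : IsTr T) {q : A} (hq : IsProjection q) (E G : A) {s t : ℝ} (hst : s * t = 0) :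
    T (tstep q E s * tstep q G t) = T (E * ((1 - q) * G * (1 - q))) := by
  have z1 : (1 - q) * q = 0 := by rw [sub_mul, one_mul, hq.mm, sub_self]
  have z2 : q * (1 - q) = 0 := by rw [mul_sub, mul_one, hq.mm, sub_self]
  have : tstep q E s * tstep q G t = (1 - q) * E * ((1 - q) * (1 - q)) * G * (1 - q) +
      t • ((1 - q) * E * ((1 - q) * q)) + s • ((q * (1 - q)) * G * (1 - q)) + (s * t) • (q * q) := by
    simp only [tstep, add_mul, mul_add, smul_mul_assoc, mul_smul_comm, smul_add, smul_smul, mul_assoc]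
    rw [mul_comm t s]
    abel
  rw [this, z1, z2, hst, hq.compl.mm]
  simp only [mul_zero, zero_mul, smul_zero, add_zero, zero_smul]
  calc T ((1 - q) * E * (1 - q) * G * (1 - q)) = T ((1 - q) * (E * ((1 - q) * G * (1 - q)))) := by
        simp only [mul_assoc]
    _ = T (E * ((1 - q) * G * ((1 - q) * (1 - q)))) := by rw [hT.comm]; simp only [mul_assoc]
    _ = _ := by rw [hq.compl.mm]

theorem tstep_mul_l (hT : IsTr T) {q : A} (E G : A) :
    T (tstep q E 0 * G) = T (E * ((1 - q) * G * (1 - q))) := by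
  rw [tstep, zero_smul, add_zero]
  calc T ((1 - q) * E * (1 - q) * G) = T ((1 - q) * (E * (1 - q) * G)) := by simp only [mul_assoc]
    _ = _ := by rw [hT.comm]; simp only [mul_assoc]

theorem alpha_tstep (β : A ≃⋆ₐ[ℂ] A) (q E : A) (s : ℝ) : β (tstep q E s) = tstep (β q) (β E) s := by
  have hs : ∀ x : A, β (s • x) = s • β x := by
    intro x
    have h1 : s • x = (s : ℂ) • x := (RCLike.real_smul_eq_coe_smul (K := ℂ) s x)
    have h2 : s • β x = (s : ℂ) • β x := (RCLike.real_smul_eq_coe_smul (K := ℂ) s (β x))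
    rw [h1, h2, map_smul]
  simp only [tstep, map_add, map_mul, map_sub, map_one, hs]

theorem Ctx.n2_pow (c : Ctx α T) (k : ℕ) (x : A) : n2 T ((α ^ k) x) = n2 T x := by
  have : n2 T ((α ^ k) x) ^ 2 = n2 T x ^ 2 := by
    rw [c.tr.n2_sq, c.tr.n2_sq, ← map_star, ← map_mul, c.inv_pow]
  exact (sq_eq_sq₀ (n2_nonneg _) (n2_nonneg _)).1 this

theorem alpha_unit (β : A ≃⋆ₐ[ℂ] A) {E : A} (h0 : 0 ≤ E) (h1 : E ≤ 1) : 0 ≤ β E ∧ β E ≤ 1 := by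
  have key : ∀ x : A, 0 ≤ x → 0 ≤ β x := by
    intro x hx
    obtain ⟨b, rfl⟩ := CStarAlgebra.nonneg_iff_eq_star_mul_self.1 hx
    rw [map_mul, map_star]; exact star_mul_self_nonneg _
  refine ⟨key E h0, ?_⟩
  have := key (1 - E) (sub_nonneg.2 h1)
  rw [map_sub, map_one] at this
  exact sub_nonneg.1 this
end tower

set_option linter.unusedSectionVars false

section towerb
variable {A : Type*} [CStarAlgebra A] [PartialOrder A] [StarOrderedRing A]
variable {α : A ≃⋆ₐ[ℂ] A} {T : A →ₗ[ℝ] ℝ}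

noncomputable def DD (α : A ≃⋆ₐ[ℂ] A) (T : A →ₗ[ℝ] ℝ) (n : ℕ) (E : A) : ℝ :=
  T (E * (1 - E)) + ∑ j ∈ Finset.Icc 1 n, T (E * (α ^ j) E)

theorem n2_le_norm (hT : IsTr T) (x : A) : n2 T x ≤ ‖x‖ := by
  have h := hT.n2_mul_le x 1
  have : n2 T (1 : A) = 1 := by simp [n2, hT.one]
  rwa [mul_one, this, mul_one] at h

theorem one_sub_tstep (q E : A) {s : ℝ} (hs : s = 0 ∨ s = 1) (hq : IsProjection q) :
    1 - tstep q E s = tstep q (1 - E) (1 - s) := by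
  have e : (1 - q) * (1 - E) * (1 - q) = (1 - q) * (1 - q) - (1 - q) * E * (1 - q) := by noncomm_ring
  rw [tstep, tstep, e, hq.compl.mm, sub_smul, one_smul]; abel

theorem Ctx.tower_step (c : Ctx α T) (n M : ℕ) (hnM : n ≤ M) {E g : A} (hE0 : 0 ≤ E) (hE1 : E ≤ 1)
    (hg : IsProjection g) (s : ℕ → ℝ) (hs : ∀ l, s l = 0 ∨ s l = 1) (hs1 : ∀ l, l < n → s l = 0)
    (hs2 : ∀ l, M ≤ l + n → s l = 0) (hs3 : ∀ l j, 1 ≤ j → j ≤ n → s l * s (l + j) = 0)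
    {θ : ℝ} (hθ0 : 0 ≤ θ)
    (hθ : ∀ m l, m ≠ l → m ≤ M + n → l ≤ M + n → n2 T ((α ^ m) g * (α ^ l) g) ≤ θ)
    (hκ : ∀ j ≤ n, ∀ l ≤ M + n, ‖(α ^ j) E * (α ^ l) g - (α ^ l) g * (α ^ j) E‖ ≤ θ) :
    ∃ E', 0 ≤ E' ∧ E' ≤ 1 ∧
      (∀ a κ, (∀ l < M, ‖(α ^ l) g * a - a * (α ^ l) g‖ ≤ κ) →
        ‖E' * a - a * E'‖ ≤ ‖E * a - a * E‖ + M * (3 * κ)) ∧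
      T E + (∑ l ∈ Finset.range M, s l) * T g - ∑ l ∈ Finset.range M, T (E * (α ^ l) g)
        - M * (M * (5 * θ * n2 T g)) ≤ T E' ∧
      DD α T n E' ≤ DD α T n E + (n + 1) * ((M + n) * (2 * (θ + M * (6 * θ)) * n2 T g)) := by
  set q : ℕ → A := fun l => (α ^ l) g with hqd
  set h := n2 T g with hh
  have hh0 : 0 ≤ h := n2_nonneg g
  have hq : ∀ l, IsProjection (q l) := fun l => alpha_proj hg _
  have hqh : ∀ l, n2 T (q l) = h := fun l => c.n2_pow l g
  have hqT : ∀ l, T (q l) = T g := fun l => c.inv_pow l g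
  have hqs : ∀ j l, (α ^ j) (q l) = q (l + j) := by
    intro j l
    rw [hqd]; simp only
    rw [add_comm, pow_add]; rfl
  have hs01 : ∀ l, 0 ≤ s l ∧ s l ≤ 1 := fun l => by rcases hs l with h | h <;> simp [h]
  set e := tseq q s E with he
  have heu : ∀ l, 0 ≤ e l ∧ e l ≤ 1 := tseq_unit hq hE0 hE1 hs01
  have hcomm : ∀ m l, m ≤ M + n → l ≤ M + n → n2 T (q m * q l - q l * q m) ≤ 2 * θ := by
    intro m l hm hl
    by_cases hml : m = l
    · subst hml; simp [n2, hθ0]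
    · have h1 := c.tr.n2_add (q m * q l) (-(q l * q m))
      rw [IsTr.n2_neg, ← sub_eq_add_neg] at h1
      have h2 := hθ m l hml hm hl
      have h3 := hθ l m (Ne.symm hml) hl hm
      linarith
  have hec : ∀ l ≤ M, ∀ m ≤ M + n, n2 T (e l * q m - q m * e l) ≤ θ + M * (6 * θ) := by
    intro l hl m hm
    have h1 := tseq_comm (n2 T) c.tr.n2_add (n2_l c.tr) (n2_r c.tr) hq hE0 hE1 hs01 (q m) (κ := 2 * θ) l
      (fun i hi => hcomm i m (by omega) hm)
    have h2 : n2 T (E * q m - q m * E) ≤ θ := by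
      refine (n2_le_norm c.tr _).trans ?_
      exact hκ 0 (by omega) m hm
    have h3 : (l : ℝ) * (6 * θ) ≤ M * (6 * θ) := by gcongr
    linarith
  set K := θ + M * (6 * θ) with hK
  have hK0 : 0 ≤ K := by positivity
  refine ⟨e M, (heu M).1, (heu M).2, ?_, ?_, ?_⟩
  · intro a κ hκ
    exact tseq_comm (fun x => ‖x‖) norm_add_le (fun d x hd => norm_mul_le_l hd)
      (fun d x hd => norm_mul_le_r hd) hq hE0 hE1 hs01 a M hκ
  · have hkl : ∀ k l, k ≤ l → l < M → T (e k * q l) ≤ T (E * q l) + k * (5 * θ * h) := by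
      intro k l hkl hl
      induction k with
      | zero => simp [he, tseq]
      | succ k ih =>
        have ih := ih (by omega)
        have e1 : T (e (k + 1) * q l) = T (e k * ((1 - q k) * q l * (1 - q k))) + s k * T (q k * q l) := by
          have : e (k + 1) = tstep (q k) (e k) 0 + s k • q k := by
            simp [he, tseq, tstep]
          rw [this, add_mul, map_add, tstep_mul_l c.tr, smul_mul_assoc, map_smul, smul_eq_mul]
        have e2 := tr_core c.tr (hq k) (heu k).1 (heu k).2 (hq l).nonneg'
        have e3 := hcomm l k (by omega) (by omega)
        have e4 : T (q k * q l) ≤ θ * h := by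
          have a1 : T (q k * q l) = n2 T (q k * q l) * n2 T (q k * q l) := by
            rw [← sq, c.tr.n2_sq, star_mul, (hq k).st, (hq l).st, mul_assoc, ← mul_assoc (q k),
              (hq k).mm, c.tr.comm (q l), mul_assoc, (hq l).mm]
          rw [a1]
          have a2 : n2 T (q k * q l) ≤ h := (n2_l c.tr _ _ (hq k).norm_le).trans (hqh l).le
          exact mul_le_mul (hθ k l (by omega) (by omega) (by omega)) a2 (n2_nonneg _) hθ0
        have e5 : s k * T (q k * q l) ≤ θ * h :=
          (mul_le_of_le_one_left (c.tr.mul_nn (hq k).nonneg' (hq l).nonneg') (hs01 k).2).trans e4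
        rw [hqh k] at e2
        have e6 := mul_le_mul_of_nonneg_right e3 hh0
        push_cast
        linarith
    have hind : ∀ k ≤ M, T E + (∑ l ∈ Finset.range k, s l) * T g - ∑ l ∈ Finset.range k, T (E * q l)
        - k * (M * (5 * θ * h)) ≤ T (e k) := by
      intro k hk
      induction k with
      | zero => simp [he, tseq]
      | succ k ih =>
        have ih := ih (by omega)
        have e1 : T (e (k + 1)) = T (e k) - T (e k * q k) + s k * T g := by
          rw [← hqT k]; exact T_tstep c.tr (hq k) _ _
        have e2 := hkl k k le_rfl (by omega)
        have e3 : (k : ℝ) * (5 * θ * h) ≤ M * (5 * θ * h) := by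
          have : (k : ℝ) ≤ M := by exact_mod_cast (by omega : k ≤ M)
          gcongr
        rw [Finset.sum_range_succ, Finset.sum_range_succ, e1]
        push_cast
        linarith
    exact hind M le_rfl
  · have h1 : T (e M * (1 - e M)) ≤ T (E * (1 - E)) + (M + n) * (2 * K * h) := by
      have hind : ∀ k ≤ M, T (e k * (1 - e k)) ≤ T (E * (1 - E)) + k * (2 * K * h) := by
        intro k hk
        induction k with
        | zero => simp [he, tseq]
        | succ k ih =>
          have ih := ih (by omega)
          have e1 : e (k + 1) = tstep (q k) (e k) (s k) := rfl
          have hst : s k * (1 - s k) = 0 := by rcases hs k with h | h <;> simp [h]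
          have e2 := tr_core c.tr (hq k) (heu k).1 (heu k).2 (sub_nonneg.2 (heu k).2)
          rw [e1, one_sub_tstep _ _ (hs k) (hq k), tstep_mul c.tr (hq k) _ _ hst]
          have e3 : n2 T ((1 - e k) * q k - q k * (1 - e k)) ≤ K := by
            have : (1 - e k) * q k - q k * (1 - e k) = -(e k * q k - q k * e k) := by noncomm_ring
            rw [this, IsTr.n2_neg]; exact hec k (by omega) k (by omega)
          rw [hqh k] at e2
          have e4 := mul_le_mul_of_nonneg_right e3 hh0
          push_cast
          linarith
      have := hind M le_rfl
      have h2 : 0 ≤ (n : ℝ) * (2 * K * h) := by positivity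
      linarith
    have h2 : ∀ j ∈ Finset.Icc 1 n, T (e M * (α ^ j) (e M)) ≤ T (E * (α ^ j) E) + (M + n) * (2 * K * h) := by
      intro j hj
      rw [Finset.mem_Icc] at hj
      have hb : ∀ l ≤ M + n, n2 T ((α ^ j) (e (l - j)) * q l - q l * (α ^ j) (e (l - j))) ≤ K ∨ M < l - j := by
        intro l hl
        by_cases hlM : M < l - j
        · exact Or.inr hlM
        left
        by_cases hlj : l < j
        · have : l - j = 0 := by omega
          rw [this]
          refine (n2_le_norm c.tr _).trans ((hκ j hj.2 l hl).trans ?_)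
          have : 0 ≤ (M : ℝ) * (6 * θ) := by positivity
          linarith
        · have e1 : q l = (α ^ j) (q (l - j)) := by rw [hqs]; congr 1; omega
          rw [e1, ← map_mul, ← map_mul, ← map_sub, c.n2_pow]
          exact hec _ (by omega) _ (by omega)
      have hind : ∀ l ≤ M + j, T (e (min l M) * (α ^ j) (e (l - j))) ≤
          T (E * (α ^ j) E) + l * (2 * K * h) := by
        intro l hl
        induction l with
        | zero => simp [he, tseq]
        | succ l ih =>
          have ih := ih (by omega)
          have hb' := (hb l (by omega)).resolve_right (by omega)
          have hbu := alpha_unit (α ^ j) (heu (l - j)).1 (heu (l - j)).2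
          have core := tr_core c.tr (hq l) (heu (min l M)).1 (heu (min l M)).2 hbu.1
          rw [hqh l] at core
          have e4 := mul_le_mul_of_nonneg_right hb' hh0
          have goal' : T (e (min (l + 1) M) * (α ^ j) (e (l + 1 - j))) =
              T (e (min l M) * ((1 - q l) * (α ^ j) (e (l - j)) * (1 - q l))) := by
            by_cases hlj : l < j
            · have a1 : l + 1 - j = l - j := by omega
              have a2 : min (l + 1) M = l + 1 := by omega
              have a3 : min l M = l := by omega
              rw [a1, a2, a3]
              have a4 : e (l + 1) = tstep (q l) (e l) 0 := by
                rw [← hs1 l (by omega)]; rfl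
              rw [a4, tstep_mul_l c.tr]
            · have a1 : l + 1 - j = (l - j) + 1 := by omega
              have a5 : (α ^ j) (e (l - j + 1)) = tstep (q l) ((α ^ j) (e (l - j))) (s (l - j)) := by
                have : e (l - j + 1) = tstep (q (l - j)) (e (l - j)) (s (l - j)) := rfl
                rw [this, alpha_tstep, hqs]
                congr 2; omega
              rw [a1, a5]
              by_cases hlM : l < M
              · have a2 : min (l + 1) M = l + 1 := by omega
                have a3 : min l M = l := by omega
                rw [a2, a3]
                have a4 : e (l + 1) = tstep (q l) (e l) (s l) := rfl
                have hst : s l * s (l - j) = 0 := by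
                  have := hs3 (l - j) j hj.1 hj.2
                  rw [mul_comm]
                  have a : l - j + j = l := by omega
                  rwa [a] at this
                rw [a4, tstep_mul c.tr (hq l) _ _ hst]
              · have a2 : min (l + 1) M = M := by omega
                have a3 : min l M = M := by omega
                rw [a2, a3, hs2 (l - j) (by omega), c.tr.comm, tstep_mul_l c.tr, c.tr.comm]
                calc T ((1 - q l) * e M * (1 - q l) * (α ^ j) (e (l - j)))
                    = T ((1 - q l) * (e M * ((1 - q l) * (α ^ j) (e (l - j))))) := by
                      simp only [mul_assoc]
                  _ = _ := by rw [c.tr.comm]; simp only [mul_assoc]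
          rw [goal']
          push_cast
          linarith
      have := hind (M + j) le_rfl
      have a1 : min (M + j) M = M := by omega
      have a2 : M + j - j = M := by omega
      rw [a1, a2] at this
      push_cast at this
      have a3 : (j : ℝ) ≤ n := by exact_mod_cast hj.2
      have a4 : (j : ℝ) * (2 * K * h) ≤ n * (2 * K * h) := by gcongr
      linarith
    have h3 := Finset.sum_le_sum h2
    rw [Finset.sum_add_distrib, Finset.sum_const, Nat.card_Icc, nsmul_eq_mul] at h3
    simp only [add_tsub_cancel_right] at h3
    simp only [DD]
    linarith
end towerb

set_option linter.unusedSectionVars false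

section tower8
variable {A : Type*} [CStarAlgebra A] [PartialOrder A] [StarOrderedRing A]
variable {α : A ≃⋆ₐ[ℂ] A} {T : A →ₗ[ℝ] ℝ}

theorem n2_sq_proj (hT : IsTr T) {p q : A} (hp : IsProjection p) (hq : IsProjection q) :
    n2 T (p * q) ^ 2 = T (p * q) := by
  rw [hT.n2_sq, star_mul, hp.st, hq.st, mul_assoc, ← mul_assoc p, hp.mm, hT.comm q, mul_assoc, hq.mm]

theorem comm_alpha (β : A ≃⋆ₐ[ℂ] A) (g a : A) :
    ‖β g * a - a * β g‖ = ‖g * β.symm a - β.symm a * g‖ := by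
  rw [← norm_alpha β (g * β.symm a - β.symm a * g)]
  simp

set_option maxHeartbeats 1000000 in
theorem Ctx.gain (c : Ctx α T) (n : ℕ) {ρ lam : ℝ} (hρ : 0 < ρ) (hl : 0 < lam) :
    ∃ d > 0, ∀ E : A, 0 ≤ E → E ≤ 1 → T E ≤ 1 / (n + 1) - ρ → ∀ (F : Finset A) (ε : ℝ), 0 < ε →
      ∃ E', 0 ≤ E' ∧ E' ≤ 1 ∧ (∀ a ∈ F, ‖E' * a - a * E'‖ ≤ ‖E * a - a * E‖ + ε) ∧
        T E - DD α T n E / lam + d ≤ T E' - DD α T n E' / lam := by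
  classical
  obtain ⟨m, hm⟩ := exists_nat_ge (4 / ρ)
  have hmρ : 4 ≤ m * ρ := by rwa [div_le_iff₀ hρ] at hm
  set M : ℕ := m * (n + 1) + n with hM
  have hm0 : 0 < m := by
    rcases Nat.eq_zero_or_pos m with h | h
    · subst h; norm_num at hmρ
    · exact h
  have hmM : m ≤ M := by rw [hM]; nlinarith
  have hMpos : 0 < M := lt_of_lt_of_le hm0 hmM
  have hMr : (0:ℝ) < M := by exact_mod_cast hMpos
  set s : ℕ → ℝ := fun l => if (n + 1) ∣ (l + 1) ∧ l < m * (n + 1) then 1 else 0 with hsd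
  have hs : ∀ l, s l = 0 ∨ s l = 1 := by
    intro l; simp only [hsd]; split_ifs <;> simp
  have hs1 : ∀ l, l < n → s l = 0 := by
    intro l hln; simp only [hsd]; rw [if_neg]
    rintro ⟨h, -⟩
    have := Nat.le_of_dvd (by omega) h
    omega
  have hs2 : ∀ l, M ≤ l + n → s l = 0 := by
    intro l hln; simp only [hsd]; rw [if_neg]
    rintro ⟨-, h⟩
    omega
  have hs3 : ∀ l j, 1 ≤ j → j ≤ n → s l * s (l + j) = 0 := by
    intro l j h1 h2
    simp only [hsd]
    by_cases h3 : (n + 1) ∣ (l + 1)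
    · have : ¬ (n + 1) ∣ (l + j + 1) := by
        intro h4
        have h5 := (Nat.dvd_sub h4 h3)
        have h6 : l + j + 1 - (l + 1) = j := by omega
        rw [h6] at h5
        have := Nat.le_of_dvd (by omega) h5
        omega
      rw [if_neg (fun h : (n + 1) ∣ (l + j + 1) ∧ l + j < m * (n + 1) => this h.1), mul_zero]
    · rw [if_neg (fun h => h3 h.1), zero_mul]
  have hsum : ∑ l ∈ Finset.range M, s l = m := by
    have h1 : ∑ l ∈ Finset.range M, s l = ∑ l ∈ Finset.range (m * (n + 1)), s l := by
      symm
      apply Finset.sum_subset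
      · intro x hx; simp only [Finset.mem_range] at *; omega
      · intro x _ hx; simp only [Finset.mem_range, not_lt] at hx
        exact hs2 x (by omega)
    have h2 : ∑ l ∈ Finset.range (m * (n + 1)), s l =
        ∑ l ∈ Finset.range (m * (n + 1)), if (n + 1) ∣ (l + 1) then (1:ℝ) else 0 := by
      apply Finset.sum_congr rfl
      intro x hx; simp only [Finset.mem_range] at hx
      simp only [hsd, hx, and_true]
    rw [h1, h2, Finset.sum_boole, Nat.card_multiples, Nat.mul_div_cancel _ (by omega)]
  set C : ℝ := 1 + 10 * M * M + 4 * (n + 1) * (M + n) * (1 + 6 * M) / lam with hC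
  have hX0 : 0 ≤ 4 * ((n:ℝ) + 1) * (M + n) * (1 + 6 * M) / lam := by positivity
  have hC0 : 0 < C := by positivity
  set r : ℝ := 1 / C with hr
  have hr0 : 0 < r := by positivity
  have hrC : r * C = 1 := by rw [hr]; field_simp
  have hr1 : M * (M * (5 * r)) ≤ 1 / 2 := by
    have : 10 * (M:ℝ) * M ≤ C := by linarith
    have := mul_le_mul_of_nonneg_left this hr0.le
    nlinarith
  have hr2 : (n + 1) * ((M + n) * (2 * (1 + M * 6) * r)) / lam ≤ 1 / 2 := by
    have : 4 * ((n:ℝ) + 1) * (M + n) * (1 + 6 * M) / lam ≤ C := by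
      have : 0 ≤ 10 * (M:ℝ) * M := by positivity
      linarith
    have := mul_le_mul_of_nonneg_left this hr0.le
    have e : ((n:ℝ) + 1) * ((M + n) * (2 * (1 + M * 6) * r)) / lam =
      (r * (4 * ((n:ℝ) + 1) * (M + n) * (1 + 6 * M) / lam)) / 2 := by ring
    rw [e]; linarith
  obtain ⟨d, hd, hg⟩ := c.exists_g (M + n) (σ := r ^ 2) (by positivity)
  refine ⟨d, hd, ?_⟩
  intro E hE0 hE1 hTE F ε hε
  obtain ⟨F', ε', hε', hind⟩ := c.indep ((Finset.range (M + n + 1)).image fun l => (α ^ l).symm E)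
    (ε := 1 / (2 * M)) (by positivity)
  set G : Finset A := F' ∪ ((Finset.range (M + n + 1) ×ˢ F).image fun x => (α ^ x.1).symm x.2) ∪
    ((Finset.range (M + n + 1) ×ˢ Finset.range (n + 1)).image fun x => (α ^ x.1).symm ((α ^ x.2) E)) with hG
  set ε2 := min ε' (min (ε / (3 * M)) (r * √d)) with hε2
  have hε20 : 0 < ε2 := by
    have : 0 < √d := Real.sqrt_pos.2 hd
    simp only [hε2, lt_min_iff]; refine ⟨hε', by positivity, by positivity⟩
  obtain ⟨g, hgp, hgc, hgd, hgM⟩ := hg G ε2 hε20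
  have hTg : 0 < T g := lt_of_lt_of_le hd hgd
  set θ := r * √(T g) with hθd
  have hθ0 : 0 ≤ θ := by positivity
  have hng : n2 T g = √(T g) := by rw [n2, hgp.st, hgp.mm]
  have hθn : θ * n2 T g = r * T g := by
    rw [hng, hθd, mul_assoc, Real.mul_self_sqrt hTg.le]
  have hlt : ∀ m l, m < l → l ≤ M + n → T ((α ^ m) g * (α ^ l) g) ≤ r ^ 2 * T g := by
    intro m l hml hl
    have e : (α ^ l) g = (α ^ m) ((α ^ (l - m)) g) := by
      have : α ^ l = α ^ m * α ^ (l - m) := by rw [← pow_add]; congr 1; omega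
      rw [this]; rfl
    rw [e, ← map_mul, c.inv_pow]
    exact hgM _ (by omega) (by omega)
  have hθ : ∀ m l, m ≠ l → m ≤ M + n → l ≤ M + n → n2 T ((α ^ m) g * (α ^ l) g) ≤ θ := by
    intro m l hml hm hl
    have h1 : T ((α ^ m) g * (α ^ l) g) ≤ r ^ 2 * T g := by
      rcases lt_or_gt_of_ne hml with h | h
      · exact hlt m l h hl
      · rw [c.tr.comm]; exact hlt l m h hm
    rw [← n2_sq_proj c.tr (alpha_proj hgp _) (alpha_proj hgp _)] at h1
    have h2 : r ^ 2 * T g = θ ^ 2 := by rw [hθd, mul_pow, Real.sq_sqrt hTg.le]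
    rw [h2] at h1
    exact (sq_le_sq₀ (n2_nonneg _) hθ0).1 h1
  have hκ : ∀ j ≤ n, ∀ l ≤ M + n, ‖(α ^ j) E * (α ^ l) g - (α ^ l) g * (α ^ j) E‖ ≤ θ := by
    intro j hj l hl
    rw [norm_sub_rev, comm_alpha]
    have : (α ^ l).symm ((α ^ j) E) ∈ G := by
      rw [hG]; apply Finset.mem_union_right
      exact Finset.mem_image.2 ⟨(l, j), by simp only [Finset.mem_product, Finset.mem_range]; omega, rfl⟩
    refine (hgc _ this).le.trans (((min_le_right _ _).trans (min_le_right _ _)).trans ?_)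
    rw [hθd]; gcongr
  have hindg := hind g hgp (fun a ha => (hgc a (by
    rw [hG]; exact Finset.mem_union_left _ (Finset.mem_union_left _ ha))).trans_le (min_le_left _ _))
  obtain ⟨E', h0, h1, hcm, hT', hD'⟩ := c.tower_step n M (by omega) hE0 hE1 hgp s hs hs1 hs2 hs3 hθ0 hθ hκ
  refine ⟨E', h0, h1, ?_, ?_⟩
  · intro a ha
    have := hcm a (ε / (3 * M)) (by
      intro l hl
      rw [comm_alpha]
      refine (hgc _ ?_).le.trans ((min_le_right _ _).trans (min_le_left _ _))
      rw [hG]; apply Finset.mem_union_left; apply Finset.mem_union_right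
      exact Finset.mem_image.2 ⟨(l, a), by simp only [Finset.mem_product, Finset.mem_range]; exact ⟨by omega, ha⟩, rfl⟩)
    have e : (M:ℝ) * (3 * (ε / (3 * M))) = ε := by field_simp
    rwa [e] at this
  · have hEq : ∀ l ∈ Finset.range M, T (E * (α ^ l) g) ≤ T g * T E + 1 / (2 * M) * T g := by
      intro l hl
      rw [Finset.mem_range] at hl
      have e1 : T (E * (α ^ l) g) = T (g * (α ^ l).symm E) := by
        rw [c.tr.comm, ← c.inv_pow l (g * _)]; simp only [map_mul, StarAlgEquiv.apply_symm_apply]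
      have e2 : T ((α ^ l).symm E) = T E := by
        rw [← c.inv_pow l, StarAlgEquiv.apply_symm_apply]
      have e3 := hindg _ (Finset.mem_image.2 ⟨l, by simp only [Finset.mem_range]; omega, rfl⟩ : (α ^ l).symm E ∈ _)
      rw [e2, abs_le] at e3
      rw [e1]; linarith [e3.2]
    have hsumE := Finset.sum_le_sum hEq
    rw [Finset.sum_const, Finset.card_range, nsmul_eq_mul] at hsumE
    have e5 : (M:ℝ) * (T g * T E + 1 / (2 * M) * T g) = T g * (M * T E) + T g / 2 := by field_simp
    rw [e5] at hsumE
    have hMT : M * T E ≤ m + 1 - 4 := by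
      have a1 : (M:ℝ) = m * (n + 1) + n := by rw [hM]; push_cast; ring
      have a2 : (M:ℝ) * T E ≤ M * (1 / (n + 1) - ρ) := by gcongr
      have a3 : (M:ℝ) * (1 / (n + 1)) ≤ m + 1 := by
        rw [mul_one_div, div_le_iff₀ (by positivity), a1]; nlinarith
      have a4 : (m:ℝ) * ρ ≤ M * ρ := by
        have : (m:ℝ) ≤ M := by exact_mod_cast hmM
        gcongr
      rw [mul_sub] at a2
      linarith
    rw [hsum] at hT'
    have e6 : (M:ℝ) * (M * (5 * θ * n2 T g)) = (M * (M * (5 * r))) * T g := by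
      rw [mul_assoc 5, hθn]; ring
    have e7 : ((n:ℝ) + 1) * ((M + n) * (2 * (θ + M * (6 * θ)) * n2 T g)) / lam =
        ((n + 1) * ((M + n) * (2 * (1 + M * 6) * r)) / lam) * T g := by
      have : 2 * (θ + M * (6 * θ)) * n2 T g = 2 * (1 + M * 6) * (θ * n2 T g) := by ring
      rw [this, hθn]; ring
    rw [e6] at hT'
    have hD2 := div_le_div_of_nonneg_right hD' hl.le
    rw [add_div, e7] at hD2
    have f1 := mul_le_mul_of_nonneg_right hr1 hTg.le
    have f2 := mul_le_mul_of_nonneg_right hr2 hTg.le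
    have f3 := mul_le_mul_of_nonneg_left hMT hTg.le
    linarith

theorem DD_nonneg (c : Ctx α T) (n : ℕ) {E : A} (h0 : 0 ≤ E) (h1 : E ≤ 1) : 0 ≤ DD α T n E := by
  unfold DD
  refine add_nonneg (c.tr.mul_nn h0 (sub_nonneg.2 h1)) (Finset.sum_nonneg fun j _ => ?_)
  exact c.tr.mul_nn h0 (alpha_unit _ h0 h1).1

theorem Ctx.tower (c : Ctx α T) (n : ℕ) {ρ lam : ℝ} (hρ : 0 < ρ) (hl : 0 < lam) (F : Finset A) {ε : ℝ}
    (hε : 0 < ε) : ∃ E, 0 ≤ E ∧ E ≤ 1 ∧ Cen F ε E ∧ 1 / (n + 1) - ρ ≤ T E ∧ DD α T n E ≤ lam := by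
  obtain ⟨d, hd, hg⟩ := c.gain n hρ hl
  by_contra hcon
  push Not at hcon
  have key : ∀ k : ℕ, ∃ E, 0 ≤ E ∧ E ≤ 1 ∧ (∀ a ∈ F, ‖E * a - a * E‖ ≤ ε * (1 - (1/2) ^ k)) ∧
      k * d ≤ T E - DD α T n E / lam := by
    intro k
    induction k with
    | zero => exact ⟨0, le_rfl, zero_le_one, by simp, by simp [DD]⟩
    | succ k ih =>
      obtain ⟨E, h0, h1, h2, h3⟩ := ih
      have hT1 : T E ≤ 1 := c.tr.le_one h1
      have hD : DD α T n E ≤ lam := by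
        have : 0 ≤ k * d := by positivity
        have : DD α T n E / lam ≤ 1 := by linarith
        rwa [div_le_one hl] at this
      have hpow : (0:ℝ) < (1/2) ^ k := by positivity
      have hTE : T E ≤ 1 / (n + 1) - ρ := by
        by_contra hc
        push Not at hc
        have := hcon E h0 h1 (fun a ha => (h2 a ha).trans_lt (by nlinarith)) hc.le
        linarith
      obtain ⟨E', a0, a1, a2, a3⟩ := hg E h0 h1 hTE F (ε * ((1/2) ^ (k + 1))) (by positivity)
      refine ⟨E', a0, a1, ?_, ?_⟩
      · intro a ha
        have := h2 a ha
        have := a2 a ha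
        rw [pow_succ] at *
        linarith
      · push_cast; linarith
  obtain ⟨k, hk⟩ := exists_nat_gt (1 / d)
  obtain ⟨E, h0, h1, -, h3⟩ := key k
  have hT1 : T E ≤ 1 := c.tr.le_one h1
  have hD := div_nonneg (DD_nonneg c n h0 h1) hl.le
  rw [div_lt_iff₀ hd] at hk
  linarith
end tower8

set_option linter.unusedSectionVars false

section cut9
variable {A : Type*} [CStarAlgebra A] [PartialOrder A] [StarOrderedRing A]
variable {α : A ≃⋆ₐ[ℂ] A} {T : A →ₗ[ℝ] ℝ}

theorem orthogonalize (m : ℕ) : ∀ ε : ℝ, 0 < ε → ∃ ω > 0, ∀ p : ℕ → A, (∀ i, IsProjection (p i)) →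
    (∀ i j, i < m → j < m → i ≠ j → ‖p i * p j‖ ≤ ω) →
    ∃ e : ℕ → A, (∀ i < m, IsProjection (e i)) ∧ (∀ i j, i < m → j < m → i ≠ j → e i * e j = 0) ∧
      ∀ i < m, ‖e i - p i‖ ≤ ε := by
  induction m with
  | zero => exact fun ε _ => ⟨1, one_pos, fun p _ _ => ⟨p, by simp, by simp, by simp⟩⟩
  | succ m ih =>
    intro ε hε
    set κ := min ε 1 with hκ
    have hκ0 : 0 < κ := lt_min hε one_pos
    have hκ1 : κ ≤ 1 := min_le_right _ _
    have hm : (0:ℝ) < m + 1 := by positivity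
    obtain ⟨ω, hω, h⟩ := ih (κ / (8 * (m + 1))) (by positivity)
    refine ⟨min ω (κ / (8 * (m + 1))), lt_min hω (by positivity), ?_⟩
    intro p hp hpo
    obtain ⟨e, he1, he2, he3⟩ := h p hp (fun i j hi hj hij => (hpo i j (by omega) (by omega) hij).trans (min_le_left _ _))
    set S := ∑ i ∈ Finset.range m, e i with hS
    have hSp : IsProjection S := IsProjection.sum' _ _ (fun i hi => he1 i (Finset.mem_range.1 hi))
      (fun i hi j hj => he2 i j (Finset.mem_range.1 hi) (Finset.mem_range.1 hj))
    have hn : ‖p m - (1 - S) * p m‖ ≤ κ / 4 := by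
      have e1 : p m - (1 - S) * p m = ∑ i ∈ Finset.range m, e i * p m := by
        rw [← Finset.sum_mul, ← hS]; noncomm_ring
      rw [e1]
      refine (norm_sum_le _ _).trans ?_
      have e2 : ∀ i ∈ Finset.range m, ‖e i * p m‖ ≤ κ / (4 * (m + 1)) := by
        intro i hi
        rw [Finset.mem_range] at hi
        have a : e i * p m = (e i - p i) * p m + p i * p m := by noncomm_ring
        rw [a]
        refine (norm_add_le _ _).trans ?_
        have a1 := (norm_mul_le_r (a := e i - p i) (hp m).norm_le).trans (he3 i hi)
        have a2 := (hpo i m (by omega) (by omega) (by omega)).trans (min_le_right _ _)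
        have a3 : κ / (4 * ((m:ℝ) + 1)) = κ / (8 * (m + 1)) + κ / (8 * (m + 1)) := by field_simp; norm_num
        linarith
      refine (Finset.sum_le_sum e2).trans ?_
      rw [Finset.sum_const, Finset.card_range, nsmul_eq_mul, mul_div_assoc', div_le_div_iff₀ (by positivity) (by norm_num)]
      nlinarith
    obtain ⟨w, hw1, hw2, -, hw4⟩ := pert (hp m) hSp.compl (by linarith) hn
    have hy := (partial_iso_proj (hp m) hw1).2
    have hSy : S * (w * star w) = 0 := by
      have : S * w = 0 := by
        have := hw2; rw [sub_mul, one_mul] at this; exact sub_eq_self.1 this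
      rw [← mul_assoc, this, zero_mul]
    have hey : ∀ i < m, e i * (w * star w) = 0 := by
      intro i hi
      have := (sub_of_sum (Finset.range m) e S (fun i hi => he1 i (Finset.mem_range.1 hi)) hSp rfl i (Finset.mem_range.2 hi)).2
      rw [← this, mul_assoc, hSy, mul_zero]
    have hye : ∀ i < m, (w * star w) * e i = 0 := by
      intro i hi
      have := congrArg star (hey i hi)
      rwa [star_mul, hy.st, (he1 i hi).st, star_zero] at this
    refine ⟨fun i => if i = m then w * star w else e i, ?_, ?_, ?_⟩
    · intro i hi
      by_cases h : i = m
      · simp only [h, if_true]; exact hy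
      · simp only [h, if_false]; exact he1 i (by omega)
    · intro i j hi hj hij
      by_cases h : i = m
      · have : j ≠ m := by omega
        simp only [h, this, if_true, if_false]; exact hye j (by omega)
      · by_cases h' : j = m
        · simp only [h, h', if_true, if_false]; exact hey i (by omega)
        · simp only [h, h', if_false]; exact he2 i j (by omega) (by omega) hij
    · intro i hi
      by_cases h : i = m
      · simp only [h, if_true]
        have : κ ≤ ε := min_le_left _ _
        linarith
      · simp only [h, if_false]
        refine (he3 i (by omega)).trans (le_trans ?_ (min_le_left ε 1))
        rw [← hκ]
        apply div_le_self hκ0.le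
        have : (0:ℝ) ≤ m := by positivity
        linarith

set_option maxHeartbeats 1000000 in
theorem Ctx.cut (c : Ctx α T) {q H a : A} (hq : IsProjection q) (hH : 0 ≤ H) (ha0 : 0 ≤ a) (ha1 : a ≤ 1)
    {η ε : ℝ} (hη : 0 < η) (hε : 0 < ε) :
    ∃ y, IsProjection y ∧ q * y = y ∧ y * H * y ≤ (2 * η) • (1 : A) ∧
      T (a * (q - y)) ≤ T (a * (q * H * q)) / η + ε := by
  classical
  set K := ‖H‖ with hK
  have hK0 : 0 ≤ K := norm_nonneg _
  set δ := min (1 / 2) (min (η / (16 * (K + 1))) (ε / 8)) with hδ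
  have hδ0 : 0 < δ := by
    simp only [hδ, lt_min_iff]; exact ⟨by norm_num, by positivity, by positivity⟩
  have hδ1 : δ ≤ 1 / 2 := min_le_left _ _
  have hδ2 : 8 * δ * K ≤ η / 2 := by
    have : δ ≤ η / (16 * (K + 1)) := (min_le_right _ _).trans (min_le_left _ _)
    rw [le_div_iff₀ (by positivity)] at this
    nlinarith
  have hδ3 : 4 * δ ≤ ε / 2 := by
    have : δ ≤ ε / 8 := (min_le_right _ _).trans (min_le_right _ _)
    linarith
  set L := 2 * η / δ ^ 2 with hL
  have hL0 : 0 < L := by positivity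
  have hLδ : 2 * η = L * δ ^ 2 := by rw [hL]; field_simp
  set Z := 1 + (5 + K + L) / η with hZ
  have hZ0 : 0 < Z := by positivity
  set ε' := min (η / 4) (ε / (2 * Z)) with hε'
  have hε'0 : 0 < ε' := lt_min (by positivity) (by positivity)
  have hε'1 : ε' ≤ η / 4 := min_le_left _ _
  have hε'2 : ε' * Z ≤ ε / 2 := by
    have : ε' ≤ ε / (2 * Z) := min_le_right _ _
    rw [le_div_iff₀ (by positivity)] at this
    linarith
  set H1 := q * H * q with hH1
  have hH10 : 0 ≤ H1 := by have := conj_nonneg' hH q; rwa [hq.st] at this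
  have hH1n : ‖H1‖ ≤ K := norm_conj_le hq.norm_le hq.norm_le
  set H2 := H1 + L • (1 - q) with hH2
  have hLq : 0 ≤ L • (1 - q) := smul_nonneg hL0.le hq.compl.nonneg'
  have hH20 : 0 ≤ H2 := add_nonneg hH10 hLq
  have hH2n : ‖H2‖ ≤ K + L := by
    refine (norm_add_le _ _).trans (add_le_add hH1n ?_)
    rw [norm_smul, Real.norm_of_nonneg hL0.le]
    exact mul_le_of_le_one_right hL0.le hq.compl.norm_le
  obtain ⟨B, p, hfd, hp, hpB, hu, h1, h2, h3⟩ := c.tr0 {H2} hε'0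
  have h1 := h1 H2 (by simp)
  obtain ⟨b, hb, hbs, hbn⟩ := sa_approx (sa_of_nonneg hH20) hp (h2 H2 (by simp))
  obtain ⟨ψ, hψB, hψ, hψb, hψ1, hψ2, -⟩ := fd_thr B hp hu hb hbs hη
  set χ := p - ψ with hχd
  have hpψ := hu ψ hψB
  have hχ : IsProjection χ := hψ.sub' hp hpψ.1
  have hpχ : p * χ = χ := by rw [hχd, mul_sub, hp.mm, hpψ.1]
  have hχp : χ * p = χ := by rw [hχd, sub_mul, hp.mm, hpψ.2]
  have hχb : χ * b * χ = b - ψ * b := by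
    rw [hχd, sub_mul, mul_sub, sub_mul, (hu b hb).1, mul_assoc ψ b p, (hu b hb).2, hψb, sub_mul, mul_assoc b ψ ψ, hψ.mm]
    abel
  -- χ H2 χ small
  have hsub : star (p * H2 * p - b) = p * H2 * p - b := by
    rw [star_sub, hbs, star_mul, star_mul, hp.st, sa_of_nonneg hH20, mul_assoc]
  have hchi : χ * H2 * χ ≤ (η + ε') • (1 : A) := by
    have e1 : χ * H2 * χ = χ * b * χ + χ * (p * H2 * p - b) * χ := by
      have : χ * (p * H2 * p - b) * χ = (χ * p) * H2 * (p * χ) - χ * b * χ := by noncomm_ring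
      rw [this, hpχ, hχp]; abel
    have e2 : χ * (p * H2 * p - b) * χ ≤ ε' • (1 : A) := by
      refine sa_le_smul ?_ ((norm_conj_le hχ.norm_le hχ.norm_le).trans hbn.le)
      rw [star_mul, star_mul, hχ.st, hsub, ← mul_assoc]
    have e3 : χ * b * χ ≤ η • (1 : A) := by
      rw [hχb]
      exact hψ2.trans (smul_le_smul_of_nonneg_left hχ.le_one' hη.le)
    rw [e1, add_smul]
    exact add_le_add e3 e2
  have hnn : ∀ x, 0 ≤ x → 0 ≤ χ * x * χ := fun x hx => by
    have := conj_nonneg' hx χ; rwa [hχ.st] at this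
  have hsplit : χ * H2 * χ = χ * H1 * χ + L • (χ * (1 - q) * χ) := by
    rw [hH2, mul_add, add_mul, mul_smul_comm, smul_mul_assoc]
  have hchiH1 : χ * H1 * χ ≤ (η + ε') • (1 : A) := by
    refine le_trans ?_ hchi
    rw [hsplit]
    exact le_add_of_nonneg_right (smul_nonneg hL0.le (hnn _ hq.compl.nonneg'))
  have hchiq : ‖χ - q * χ‖ ≤ δ := by
    have e1 : L • (χ * (1 - q) * χ) ≤ (L * δ ^ 2) • (1 : A) := by
      have a1 : L • (χ * (1 - q) * χ) ≤ (η + ε') • (1 : A) := by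
        refine le_trans ?_ hchi
        rw [hsplit]
        exact le_add_of_nonneg_left (hnn _ hH10)
      refine a1.trans (smul_one_mono2 ?_)
      linarith
    have e2 : ‖L • (χ * (1 - q) * χ)‖ ≤ L * δ ^ 2 :=
      norm_le_of_le_smul (by positivity) (smul_nonneg hL0.le (hnn _ hq.compl.nonneg')) e1
    rw [norm_smul, Real.norm_of_nonneg hL0.le] at e2
    have e3 := le_of_mul_le_mul_left e2 hL0
    have e4 : χ * (1 - q) * χ = star (χ - q * χ) * (χ - q * χ) := by
      have : χ - q * χ = (1 - q) * χ := by noncomm_ring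
      rw [this, star_mul, hχ.st, hq.compl.st, ← mul_assoc, mul_assoc χ (1 - q) (1 - q), hq.compl.mm]
    rw [e4, CStarRing.norm_star_mul_self, ← sq] at e3
    exact (sq_le_sq₀ (norm_nonneg _) hδ0.le).1 e3
  obtain ⟨w, hw1, hw2, -, hw4⟩ := pert hχ hq hδ1 hchiq
  set y := w * star w with hyd
  have hy : IsProjection y := (partial_iso_proj hχ hw1).2
  have hqy : q * y = y := by rw [hyd, ← mul_assoc, hw2]
  have hyq : y * q = y := by have := congrArg star hqy; rwa [star_mul, hy.st, hq.st] at this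
  refine ⟨y, hy, hqy, ?_, ?_⟩
  · have e1 : y * H * y = χ * H1 * χ + (y * H1 * (y - χ) + (y - χ) * H1 * χ) := by
      have : y * H * y = y * H1 * y := by
        calc y * H * y = (y * q) * H * (q * y) := by rw [hyq, hqy]
          _ = _ := by rw [hH1]; noncomm_ring
      rw [this]; noncomm_ring
    have e2 : y * H1 * (y - χ) + (y - χ) * H1 * χ ≤ (8 * δ * K) • (1 : A) := by
      apply sa_le_smul
      · have : y * H1 * (y - χ) + (y - χ) * H1 * χ = y * H1 * y - χ * H1 * χ := by noncomm_ring
        rw [this]; simp only [star_sub, star_mul, hy.st, hχ.st, sa_of_nonneg hH10, mul_assoc]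
      · refine (norm_add_le _ _).trans ?_
        have a1 : ‖y * H1 * (y - χ)‖ ≤ K * (4 * δ) := by
          refine (norm_mul_le _ _).trans ?_
          have := (norm_mul_le_l (a := H1) hy.norm_le).trans hH1n
          gcongr
        have a2 : ‖(y - χ) * H1 * χ‖ ≤ (4 * δ) * K := by
          refine (norm_mul_le_r hχ.norm_le).trans ((norm_mul_le _ _).trans ?_)
          gcongr
        linarith
    rw [e1]
    refine (add_le_add hchiH1 e2).trans ?_
    rw [← add_smul]
    apply smul_one_mono2
    linarith
  · set a' := q * a * q with ha'
    have ha'0 : 0 ≤ a' := by have := conj_nonneg' ha0 q; rwa [hq.st] at this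
    have ha'n : ‖a'‖ ≤ 1 := (norm_conj_le hq.norm_le hq.norm_le).trans (norm_le_one_of ha0 ha1)
    have ha'1 : a' ≤ 1 := by simpa using sa_le_smul (sa_of_nonneg ha'0) ha'n
    have aq : ∀ x, T (a * (q * x * q)) = T (a' * x) := by
      intro x
      rw [ha', ← mul_assoc, c.tr.comm]
      simp only [mul_assoc]
    have e0 : T (a * (q - y)) = T (a' * (1 - y)) := by
      rw [← aq]; congr 2
      rw [mul_sub, sub_mul, mul_one, hq.mm, hqy, hyq]
    have e1 : a' * (1 - y) = a' * (1 - p) + a' * ψ + a' * (χ - y) := by rw [hχd]; noncomm_ring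
    have f1 : T (a' * (1 - p)) ≤ ε' := by
      have := c.tr.abs_mul_le a' hp.compl.nonneg'
      have h5 := (abs_le.1 this).2
      have h6 := mul_le_of_le_one_left (c.tr.nonneg hp.compl.nonneg') ha'n
      linarith
    have f3 : T (a' * (χ - y)) ≤ 4 * δ := by
      have := c.tr.abs_le (a' * (χ - y))
      have h5 := (abs_le.1 this).2
      have h6 : ‖a' * (χ - y)‖ ≤ ‖χ - y‖ := norm_mul_le_l ha'n
      rw [norm_sub_rev] at hw4
      linarith
    have f2 : η * T (a' * ψ) ≤ T (a' * (ψ * b)) := by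
      have := c.tr.mul_mono_l ha'0 hψ1
      rwa [mul_smul_comm, map_smul, smul_eq_mul] at this
    have hbpos : -(ε' • (1 : A)) ≤ χ * b * χ := by
      have a1 : χ * b * χ = χ * H2 * χ - χ * (p * H2 * p - b) * χ := by
        have : χ * (p * H2 * p - b) * χ = (χ * p) * H2 * (p * χ) - χ * b * χ := by noncomm_ring
        rw [this, hpχ, hχp]; abel
      have e2 : χ * (p * H2 * p - b) * χ ≤ ε' • (1 : A) := by
        refine sa_le_smul ?_ ((norm_conj_le hχ.norm_le hχ.norm_le).trans hbn.le)
        rw [star_mul, star_mul, hχ.st, hsub, ← mul_assoc]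
      rw [a1]
      have a2 := sub_le_sub (hnn _ hH20) e2
      rwa [zero_sub] at a2
    have hTa' : T a' ≤ 1 := c.tr.le_one ha'1
    have f4 : T (a' * (ψ * b)) ≤ T (a' * b) + ε' := by
      have a1 := c.tr.mul_mono_l ha'0 hbpos
      rw [hχb, mul_sub, map_sub, mul_neg, mul_smul_comm, map_neg, map_smul, mul_one, smul_eq_mul] at a1
      nlinarith
    have f5 : T (a' * b) ≤ T (a' * (p * H2 * p)) + ε' := by
      have a1 : a' * b = a' * (p * H2 * p) - a' * (p * H2 * p - b) := by noncomm_ring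
      have a2 := (abs_le.1 (c.tr.abs_le (a' * (p * H2 * p - b)))).1
      have a3 : ‖a' * (p * H2 * p - b)‖ ≤ _ := norm_mul_le_l ha'n
      rw [a1, map_sub]; linarith
    have f6 : T (a' * (p * H2 * p)) ≤ T (a' * H2) + ε' + (K + L) * ε' := by
      have a1 : a' * (p * H2 * p) = a' * H2 - (a' * H2) * (1 - p) - a' * ((H2 * p - p * H2) * p) := by
        have : (H2 * p - p * H2) * p = H2 * (p * p) - p * H2 * p := by noncomm_ring
        rw [this, hp.mm]; noncomm_ring
      have a2 := (abs_le.1 (c.tr.abs_mul_le (a' * H2) hp.compl.nonneg')).1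
      have a3 := (abs_le.1 (c.tr.abs_le (a' * ((H2 * p - p * H2) * p)))).1
      have a4 : ‖a' * ((H2 * p - p * H2) * p)‖ ≤ ‖H2 * p - p * H2‖ :=
        (norm_mul_le_l ha'n).trans (norm_mul_le_r hp.norm_le)
      have a5 : ‖a' * H2‖ ≤ K + L := (norm_mul_le_l ha'n).trans hH2n
      have a6 : ‖a' * H2‖ * T (1 - p) ≤ (K + L) * ε' :=
        mul_le_mul a5 h3.le (c.tr.nonneg hp.compl.nonneg') (by positivity)
      rw [a1, map_sub, map_sub]; linarith
    have f7 : T (a' * H2) = T (a * (q * H * q)) := by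
      have a1 : a' * (1 - q) = 0 := by rw [ha', mul_assoc, mul_sub, mul_one, hq.mm, sub_self, mul_zero]
      rw [hH2, mul_add, mul_smul_comm, a1, smul_zero, add_zero, hH1, ← aq]
      congr 2
      simp only [← mul_assoc]
      rw [hq.mm, mul_assoc (q * H), hq.mm]
    have f8 : T (a' * ψ) ≤ (T (a * (q * H * q)) + ε' * (3 + K + L)) / η := by
      rw [le_div_iff₀ hη]; nlinarith
    have f9 : (T (a * (q * H * q)) + ε' * (3 + K + L)) / η ≤ T (a * (q * H * q)) / η + ε' * ((5 + K + L) / η) := by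
      rw [add_div, mul_div_assoc]
      gcongr
      norm_num
    have f10 : ε' * Z = ε' + ε' * ((5 + K + L) / η) := by rw [hZ]; ring
    rw [e0, e1, map_add, map_add]
    linarith
end cut9

set_option linter.unusedSectionVars false

section final10
variable {A : Type*} [CStarAlgebra A] [PartialOrder A] [StarOrderedRing A]
variable {α : A ≃⋆ₐ[ℂ] A} {T : A →ₗ[ℝ] ℝ}

def HH (α : A ≃⋆ₐ[ℂ] A) (n : ℕ) (E : A) : A := 1 - E + ∑ j ∈ Finset.Icc 1 n, (α ^ j) E

theorem HH_sum_nonneg (n : ℕ) {E : A} (h0 : 0 ≤ E) (h1 : E ≤ 1) :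
    0 ≤ ∑ j ∈ Finset.Icc 1 n, (α ^ j) E := Finset.sum_nonneg fun j _ => (alpha_unit (α ^ j) h0 h1).1

theorem HH_ge (n : ℕ) {E : A} (h0 : 0 ≤ E) (h1 : E ≤ 1) : 1 - E ≤ HH α n E :=
  le_add_of_nonneg_right (HH_sum_nonneg n h0 h1)

theorem HH_nonneg (n : ℕ) {E : A} (h0 : 0 ≤ E) (h1 : E ≤ 1) : 0 ≤ HH α n E :=
  (sub_nonneg.2 h1).trans (HH_ge n h0 h1)

theorem HH_ge' (n : ℕ) {E : A} (h0 : 0 ≤ E) (h1 : E ≤ 1) {j : ℕ} (hj1 : 1 ≤ j) (hj : j ≤ n) :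
    (α ^ j) E ≤ HH α n E := by
  refine le_trans ?_ (le_add_of_nonneg_left (sub_nonneg.2 h1))
  exact Finset.single_le_sum (f := fun j => (α ^ j) E) (fun j _ => (alpha_unit (α ^ j) h0 h1).1)
    (Finset.mem_Icc.2 ⟨hj1, hj⟩)

theorem HH_norm (n : ℕ) {E : A} (h0 : 0 ≤ E) (h1 : E ≤ 1) : ‖HH α n E‖ ≤ n + 1 := by
  have a1 : ‖1 - E‖ ≤ 1 := norm_le_one_of (sub_nonneg.2 h1) (sub_le_self _ h0)
  have a2 : ‖∑ j ∈ Finset.Icc 1 n, (α ^ j) E‖ ≤ n := by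
    refine (norm_sum_le_of_le _ (fun j _ => (norm_le_one_of (alpha_unit (α ^ j) h0 h1).1
      (alpha_unit (α ^ j) h0 h1).2))).trans ?_
    simp
  have := norm_add_le (1 - E) (∑ j ∈ Finset.Icc 1 n, (α ^ j) E)
  unfold HH
  linarith

theorem HH_comm (n : ℕ) {E a : A} {κ : ℝ}
    (h : ∀ j ≤ n, ‖E * (α ^ j).symm a - (α ^ j).symm a * E‖ ≤ κ) :
    ‖HH α n E * a - a * HH α n E‖ ≤ (n + 1) * κ := by
  have e : HH α n E * a - a * HH α n E = -(E * a - a * E) +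
      ∑ j ∈ Finset.Icc 1 n, ((α ^ j) E * a - a * (α ^ j) E) := by
    rw [Finset.sum_sub_distrib, ← Finset.sum_mul, ← Finset.mul_sum, HH]; noncomm_ring
  rw [e]
  refine (norm_add_le _ _).trans ?_
  have a0 : ‖E * a - a * E‖ ≤ κ := h 0 (Nat.zero_le _)
  have a1 : ‖∑ j ∈ Finset.Icc 1 n, ((α ^ j) E * a - a * (α ^ j) E)‖ ≤ n * κ := by
    refine (norm_sum_le_of_le (f := fun j => ((α ^ j) E * a - a * (α ^ j) E)) _ (n := fun _ => κ) (fun j hj => ?_)).trans ?_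
    · rw [comm_alpha]; exact h j (Finset.mem_Icc.1 hj).2
    · simp
  rw [norm_neg]; linarith

theorem T_HH (n : ℕ) (E : A) : T (E * HH α n E) = DD α T n E := by
  rw [HH, DD, mul_add, map_add, Finset.mul_sum, map_sum]

variable {B : NonUnitalStarSubalgebra ℂ A} {p : A} {N : ℕ} {v : Fin N → A} {r : Fin N → Fin N} {Q : Fin N → A}

theorem MU.norm_eHe (h : MU B p v r Q) {y : Fin N → A} (hy : ∀ k, IsProjection (y k))
    (hyQ : ∀ k, y k * Q k = y k) {H : A} (hH : 0 ≤ H) {η κ : ℝ} (hη : 0 ≤ η)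
    (hc : ∀ s, ‖H * v s - v s * H‖ ≤ κ) (hyH : ∀ k, y k * H * y k ≤ η • (1 : A)) :
    ‖eMU v r y * H * eMU v r y‖ ≤ η + N * κ := by
  set e := eMU v r y with he
  have hep : IsProjection e := h.e_proj y hyQ hy
  have hev : ∀ t, e * v t = v t * y (r t) := by
    intro t
    rw [he, eMU, Finset.sum_mul, Finset.sum_eq_single_of_mem t (Finset.mem_univ _)]
    · rw [mul_assoc, h.vv, mul_assoc, hyQ]
    · intro s _ hst
      rw [mul_assoc, h.orth s t hst, mul_zero]
  have e1 : e * H * e = ∑ t, v t * (y (r t) * H * y (r t)) * star (v t) +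
      ∑ t, e * (H * v t - v t * H) * (y (r t) * star (v t)) := by
    rw [← Finset.sum_add_distrib]
    conv_lhs => rw [he, eMU, ← eMU, ← he]
    have : e * H * e = ∑ t, e * H * (v t * y (r t) * star (v t)) := by
      rw [← Finset.mul_sum]; rfl
    rw [this]
    refine Finset.sum_congr rfl fun t _ => ?_
    have : v t * (y (r t) * H * y (r t)) * star (v t) = (e * v t) * H * (y (r t) * star (v t)) := by
      rw [hev]; noncomm_ring
    rw [this]; noncomm_ring
  have n1 : ‖∑ t, v t * (y (r t) * H * y (r t)) * star (v t)‖ ≤ η := by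
    refine norm_le_of_le_smul hη (Finset.sum_nonneg fun t _ => conj_nonneg_r ?_ _) ?_
    · have := conj_nonneg' hH (y (r t)); rwa [(hy _).st] at this
    · have : ∀ t ∈ Finset.univ, v t * (y (r t) * H * y (r t)) * star (v t) ≤ η • (v t * star (v t)) := by
        intro t _
        have := conj_mono_r (hyH (r t)) (v t)
        rwa [mul_smul_comm, mul_one, smul_mul_assoc] at this
      refine (Finset.sum_le_sum this).trans ?_
      rw [← Finset.smul_sum, h.sum]
      exact smul_le_smul_of_nonneg_left h.pp.le_one' hη
  have n2 : ‖∑ t, e * (H * v t - v t * H) * (y (r t) * star (v t))‖ ≤ N * κ := by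
    refine (norm_sum_le_of_le _ (n := fun _ => κ) (fun t _ => ?_)).trans (by simp)
    refine (norm_conj_le hep.norm_le ?_).trans (hc t)
    refine (norm_mul_le_l (hy _).norm_le).trans ?_
    rw [norm_star]; exact h.norm_v t
  rw [e1]
  exact (norm_add_le _ _).trans (add_le_add n1 n2)

theorem tr_err (hT : IsTr T) {x y u : A} {κ : ℝ} (h : x = y + u) (hu : ‖u‖ ≤ κ) : |T x - T y| ≤ κ := by
  rw [h, map_add, add_sub_cancel_left]; exact (hT.abs_le u).trans hu

theorem MU.tr_est (h : MU B p v r Q) (hT : IsTr T) {y : Fin N → A} (hy : ∀ k, IsProjection (y k))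
    (hyQ : ∀ k, Q k * y k = y k) {E H : A} (hE : ‖E‖ ≤ 1) {η κ ε K : ℝ} (hη : 0 < η) (hK : 1 ≤ K)
    (hHK : ‖H‖ ≤ K)
    (hcH : ∀ s, ‖H * v s - v s * H‖ ≤ K * κ) (hcE : ∀ s, ‖E * star (v s) - star (v s) * E‖ ≤ κ)
    (hcut : ∀ k, T (E * (Q k - y k)) ≤ T (E * (Q k * H * Q k)) / η + ε) :
    T (E * p) - T (E * eMU v r y) ≤ T (E * H * p) / η + N * (2 * κ + 2 * (K * κ) / η + ε) := by
  have key : ∀ s ∈ Finset.univ, T (E * (v s * star (v s))) - T (E * (v s * y (r s) * star (v s))) ≤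
      T (E * H * (v s * star (v s))) / η + (2 * κ + 2 * (K * κ) / η + ε) := by
    intro s _
    have hκ : 0 ≤ κ := (norm_nonneg _).trans (hcE s)
    have hv := h.norm_v s
    have hv' : ‖star (v s)‖ ≤ 1 := by rwa [norm_star]
    set u := v s
    set q := Q (r s)
    have hq : IsProjection q := h.Qp _
    have hqq : star u * u = q := h.vv s
    have huq : u * q = u := h.vQ s
    set z := y (r s)
    have hz := (hy (r s)).norm_le
    have hqz : q * z = z := hyQ (r s)
    have i1 : |T (E * (u * star u)) - T (E * q)| ≤ κ := by
      have : T (E * (u * star u)) = T (star u * E * u) := by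
        rw [← mul_assoc, hT.comm, ← mul_assoc]
      rw [this]
      refine tr_err hT (u := -((E * star u - star u * E) * u)) ?_ ?_
      · rw [← hqq]; noncomm_ring
      · rw [norm_neg]; exact (norm_mul_le_r hv).trans (hcE s)
    have i2 : |T (E * (u * z * star u)) - T (E * z)| ≤ κ := by
      have : T (E * (u * z * star u)) = T (star u * E * u * z) := by
        rw [← mul_assoc, hT.comm]; simp only [mul_assoc]
      rw [this]
      refine tr_err hT (u := -((E * star u - star u * E) * (u * z))) ?_ ?_
      · nth_rewrite 2 [← hqz]; rw [← hqq]; noncomm_ring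
      · rw [norm_neg]; refine (norm_mul_le_r ?_).trans (hcE s)
        exact (norm_mul_le_l hv).trans hz
    have i3 : |T (E * (q * H * q)) - T (E * star u * H * u)| ≤ K * κ := by
      refine tr_err hT (u := -(E * star u * (H * u - u * H) * q)) ?_ ?_
      · calc E * (q * H * q) = E * (star u * u * H * q) := by rw [hqq]
          _ = E * star u * H * (u * q) + -(E * star u * (H * u - u * H) * q) := by noncomm_ring
          _ = _ := by rw [huq]
      · rw [norm_neg]; refine (norm_conj_le ?_ hq.norm_le).trans (hcH s)
        exact (norm_mul_le_l hE).trans hv'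
    have i4 : |T (E * star u * H * u) - T (E * H * (u * star u))| ≤ K * κ := by
      have : T (E * H * (u * star u)) = T (star u * E * H * u) := by
        rw [← mul_assoc, hT.comm]; simp only [mul_assoc]
      rw [this]
      refine tr_err hT (u := (E * star u - star u * E) * H * u) (by noncomm_ring) ?_
      refine (norm_mul_le_r hv).trans ((norm_mul_le _ _).trans ?_)
      rw [mul_comm]
      exact mul_le_mul hHK (hcE s) (norm_nonneg _) (by linarith)
    have i5 := hcut (r s)
    change T (E * (q - z)) ≤ T (E * (q * H * q)) / η + ε at i5
    rw [mul_sub, map_sub] at i5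
    have i6 : T (E * (q * H * q)) / η ≤ (T (E * H * (u * star u)) + 2 * (K * κ)) / η := by
      apply div_le_div_of_nonneg_right _ hη.le
      linarith [(abs_le.1 i3).2, (abs_le.1 i4).2]
    rw [add_div] at i6
    linarith [(abs_le.1 i1).2, (abs_le.1 i2).1]
  have hs := Finset.sum_le_sum key
  rw [Finset.sum_sub_distrib, Finset.sum_add_distrib, ← map_sum, ← map_sum, ← Finset.mul_sum, ← Finset.mul_sum,
    ← Finset.sum_div, ← map_sum, ← Finset.mul_sum, h.sum, Finset.sum_const, Finset.card_univ, Fintype.card_fin,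
    nsmul_eq_mul] at hs
  exact hs

theorem norm_sqrt_bound {e X H : A} {μ : ℝ} (hμ : 0 ≤ μ) (he : IsProjection e) (hX0 : 0 ≤ X) (hX1 : X ≤ 1)
    (hXH : X ≤ H) (h : ‖e * H * e‖ ≤ μ ^ 2) : ‖X * e‖ ≤ μ := by
  obtain ⟨s, hs0, hs⟩ := exists_sqrt hX0
  have hst := sa_of_nonneg hs0
  have hsn : ‖s‖ ≤ 1 := by
    have h1 : ‖s‖ * ‖s‖ = ‖X‖ := by
      rw [← hs]; nth_rewrite 3 [← hst]; rw [CStarRing.norm_star_mul_self]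
    have := norm_le_one_of hX0 hX1
    nlinarith [norm_nonneg s]
  have h0 : 0 ≤ e * X * e := by have := conj_nonneg' hX0 e; rwa [he.st] at this
  have h1 : e * X * e ≤ e * H * e := by have := conj_mono hXH e; rwa [he.st] at this
  have h2 : ‖e * X * e‖ ≤ μ ^ 2 := (CStarAlgebra.norm_le_norm_of_nonneg_of_le h0 h1).trans h
  have h3 : e * X * e = star (s * e) * (s * e) := by
    rw [star_mul, he.st, hst, ← hs]; noncomm_ring
  rw [h3, CStarRing.norm_star_mul_self, ← sq] at h2
  have h4 := (sq_le_sq₀ (norm_nonneg _) hμ).1 h2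
  rw [← hs, mul_assoc]
  exact (norm_mul_le_l hsn).trans h4

theorem Ctx.exists_e (c : Ctx α T) (n : ℕ) (F : Finset A) {ε ω δ : ℝ} (hε : 0 < ε) (hω : 0 < ω) (hδ : 0 < δ) :
    ∃ e, IsProjection e ∧ Cen F ε e ∧ (∀ j, 1 ≤ j → j ≤ n → ‖e * (α ^ j) e‖ ≤ ω) ∧ 1 / (n + 1) - δ ≤ T e := by
  classical
  set η := ω ^ 2 / 12 with hη
  have hη0 : 0 < η := by positivity
  have hn : (0:ℝ) < n + 1 := by positivity
  set ε' := min (ε / 4) (min (δ / 6) (η * δ / (6 * (n + 1)))) with hε'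
  have hε'0 : 0 < ε' := by
    simp only [hε', lt_min_iff]; exact ⟨by positivity, by positivity, by positivity⟩
  have hε'1 : ε' ≤ ε / 4 := min_le_left _ _
  have hε'2 : ε' ≤ δ / 6 := (min_le_right _ _).trans (min_le_left _ _)
  have hε'3 : (n + 1) * ε' / η ≤ δ / 6 := by
    have : ε' ≤ η * δ / (6 * (n + 1)) := (min_le_right _ _).trans (min_le_right _ _)
    rw [le_div_iff₀ (by positivity)] at this
    rw [div_le_iff₀ hη0]; linarith
  obtain ⟨B, p, hfd, hp, hpB, hu, h1, h2, h3⟩ := c.tr0 F hε'0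
  obtain ⟨N, v, r, Q, h⟩ := exists_MU B hp hpB
  set Z : ℝ := N * (n + 1) + N * (2 + 2 * (n + 1) / η) + 1 with hZ
  have hZ1 : (N:ℝ) * (n + 1) ≤ Z := by
    have : 0 ≤ (N:ℝ) * (2 + 2 * (n + 1) / η) := by positivity
    linarith
  have hZ2 : (N:ℝ) * (2 + 2 * (n + 1) / η) ≤ Z := by
    have : 0 ≤ (N:ℝ) * (n + 1) := by positivity
    linarith
  have hZ0 : 0 < Z := by positivity
  set κ := min (η / Z) (δ / (6 * Z)) with hκ
  have hκ0 : 0 < κ := lt_min (by positivity) (by positivity)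
  have hκ1 : Z * κ ≤ η := by
    have : κ ≤ η / Z := min_le_left _ _
    rw [le_div_iff₀ hZ0] at this; linarith
  have hκ2 : Z * κ ≤ δ / 6 := by
    have : κ ≤ δ / (6 * Z) := min_le_right _ _
    rw [le_div_iff₀ (by positivity)] at this; linarith
  set F1 : Finset A := ((Finset.range (n + 1)) ×ˢ (Finset.univ : Finset (Fin N))).image (fun x => (α ^ x.1).symm (v x.2)) ∪
    ((Finset.univ : Finset (Fin N)).image fun s => star (v s)) with hF1
  obtain ⟨E, hE0, hE1, hEc, hET, hED⟩ := c.tower n (ρ := δ / 6) (lam := η * δ / 6) (by positivity) (by positivity) F1 hκ0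
  have hEn := norm_le_one_of hE0 hE1
  set H := HH α n E with hH
  have hH0 : 0 ≤ H := HH_nonneg n hE0 hE1
  have hHn : ‖H‖ ≤ n + 1 := HH_norm n hE0 hE1
  have hcH : ∀ s, ‖H * v s - v s * H‖ ≤ (n + 1) * κ := by
    intro s
    refine HH_comm n fun j hj => (hEc _ ?_).le
    rw [hF1]; apply Finset.mem_union_left
    exact Finset.mem_image.2 ⟨(j, s), by simp only [Finset.mem_product, Finset.mem_range, Finset.mem_univ, and_true]; omega, rfl⟩
  have hcE : ∀ s, ‖E * star (v s) - star (v s) * E‖ ≤ κ := by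
    intro s
    refine (hEc _ ?_).le
    rw [hF1]; apply Finset.mem_union_right
    exact Finset.mem_image.2 ⟨s, Finset.mem_univ _, rfl⟩
  have hε3 : 0 < δ / (6 * ((N:ℝ) + 1)) := by positivity
  choose y hy hQy hyH hyT using fun k => c.cut (h.Qp k) hH0 hE0 hE1 hη0 hε3
  have hyQ : ∀ k, y k * Q k = y k := fun k => by
    have := congrArg star (hQy k); rwa [star_mul, (hy k).st, (h.Qp k).st] at this
  set e := eMU v r y with he
  have hep : IsProjection e := h.e_proj y hyQ hy
  have heH : ‖e * H * e‖ ≤ (ω / 2) ^ 2 := by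
    have := h.norm_eHe hy hyQ hH0 (by positivity) hcH hyH
    have a2 := mul_le_mul_of_nonneg_right hZ1 hκ0.le
    refine this.trans ?_
    have a3 : (ω / 2) ^ 2 = 3 * η := by rw [hη]; ring
    rw [a3]; linarith
  have heE : ‖(1 - E) * e‖ ≤ ω / 2 :=
    norm_sqrt_bound (by positivity) hep (sub_nonneg.2 hE1) (sub_le_self _ hE0) (HH_ge n hE0 hE1) heH
  refine ⟨e, hep, ?_, ?_, ?_⟩
  · intro a ha
    have := near_central (B := B) hp (h.pe y) (h.ep y) hep.norm_le (fun b hb => h.e_comm hu y hQy hyQ hb)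
      (h1 a ha) (h2 a ha)
    exact this.trans_le (by linarith)
  · intro j hj1 hj
    have hu := alpha_unit (α ^ j) hE0 hE1
    have a1 : ‖(α ^ j) E * e‖ ≤ ω / 2 :=
      norm_sqrt_bound (by positivity) hep hu.1 hu.2 (HH_ge' n hE0 hE1 hj1 hj) heH
    have a2 : ‖e * (α ^ j) E‖ ≤ ω / 2 := by
      rw [← norm_star, star_mul, hep.st, sa_of_nonneg hu.1]; exact a1
    have a3 : ‖(α ^ j) ((1 - E) * e)‖ ≤ ω / 2 := by rw [norm_alpha]; exact heE
    have a4 : e * (α ^ j) e = e * (α ^ j) E * (α ^ j) e + e * (α ^ j) ((1 - E) * e) := by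
      rw [map_mul, map_sub, map_one]; noncomm_ring
    rw [a4]
    refine (norm_add_le _ _).trans ?_
    have a5 := (norm_mul_le_r (a := e * (α ^ j) E) (alpha_proj hep (α ^ j)).norm_le).trans a2
    have a6 := (norm_mul_le_l (a := (α ^ j) ((1 - E) * e)) hep.norm_le).trans a3
    linarith
  · have t1 := h.tr_est c.tr hy hQy hEn hη0 (K := n + 1) (by linarith [(Nat.cast_nonneg n : (0:ℝ) ≤ n)]) hHn hcH hcE hyT
    have t2 : T (E * e) ≤ T e := by
      have := c.tr.mul_mono_r hep.nonneg' hE1; rwa [one_mul] at this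
    have t3 : T E - ε' ≤ T (E * p) := by
      have a1 := (abs_le.1 (c.tr.abs_mul_le E hp.compl.nonneg')).2
      have a2 := mul_le_of_le_one_left (c.tr.nonneg hp.compl.nonneg') hEn
      rw [mul_sub, mul_one, map_sub] at a1
      linarith
    have t4 : T (E * H * p) ≤ η * δ / 6 + (n + 1) * ε' := by
      have a1 := (abs_le.1 (c.tr.abs_mul_le (E * H) hp.compl.nonneg')).1
      have a2 : ‖E * H‖ * T (1 - p) ≤ (n + 1) * ε' :=
        mul_le_mul ((norm_mul_le_l hEn).trans hHn) h3.le (c.tr.nonneg hp.compl.nonneg') hn.le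
      have a3 : T (E * H * (1 - p)) = DD α T n E - T (E * H * p) := by
        rw [mul_sub, mul_one, map_sub, ← T_HH]
      linarith
    have t5 : T (E * H * p) / η ≤ δ / 6 + δ / 6 := by
      refine (div_le_div_of_nonneg_right t4 hη0.le).trans ?_
      rw [add_div]
      have : η * δ / 6 / η = δ / 6 := by field_simp
      linarith
    have t6 : (N:ℝ) * (2 * κ + 2 * ((n + 1) * κ) / η + δ / (6 * (N + 1))) ≤ δ / 6 + δ / 6 := by
      have a1 : (N:ℝ) * (δ / (6 * (N + 1))) ≤ δ / 6 := by
        rw [mul_div_assoc', div_le_div_iff₀ (by positivity) (by norm_num)]; nlinarith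
      have a2 := mul_le_mul_of_nonneg_right hZ2 hκ0.le
      have a3 : (N:ℝ) * (2 * κ + 2 * ((n + 1) * κ) / η + δ / (6 * (N + 1))) =
        N * (2 + 2 * (n + 1) / η) * κ + N * (δ / (6 * (N + 1))) := by ring
      rw [a3]; linarith
    linarith

theorem Ctx.rokhlin (c : Ctx α T) : TracialRokhlin α := by
  intro F ε hε n x hx hx0
  classical
  obtain ⟨δ, hδ, hcmp⟩ := c.comparison hx hx0
  set R : ℝ := 1 + ∑ a ∈ F, ‖a‖ with hR
  have hRs : 0 ≤ ∑ a ∈ F, ‖a‖ := Finset.sum_nonneg fun _ _ => norm_nonneg _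
  have hR1 : 1 ≤ R := by linarith
  have hRa : ∀ a ∈ F, ‖a‖ ≤ R := fun a ha => by
    have := Finset.single_le_sum (f := fun a : A => ‖a‖) (fun _ _ => norm_nonneg _) ha
    linarith
  have hn : (0:ℝ) < n + 1 := by positivity
  set μ := min (ε / (4 * R)) (δ / (4 * (n + 1))) with hμ
  have hμ0 : 0 < μ := lt_min (by positivity) (by positivity)
  have hμ1 : 4 * (μ * R) ≤ ε := by
    have : μ ≤ ε / (4 * R) := min_le_left _ _
    rw [le_div_iff₀ (by positivity)] at this; linarith
  have hμ2 : (n + 1) * μ ≤ δ / 4 := by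
    have : μ ≤ δ / (4 * (n + 1)) := min_le_right _ _
    rw [le_div_iff₀ (by positivity)] at this; linarith
  have hμ3 : 4 * μ ≤ ε := by nlinarith
  obtain ⟨ω, hω, horth⟩ := orthogonalize (A := A) (n + 1) μ hμ0
  obtain ⟨e, he, heF, heω, heT⟩ := c.exists_e n
    ((Finset.range (n + 1) ×ˢ F).image fun x => (α ^ x.1).symm x.2) (ε := ε / 2) (by positivity) hω hμ0
  have hpo : ∀ i j, i < j → j < n + 1 → ‖(α ^ i) e * (α ^ j) e‖ ≤ ω := by
    intro i j hij hj
    have e1 : (α ^ j) e = (α ^ i) ((α ^ (j - i)) e) := by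
      have : α ^ j = α ^ i * α ^ (j - i) := by rw [← pow_add]; congr 1; omega
      rw [this]; rfl
    rw [e1, ← map_mul, norm_alpha]
    exact heω _ (by omega) (by omega)
  have hpp : ∀ i, IsProjection ((α ^ i) e) := fun i => alpha_proj he _
  obtain ⟨f, hf1, hf2, hf3⟩ := horth (fun i => (α ^ i) e) hpp (by
    intro i j hi hj hij
    rcases lt_or_gt_of_ne hij with h | h
    · exact hpo i j h hj
    · rw [← norm_star, star_mul, (hpp i).st, (hpp j).st]; exact hpo j i h hi)
  refine ⟨fun j => f j, fun j => hf1 j j.2, fun i j hij => hf2 i j i.2 j.2 (fun h => hij (Fin.ext h)), ?_, ?_, ?_⟩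
  · intro j hj
    have e1 : ((j + 1 : Fin (n + 1)) : ℕ) = j + 1 := Fin.val_add_one_of_lt (Fin.lt_def.2 (by simpa using hj))
    simp only [e1]
    have e2 : α (f j) - f (j + 1) = α (f j - (α ^ (j : ℕ)) e) - (f (j + 1) - (α ^ ((j : ℕ) + 1)) e) := by
      have : (α ^ ((j : ℕ) + 1)) e = α ((α ^ (j : ℕ)) e) := by rw [pow_succ']; rfl
      rw [this, map_sub]; abel
    rw [e2]
    refine (norm_sub_le _ _).trans_lt ?_
    rw [norm_alpha]
    have a1 := hf3 j j.2
    have a2 := hf3 (j + 1) (by omega)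
    linarith
  · intro j a ha
    have e1 : f j * a - a * f j = ((α ^ (j : ℕ)) e * a - a * (α ^ (j : ℕ)) e) +
        ((f j - (α ^ (j : ℕ)) e) * a - a * (f j - (α ^ (j : ℕ)) e)) := by noncomm_ring
    have a1 := hf3 j j.2
    have a2 : ‖(f j - (α ^ (j : ℕ)) e) * a‖ ≤ μ * R :=
      (norm_mul_le _ _).trans (mul_le_mul a1 (hRa a ha) (norm_nonneg _) hμ0.le)
    have a3 : ‖a * (f j - (α ^ (j : ℕ)) e)‖ ≤ R * μ :=
      (norm_mul_le _ _).trans (mul_le_mul (hRa a ha) a1 (norm_nonneg _) (by linarith))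
    have a4 : ‖(α ^ (j : ℕ)) e * a - a * (α ^ (j : ℕ)) e‖ < ε / 2 := by
      rw [comm_alpha]
      refine heF _ (Finset.mem_image.2 ⟨(j, a), ?_, rfl⟩)
      simp only [Finset.mem_product, Finset.mem_range]
      exact ⟨j.2, ha⟩
    rw [e1]
    refine (norm_add_le _ _).trans_lt ?_
    have a5 := norm_sub_le ((f j - (α ^ (j : ℕ)) e) * a) (a * (f j - (α ^ (j : ℕ)) e))
    linarith
  · apply hcmp
    · apply IsProjection.compl
      exact IsProjection.sum' _ _ (fun j _ => hf1 j j.2)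
        (fun i _ j _ hij => hf2 i j i.2 j.2 (fun h => hij (Fin.ext h)))
    · have e1 : ∀ j ∈ (Finset.univ : Finset (Fin (n + 1))), 1 / (n + 1) - μ - μ ≤ T (f j) := by
        intro j _
        have a1 := (abs_le.1 (c.tr.abs_le (f j - (α ^ (j : ℕ)) e))).1
        have a2 := hf3 j j.2
        rw [map_sub, c.inv_pow] at a1
        linarith
      have e2 := Finset.sum_le_sum e1
      rw [Finset.sum_const, Finset.card_univ, Fintype.card_fin, nsmul_eq_mul] at e2
      rw [map_sub, c.tr.one, map_sum]
      push_cast at e2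
      have e3 : ((n:ℝ) + 1) * (1 / (n + 1) - μ - μ) = 1 - 2 * ((n + 1) * μ) := by field_simp; ring
      linarith
end final10

set_option linter.unusedSectionVars false

theorem reTr_isTr {A : Type*} [CStarAlgebra A] [PartialOrder A] [StarOrderedRing A]
    (τ : A →ₗ[ℂ] ℂ) (hτ : IsTracialState τ) :
    IsTr (Complex.reLm ∘ₗ τ.restrictScalars ℝ) := by
  obtain ⟨hpos, hone, hcomm⟩ := hτ
  refine ⟨fun x => ?_, ?_, fun x y => ?_, fun x => ?_⟩
  · obtain ⟨r, hr, h⟩ := hpos x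
    simp [h, hr]
  · simp [hone]
  · simp [hcomm x y]
  · obtain ⟨r, hr, h⟩ := hpos x
    obtain ⟨s, hs, h2⟩ := hpos (x + Complex.I • (1 : A))
    have e : star (x + Complex.I • (1 : A)) * (x + Complex.I • (1 : A))
        = star x * x + Complex.I • star x - Complex.I • x + 1 := by
      simp only [star_add, star_smul, star_one, add_mul, mul_add, mul_smul_comm, smul_mul_assoc,
        mul_one, one_mul, smul_smul]
      simp
      have hII : Complex.I • Complex.I • (1 : A) = -1 := by
        rw [smul_smul, Complex.I_mul_I, neg_smul, one_smul]
      rw [hII]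
      abel
    rw [e, map_add, map_sub, map_add, map_smul, map_smul, h, hone] at h2
    have := congrArg Complex.im h2
    simp at this
    simp
    linarith

/-- Complex extension of a real functional. -/
noncomputable def cExt {A : Type*} [CStarAlgebra A] (T : A →ₗ[ℝ] ℝ) : A →ₗ[ℂ] ℂ where
  toFun x := ⟨T x, - T (Complex.I • x)⟩
  map_add' x y := by
    apply Complex.ext <;> simp
    ring
  map_smul' c x := by
    have h1 : c • x = c.re • x + c.im • (Complex.I • x) := by
      conv_lhs => rw [← Complex.re_add_im c]
      rw [add_smul, mul_smul]
      rfl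
    have h2 : Complex.I • (c • x) = c.re • (Complex.I • x) - c.im • x := by
      rw [h1, smul_add, smul_comm Complex.I c.re, smul_comm Complex.I c.im, smul_smul Complex.I]
      simp [sub_eq_add_neg]
    apply Complex.ext
    · simp only [h1, map_add, map_smul]
      simp
    · simp only [h2, map_sub, map_smul]
      simp
      ring

theorem cExt_isTracial {A : Type*} [CStarAlgebra A] [PartialOrder A] [StarOrderedRing A]
    (T : A →ₗ[ℝ] ℝ) (h : IsTr T) : IsTracialState (cExt T) := by
  have key : ∀ a : A, star a = a → T (Complex.I • a) = 0 := by
    intro a ha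
    have := h.tstar (Complex.I • a)
    rw [star_smul, ha] at this
    simp at this
    linarith
  refine ⟨fun a => ⟨T (star a * a), h.pos a, ?_⟩, ?_, fun a b => ?_⟩
  · apply Complex.ext
    · simp [cExt]
    · simp [cExt, key (star a * a) (by simp)]
  · apply Complex.ext
    · simp [cExt, h.one]
    · simp [cExt, key 1 (by simp)]
  · apply Complex.ext
    · simp [cExt, h.comm a b]
    · have := h.comm (Complex.I • a) b
      rw [smul_mul_assoc, mul_smul_comm] at this
      simp [cExt, this]

theorem faithful_of_simple {A : Type*} [CStarAlgebra A] [PartialOrder A] [StarOrderedRing A]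
    (T : A →ₗ[ℝ] ℝ) (h : IsTr T) (hs : IsSimpleCStar A) (x : A)
    (hx : T (star x * x) = 0) : x = 0 := by
  have hmul : ∀ x y : A, n2 T y = 0 → n2 T (x * y) = 0 := fun x y hy => by
    have := h.n2_mul_le x y
    rw [hy, mul_zero] at this
    exact le_antisymm this (n2_nonneg _)
  let I : TwoSidedIdeal A := TwoSidedIdeal.mk' {y : A | n2 T y = 0}
    (by simp [n2])
    (fun {x y} hx hy => by
      have := h.n2_add x y
      simp only [Set.mem_ofPred_eq] at hx hy
      rw [hx, hy, add_zero] at this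
      exact le_antisymm this (n2_nonneg _))
    (fun {x} hx => by
      simp only [Set.mem_ofPred_eq] at hx ⊢
      rw [IsTr.n2_neg, hx])
    (fun {x y} hy => hmul x y hy)
    (fun {x y} hx => by
      simp only [Set.mem_ofPred_eq] at hx ⊢
      rw [← h.n2_star, star_mul]
      exact hmul _ _ (by rw [h.n2_star, hx]))
  have hI : (I : Set A) = {y : A | n2 T y = 0} := by
    ext y
    exact TwoSidedIdeal.mem_mk' _ _ _ _ _ _ y
  have hc : Continuous (T : A → ℝ) :=
    AddMonoidHomClass.continuous_of_bound T 1 (fun x => by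
      rw [Real.norm_eq_abs, one_mul]; exact h.abs_le x)
  have hcl : IsClosed (I : Set A) := by
    rw [hI]
    apply isClosed_eq _ continuous_const
    unfold n2
    fun_prop
  have hxI : x ∈ (I : Set A) := by
    rw [hI]
    simp [n2, hx]
  rcases hs I hcl with h0 | h1
  · rw [h0] at hxI
    exact hxI
  · have : (1 : A) ∈ (I : Set A) := by rw [h1]; trivial
    rw [hI] at this
    simp [n2, h.one] at this

/-- Let `A` be a unital separable simple C*-algebra with `TR(A) = 0` and
a unique tracial state. If `α ^ m` is uniformly outer for every nonzero integer `m`, then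
`α` has the tracial Rokhlin property. -/
theorem stmt11 {A : Type*} [CStarAlgebra A] [TopologicalSpace.SeparableSpace A]
    (hsimple : IsSimpleCStar A) (hTR : TracialRankZero A)
    (huniq : ∃! τ : A →ₗ[ℂ] ℂ, IsTracialState τ)
    (α : A ≃⋆ₐ[ℂ] A)
    (hout : ∀ m : ℤ, m ≠ 0 → UniformlyOuter (autZPow α m)) :
    TracialRokhlin α := by
  letI := CStarAlgebra.spectralOrder A
  haveI := CStarAlgebra.spectralOrderedRing A
  obtain ⟨τ, hτ, hu⟩ := huniq
  set T : A →ₗ[ℝ] ℝ := Complex.reLm ∘ₗ τ.restrictScalars ℝ with hT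
  have htr : IsTr T := reTr_isTr τ hτ
  have hun : ∀ T' : A →ₗ[ℝ] ℝ, IsTr T' → T' = T := by
    intro T' h'
    have := hu _ (cExt_isTracial T' h')
    ext x
    have h2 := congrArg Complex.re (LinearMap.congr_fun this x)
    simpa [hT, cExt] using h2
  have hinv : ∀ x, T (α x) = T x := by
    let αr : A →ₗ[ℝ] A :=
      { toFun := α, map_add' := map_add α,
        map_smul' := fun c x => by
          have : (c • x : A) = (c : ℂ) • x := rfl
          rw [this, map_smul]; rfl }
    have h3 : IsTr (T ∘ₗ αr) := by
      refine ⟨fun x => ?_, ?_, fun x y => ?_, fun x => ?_⟩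
      · change 0 ≤ T (α (star x * x))
        rw [map_mul, map_star]; exact htr.pos _
      · change T (α 1) = 1
        rw [map_one]; exact htr.one
      · change T (α (x * y)) = T (α (y * x))
        rw [map_mul α, map_mul α]; exact htr.comm _ _
      · change T (α (star x)) = T (α x)
        rw [map_star]; exact htr.tstar _
    intro x
    exact LinearMap.congr_fun (hun _ h3) x
  exact Ctx.rokhlin (T := T) ⟨htr, hinv, faithful_of_simple T htr hsimple, hun, hsimple, hTR, hout⟩
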